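/- arXiv:2412.11505 — 7 statements merged into one kernel-verified Lean document; each statement's English description precedes it below -/
import Mathlib

section
/- For every z* ∈ Zer(M+F), every λ with 0 ≤ λ ≤ α − 1 and every s with 1 < s < 2, the following identity holds for all k ≥ 1: E_{λ,s,k+1} − E_{λ,s,k} = −4(c−1)λγ⟨z_{k+1} − z*, v_{k+1}⟩ + 2(λ + 1 − α)(2k + α + 1)‖z_{k+1} − z_k‖² + 2γ(((2−s)λ + s(λ + 1 − α) + s − 2c)k + 2λα + s − 2αc)⟨z_{k+1} − z_k, v_{k+1}⟩ − 2γ(k+α)((2−s)k + 2(α−c))⟨z_{k+1} − z_k, v_{k+1} − v_k⟩ − γ²(k+α)((2−s)k + 2(α−c))‖v_{k+1} − v_k‖² + γ²((1−c)(2sk + 2c + s) + s(α−c))‖v_{k+1}‖². -/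
open scoped RealInnerProductSpace Pointwise
open Filter

/-- The energy difference identity after the momentum term `κ (z_κ - z_{κ-1})` has been eliminated,
written in terms of `a = z_{κ+1} - z*`, `d = z_{κ+1} - z_κ`, `V = v_{κ+1}` and `G = v_{κ+1} - v_κ`. -/
theorem energy_difference_identity
    {H : Type*} [NormedAddCommGroup H] [InnerProductSpace ℝ H]
    (α c γ lam s κ : ℝ) (a d V G : H) :
    ((1 / 2) * ‖(2 * lam) • a + (2 * (κ + 1)) • d + (s * γ * (κ + 1)) • V‖ ^ 2
      + 2 * lam * (α - 1 - lam) * ‖a‖ ^ 2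
      + 2 * lam * γ * ((2 - s) * (κ + 1) + 2 * (α - c)) * ⟪a, V⟫
      + (1 / 2) * γ ^ 2 * ((2 - s) * (κ + 1) + 2 * (α - c)) * (s * (κ + 1) + 2 * c) * ‖V‖ ^ 2)
    - ((1 / 2) * ‖(2 * lam) • (a - d)
          + (2 : ℝ) • ((κ + α) • d + (c * γ) • (V - G) + ((κ + α) * γ) • G)
          + (s * γ * κ) • (V - G)‖ ^ 2
      + 2 * lam * (α - 1 - lam) * ‖a - d‖ ^ 2
      + 2 * lam * γ * ((2 - s) * κ + 2 * (α - c)) * ⟪a - d, V - G⟫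
      + (1 / 2) * γ ^ 2 * ((2 - s) * κ + 2 * (α - c)) * (s * κ + 2 * c) * ‖V - G‖ ^ 2) =
      -(4 * (c - 1) * lam * γ) * ⟪a, V⟫
      + 2 * (lam + 1 - α) * (2 * κ + α + 1) * ‖d‖ ^ 2
      + 2 * γ * (((2 - s) * lam + s * (lam + 1 - α) + s - 2 * c) * κ
          + 2 * lam * α + s - 2 * α * c) * ⟪d, V⟫
      - 2 * γ * (κ + α) * ((2 - s) * κ + 2 * (α - c)) * ⟪d, G⟫
      - γ ^ 2 * (κ + α) * ((2 - s) * κ + 2 * (α - c)) * ‖G‖ ^ 2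
      + γ ^ 2 * ((1 - c) * (2 * s * κ + 2 * c + s) + s * (α - c)) * ‖V‖ ^ 2 := by
  simp only [← real_inner_self_eq_norm_sq, inner_add_left, inner_add_right, inner_sub_left,
    inner_sub_right, real_inner_smul_left, real_inner_smul_right]
  rw [real_inner_comm a d, real_inner_comm a V, real_inner_comm a G, real_inner_comm d V,
    real_inner_comm d G, real_inner_comm V G]
  ring

theorem stmt_1
    {H : Type*} [NormedAddCommGroup H] [InnerProductSpace ℝ H] [CompleteSpace H]
    (M : H → Set H) (F : H → H) (L α c γ : ℝ)
    (hM : ∀ z y u' v', u' ∈ M z → v' ∈ M y → 0 ≤ ⟪v' - u', y - z⟫)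
    (hFmono : ∀ z y, 0 ≤ ⟪F y - F z, y - z⟫)
    (hL : 0 < L)
    (hFlip : ∀ z y, ‖F y - F z‖ ≤ L * ‖y - z‖)
    (hα : 2 < α) (hcl : α / 2 < c) (hcu : c < α - 1)
    (hγ0 : 0 < γ) (hγ : γ < 1 / (2 * L))
    (z w ξ v : ℕ → H)
    (hξ : ∀ k : ℕ, 1 ≤ k → ξ k ∈ M (z k))
    (hv : ∀ k : ℕ, 1 ≤ k → v k = ξ k + F (w (k - 1)))
    (hw : ∀ k : ℕ, 1 ≤ k →
      w k = z k + ((k : ℝ) / ((k : ℝ) + α)) • (z k - z (k - 1)) - ((c / ((k : ℝ) + α)) * γ) • v k)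
    (hz : ∀ k : ℕ, 1 ≤ k → z (k + 1) = w k - γ • (v (k + 1) - v k))
    (zs : H) (hzs : -F zs ∈ M zs)
    (lam s : ℝ) (hlam0 : 0 ≤ lam) (hlam1 : lam ≤ α - 1) (hs1 : 1 < s) (hs2 : s < 2)
    (E : ℕ → ℝ)
    (hE : ∀ k : ℕ, 1 ≤ k → E k =
      (1 / 2) * ‖(2 * lam) • (z k - zs) + (2 * (k : ℝ)) • (z k - z (k - 1)) + (s * γ * (k : ℝ)) • v k‖ ^ 2
      + 2 * lam * (α - 1 - lam) * ‖z k - zs‖ ^ 2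
      + 2 * lam * γ * ((2 - s) * (k : ℝ) + 2 * (α - c)) * ⟪z k - zs, v k⟫
      + (1 / 2) * γ ^ 2 * ((2 - s) * (k : ℝ) + 2 * (α - c)) * (s * (k : ℝ) + 2 * c) * ‖v k‖ ^ 2) :
    ∀ k : ℕ, 1 ≤ k →
      E (k + 1) - E k =
        -(4 * (c - 1) * lam * γ) * ⟪z (k + 1) - zs, v (k + 1)⟫
        + 2 * (lam + 1 - α) * (2 * (k : ℝ) + α + 1) * ‖z (k + 1) - z k‖ ^ 2
        + 2 * γ * (((2 - s) * lam + s * (lam + 1 - α) + s - 2 * c) * (k : ℝ)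
            + 2 * lam * α + s - 2 * α * c) * ⟪z (k + 1) - z k, v (k + 1)⟫
        - 2 * γ * ((k : ℝ) + α) * ((2 - s) * (k : ℝ) + 2 * (α - c))
            * ⟪z (k + 1) - z k, v (k + 1) - v k⟫
        - γ ^ 2 * ((k : ℝ) + α) * ((2 - s) * (k : ℝ) + 2 * (α - c)) * ‖v (k + 1) - v k‖ ^ 2
        + γ ^ 2 * ((1 - c) * (2 * s * (k : ℝ) + 2 * c + s) + s * (α - c)) * ‖v (k + 1)‖ ^ 2 := by
  intro k hk
  have hpos : (k : ℝ) + α ≠ 0 := by positivity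
  have hstep : ((k : ℝ) + α) • (z (k + 1) - z k) =
      (k : ℝ) • (z k - z (k - 1)) - (c * γ) • v k
        - (((k : ℝ) + α) * γ) • (v (k + 1) - v k) := by
    rw [hz k hk, hw k hk]
    match_scalars <;> field_simp <;> ring
  have hmom : (2 * (k : ℝ)) • (z k - z (k - 1)) =
      (2 : ℝ) • (((k : ℝ) + α) • (z (k + 1) - z k) + (c * γ) • (v (k + 1) - (v (k + 1) - v k))
        + (((k : ℝ) + α) * γ) • (v (k + 1) - v k)) := by
    rw [hstep]
    module
  have hzk : z k - zs = (z (k + 1) - zs) - (z (k + 1) - z k) := by abel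
  have hvk : v k = v (k + 1) - (v (k + 1) - v k) := by abel
  have hid := energy_difference_identity α c γ lam s k
    (z (k + 1) - zs) (z (k + 1) - z k) (v (k + 1)) (v (k + 1) - v k)
  rw [← hmom, ← hzk, ← hvk] at hid
  rw [hE (k + 1) (by lia), hE k hk, Nat.add_sub_cancel, Nat.cast_add_one]
  exact hid
end

section
/- For every z* ∈ Zer(M+F), every λ with 0 ≤ λ ≤ α − 1 and every s with 1 < s < 2, the following inequality holds for all k ≥ 2: G_{λ,s,k+1} − G_{λ,s,k} ≤ (4(c−1)²/(k+1)^{3/2})λ²‖z_{k+1} − z*‖² − 4(c−1)λγ⟨z_{k+1} − z*, ξ_{k+1} + F(z_{k+1})⟩ + 2γ(ω₁k + ω₂)⟨z_{k+1} − z_k, v_{k+1}⟩ − μ_k γ²‖v_{k+1} − v_k‖² + 2(ω₃k + √(ω₅(k+1) + ω₇))‖z_{k+1} − z_k‖² + γ²(ω₄k + c√(ω₀k + 2ω₆) + sω₆)‖v_{k+1}‖². -/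
open scoped RealInnerProductSpace Pointwise
open Filter

section Energy

variable {H : Type*} [NormedAddCommGroup H] [InnerProductSpace ℝ H]

/-- Exact one-step change of the discrete energy, in terms of `x = z_{k+1} - z*`,
`d = z_{k+1} - z_k`, `V = v_{k+1}` and `D = v_{k+1} - v_k`, where `p = z_k - z_{k-1}`. -/
lemma energy_succ_sub (x d p V D : H) (K α c γ lam s : ℝ)
    (hp : K • p = (K + α) • d + (c * γ) • V + (γ * (K + α - c)) • D) :
    ((1 / 2) * ‖(2 * lam) • x + (2 * (K + 1)) • d + (s * γ * (K + 1)) • V‖ ^ 2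
      + 2 * lam * (α - 1 - lam) * ‖x‖ ^ 2
      + 2 * lam * γ * ((2 - s) * (K + 1) + 2 * (α - c)) * ⟪x, V⟫
      + (1 / 2) * γ ^ 2 * ((2 - s) * (K + 1) + 2 * (α - c)) * (s * (K + 1) + 2 * c) * ‖V‖ ^ 2)
    - ((1 / 2) * ‖(2 * lam) • (x - d) + (2 * K) • p + (s * γ * K) • (V - D)‖ ^ 2
      + 2 * lam * (α - 1 - lam) * ‖x - d‖ ^ 2
      + 2 * lam * γ * ((2 - s) * K + 2 * (α - c)) * ⟪x - d, V - D⟫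
      + (1 / 2) * γ ^ 2 * ((2 - s) * K + 2 * (α - c)) * (s * K + 2 * c) * ‖V - D‖ ^ 2)
    = -4 * (c - 1) * lam * γ * ⟪x, V⟫
      + 2 * γ * (((2 - s) * lam + s * (lam + 1 - α) + s - 2 * c) * K
        + (2 * lam * α + s - 2 * α * c)) * ⟪d, V⟫
      - 2 * γ * (K + α) * ((2 - s) * K + 2 * (α - c)) * ⟪d, D⟫
      - γ ^ 2 * (K + α) * ((2 - s) * K + 2 * (α - c)) * ‖D‖ ^ 2
      + 2 * (lam + 1 - α) * (2 * K + 1 + α) * ‖d‖ ^ 2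
      + γ ^ 2 * (2 * s * (1 - c) * K + (1 - c) * (s + 2 * c) + s * (α - c)) * ‖V‖ ^ 2 := by
  have hu : (2 * lam) • (x - d) + (2 * K) • p + (s * γ * K) • (V - D)
      = (2 * lam) • x + (2 * (K + α - lam)) • d + (γ * (s * K + 2 * c)) • V
        + (γ * ((2 - s) * K + 2 * (α - c))) • D := by
    rw [mul_smul 2 K p, hp]
    module
  rw [hu]
  simp only [← real_inner_self_eq_norm_sq, inner_add_left, inner_add_right, inner_sub_left,
    inner_sub_right, real_inner_smul_left, real_inner_smul_right, real_inner_comm x d,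
    real_inner_comm x V, real_inner_comm x D, real_inner_comm d V, real_inner_comm d D,
    real_inner_comm V D]
  ring

lemma two_mul_inner_le_mul_add_div (a b : H) {t : ℝ} (ht : 0 < t) :
    2 * ⟪a, b⟫ ≤ t * ‖a‖ ^ 2 + ‖b‖ ^ 2 / t := by
  have h : 0 ≤ ‖t • a - b‖ ^ 2 / t := by positivity
  rw [norm_sub_sq_real, norm_smul, real_inner_smul_left, mul_pow, Real.norm_eq_abs, sq_abs] at h
  have e : (t ^ 2 * ‖a‖ ^ 2 - 2 * (t * ⟪a, b⟫) + ‖b‖ ^ 2) / t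
      = t * ‖a‖ ^ 2 + ‖b‖ ^ 2 / t - 2 * ⟪a, b⟫ := by
    field_simp
    ring
  linarith

lemma two_mul_mul_inner_le (a b : H) (r : ℝ) :
    2 * r * ⟪a, b⟫ ≤ ‖a‖ ^ 2 + r ^ 2 * ‖b‖ ^ 2 := by
  have h : 0 ≤ ‖a - r • b‖ ^ 2 := by positivity
  rw [norm_sub_sq_real, norm_smul, real_inner_smul_right, mul_pow, Real.norm_eq_abs, sq_abs] at h
  linarith

lemma two_mul_inner_le_of_norm_le {a b e : H} {m : ℝ} (hm : 0 ≤ m) (hb : ‖b‖ ≤ m * ‖e‖) :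
    2 * ⟪a, b⟫ ≤ m * (‖a‖ ^ 2 + ‖e‖ ^ 2) := by
  have h1 := real_inner_le_norm a b
  have h2 := mul_le_mul_of_nonneg_left hb (norm_nonneg a)
  have h3 := mul_nonneg hm (sq_nonneg (‖a‖ - ‖e‖))
  linarith

/-- Young-type bound for the terms of the energy change that involve the differences
`f' = F z_{k+1} - F w_k` and `f = F z_k - F w_{k-1}`, with `e = v_k - v_{k-1}`. -/
lemma cross_terms_le (x d p V D e f f' : H) {K α c γ L lam s T : ℝ}
    (hK : 2 ≤ K) (hc : 1 < c) (hcu : c < α - 1) (hγ0 : 0 < γ) (hL : 0 < L)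
    (hγL : γ * L < 1 / 2) (hs1 : 1 < s) (hs2 : s < 2) (hT : 0 < T)
    (hp : K • p = (K + α) • d + (c * γ) • V + (γ * (K + α - c)) • D)
    (hf' : ‖f'‖ ≤ γ * L * ‖D‖) (hf : ‖f‖ ≤ γ * L * ‖e‖)
    (hmono : 0 ≤ ⟪d, D⟫ + ⟪d, f'⟫ - ⟪d, f⟫) :
    4 * (c - 1) * lam * γ * ⟪x, f'⟫
      - 2 * γ * (K + α) * ((2 - s) * K + 2 * (α - c)) * ⟪d, D⟫
      - 2 * γ * ((2 - s) * (K + 1) + 2 * (α - c)) * (K + 1) * ⟪d, f'⟫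
      + 2 * γ * ((2 - s) * K + 2 * (α - c)) * K * ⟪p, f⟫
      + γ ^ 3 * L * ((2 - s) * (K + 1) + 2 * (α - c)) * (K + 1 + α - c) * ‖D‖ ^ 2
      - γ ^ 3 * L * ((2 - s) * K + 2 * (α - c))
        * (K + α - c + c * γ * L * √((2 - s) * K + 2 * (α - c))) * ‖e‖ ^ 2
    ≤ (4 * (c - 1) ^ 2 / T) * lam ^ 2 * ‖x‖ ^ 2
      + γ ^ 2 * (T
        + ((α - 2) * (2 - s) * (K + 1) + (α - 1) * (2 * (α - c) - (2 - s)))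
          * √((α - 2) * (2 - s) * (K + 1) + (α - 1) * (2 * (α - c) - (2 - s)))
        + 2 * γ * L * ((2 - s) * K ^ 2
          + (2 * ((2 - s) + 2 * (α - c)) - s * (α - c)) * K
          + ((2 - s) + 2 * (α - c)) * (α + 1 - c))) * ‖D‖ ^ 2
      + 2 * √((α - 2) * (2 - s) * (K + 1) + (α - 1) * (2 * (α - c) - (2 - s))) * ‖d‖ ^ 2
      + γ ^ 2 * c * √((2 - s) * K + 2 * (α - c)) * ‖V‖ ^ 2 := by
  have hinner : K * ⟪p, f⟫ = (K + α) * ⟪d, f⟫ + c * γ * ⟪V, f⟫ + γ * (K + α - c) * ⟪D, f⟫ := by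
    rw [← real_inner_smul_left, hp]
    simp only [inner_add_left, real_inner_smul_left]
  have hA : 0 ≤ (2 - s) * K + 2 * (α - c) := by nlinarith
  have hB : 0 ≤ (α - 2) * (2 - s) * (K + 1) + (α - 1) * (2 * (α - c) - (2 - s)) :=
    add_nonneg (mul_nonneg (mul_nonneg (by linarith) (by linarith)) (by linarith))
      (mul_nonneg (by linarith) (by linarith))
  have hm0 : 0 < γ * L := by positivity
  have hfsq' : ‖f'‖ ^ 2 ≤ ‖D‖ ^ 2 := by
    refine pow_le_pow_left₀ (norm_nonneg _) (hf'.trans ?_) 2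
    exact mul_le_of_le_one_left (norm_nonneg _) (by linarith)
  have hfsq : ‖f‖ ^ 2 ≤ (γ * L) ^ 2 * ‖e‖ ^ 2 := by
    rw [← mul_pow]
    exact pow_le_pow_left₀ (norm_nonneg _) hf 2
  have hxf : 4 * (c - 1) * lam * γ * ⟪x, f'⟫
      ≤ (4 * (c - 1) ^ 2 / T) * lam ^ 2 * ‖x‖ ^ 2
        + γ ^ 2 * T * ‖D‖ ^ 2 := by
    have h := two_mul_inner_le_mul_add_div (γ • f') ((2 * lam * (c - 1)) • x) hT
    simp only [norm_smul, real_inner_smul_left, real_inner_smul_right, mul_pow,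
      Real.norm_eq_abs, sq_abs] at h
    rw [real_inner_comm] at h
    have h' := mul_le_mul_of_nonneg_left hfsq'
      (mul_nonneg (sq_nonneg γ) hT.le)
    have hdiv : (2 ^ 2 * lam ^ 2 * (c - 1) ^ 2 * ‖x‖ ^ 2) / T
        = (4 * (c - 1) ^ 2 / T) * lam ^ 2 * ‖x‖ ^ 2 := by ring
    rw [hdiv] at h
    linarith
  have hsqA := Real.sq_sqrt hA
  have hsqB := Real.sq_sqrt hB
  have hA0 := Real.sqrt_nonneg ((2 - s) * K + 2 * (α - c))
  have hB0 := Real.sqrt_nonneg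
    ((α - 2) * (2 - s) * (K + 1) + (α - 1) * (2 * (α - c) - (2 - s)))
  generalize √((2 - s) * K + 2 * (α - c)) = q at *
  generalize √((α - 2) * (2 - s) * (K + 1) + (α - 1) * (2 * (α - c) - (2 - s))) = r at *
  have hdf : 2 * γ * r ^ 2 * ⟪d, f'⟫
      ≤ 2 * r * ‖d‖ ^ 2 + γ ^ 2 * r ^ 2 * r * ‖D‖ ^ 2 := by
    have h := mul_le_mul_of_nonneg_left
      (two_mul_mul_inner_le d f' (r * γ)) hB0
    have h' := mul_le_mul_of_nonneg_left hfsq' (show 0 ≤ r ^ 2 * γ ^ 2 * r by positivity)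
    have h'' := mul_nonneg hB0 (sq_nonneg ‖d‖)
    linarith
  have hVf : 2 * γ ^ 2 * c * q ^ 2 * ⟪V, f⟫
      ≤ γ ^ 2 * c * q * ‖V‖ ^ 2
        + γ ^ 2 * c * q * q ^ 2 * ((γ * L) ^ 2 * ‖e‖ ^ 2) := by
    have hc : 0 ≤ γ ^ 2 * c * q := mul_nonneg (mul_nonneg (sq_nonneg γ) (by linarith)) hA0
    have h := mul_le_mul_of_nonneg_left (two_mul_mul_inner_le V f q) hc
    have h' := mul_le_mul_of_nonneg_left hfsq (mul_nonneg hc (sq_nonneg q))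
    linarith
  rw [hsqB] at hdf
  rw [hsqA] at hVf
  have hDf := mul_le_mul_of_nonneg_left
    (two_mul_inner_le_of_norm_le (a := D) hm0.le hf)
    (mul_nonneg (mul_nonneg (sq_nonneg γ) hA) (show 0 ≤ K + α - c by linarith))
  have hmono' := mul_nonneg (mul_nonneg (mul_nonneg (mul_nonneg zero_le_two hγ0.le)
    (show 0 ≤ K + α by linarith)) hA) hmono
  have hD : 0 ≤ γ ^ 3 * L * (2 * (2 - s) * K + 2 * (α - c) + (2 - s) + (2 - s) * (α - c))
      * ‖D‖ ^ 2 := by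
    have h1 : 0 ≤ (2 - s) * K := mul_nonneg (by linarith) (by linarith)
    have h2 : 0 ≤ (2 - s) * (α - c) := mul_nonneg (by linarith) (by linarith)
    exact mul_nonneg (mul_nonneg (by positivity) (by linarith)) (sq_nonneg _)
  calc
    _ = 4 * (c - 1) * lam * γ * ⟪x, f'⟫
      - 2 * γ * (K + α) * ((2 - s) * K + 2 * (α - c)) * ⟪d, D⟫
      - 2 * γ * ((2 - s) * (K + 1) + 2 * (α - c)) * (K + 1) * ⟪d, f'⟫
      + 2 * γ * ((2 - s) * K + 2 * (α - c))
        * ((K + α) * ⟪d, f⟫ + c * γ * ⟪V, f⟫ + γ * (K + α - c) * ⟪D, f⟫)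
      + γ ^ 3 * L * ((2 - s) * (K + 1) + 2 * (α - c)) * (K + 1 + α - c) * ‖D‖ ^ 2
      - γ ^ 3 * L * ((2 - s) * K + 2 * (α - c)) * (K + α - c + c * γ * L * q) * ‖e‖ ^ 2 := by
        rw [← hinner]
        ring
    _ ≤ _ := by
        linarith only [hxf, hdf, hVf, hDf, hmono', hD]

end Energy

theorem stmt_2
    {H : Type*} [NormedAddCommGroup H] [InnerProductSpace ℝ H] [CompleteSpace H]
    (M : H → Set H) (F : H → H) (L α c γ : ℝ)
    (hM : ∀ z y u' v', u' ∈ M z → v' ∈ M y → 0 ≤ ⟪v' - u', y - z⟫)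
    (hFmono : ∀ z y, 0 ≤ ⟪F y - F z, y - z⟫)
    (hL : 0 < L)
    (hFlip : ∀ z y, ‖F y - F z‖ ≤ L * ‖y - z‖)
    (hα : 2 < α) (hcl : α / 2 < c) (hcu : c < α - 1)
    (hγ0 : 0 < γ) (hγ : γ < 1 / (2 * L))
    (z w ξ v : ℕ → H)
    (hξ : ∀ k : ℕ, 1 ≤ k → ξ k ∈ M (z k))
    (hv : ∀ k : ℕ, 1 ≤ k → v k = ξ k + F (w (k - 1)))
    (hw : ∀ k : ℕ, 1 ≤ k →
      w k = z k + ((k : ℝ) / ((k : ℝ) + α)) • (z k - z (k - 1)) - ((c / ((k : ℝ) + α)) * γ) • v k)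
    (hz : ∀ k : ℕ, 1 ≤ k → z (k + 1) = w k - γ • (v (k + 1) - v k))
    (zs : H) (hzs : -F zs ∈ M zs)
    (lam s : ℝ) (hlam0 : 0 ≤ lam) (hlam1 : lam ≤ α - 1) (hs1 : 1 < s) (hs2 : s < 2)
    (E : ℕ → ℝ)
    (hE : ∀ k : ℕ, 1 ≤ k → E k =
      (1 / 2) * ‖(2 * lam) • (z k - zs) + (2 * (k : ℝ)) • (z k - z (k - 1)) + (s * γ * (k : ℝ)) • v k‖ ^ 2
      + 2 * lam * (α - 1 - lam) * ‖z k - zs‖ ^ 2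
      + 2 * lam * γ * ((2 - s) * (k : ℝ) + 2 * (α - c)) * ⟪z k - zs, v k⟫
      + (1 / 2) * γ ^ 2 * ((2 - s) * (k : ℝ) + 2 * (α - c)) * (s * (k : ℝ) + 2 * c) * ‖v k‖ ^ 2)
    (G : ℕ → ℝ)
    (hG : ∀ k : ℕ, 2 ≤ k → G k =
      E k - 2 * γ * ((2 - s) * (k : ℝ) + 2 * (α - c)) * (k : ℝ)
          * ⟪z k - z (k - 1), F (z k) - F (w (k - 1))⟫
      + γ ^ 3 * L * ((2 - s) * (k : ℝ) + 2 * (α - c))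
        * ((k : ℝ) + α - c + c * γ * L * Real.sqrt ((2 - s) * (k : ℝ) + 2 * (α - c)))
        * ‖v k - v (k - 1)‖ ^ 2)
    (ω0 ω1 ω2 ω3 ω4 ω5 ω6 ω7 : ℝ)
    (hω0 : ω0 = 2 - s)
    (hω1 : ω1 = ω0 * lam + s * (lam + 1 - α) + s - 2 * c)
    (hω2 : ω2 = 2 * lam * α + s - 2 * α * c)
    (hω3 : ω3 = 2 * (lam + 1 - α))
    (hω4 : ω4 = 2 * s * (1 - c))
    (hω5 : ω5 = (α - 2) * ω0)
    (hω6 : ω6 = α - c)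
    (hω7 : ω7 = (α - 1) * (2 * ω6 - ω0))
    (μ : ℕ → ℝ)
    (hμ : ∀ k : ℕ, 2 ≤ k → μ k =
      ω0 * (1 - 2 * γ * L) * (k : ℝ) ^ 2 + (2 * ω6 + ω0 * α) * (k : ℝ) + 2 * ω6 * α
      - 2 * γ * L * ((2 * (ω0 + 2 * ω6) - s * ω6) * (k : ℝ) + (ω0 + 2 * ω6) * (α + 1 - c))
      - ((k : ℝ) + 1) * Real.sqrt ((k : ℝ) + 1)
      - (ω5 * ((k : ℝ) + 1) + ω7) * Real.sqrt (ω5 * ((k : ℝ) + 1) + ω7)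
      - γ ^ 2 * L ^ 2 * c * (ω0 * ((k : ℝ) + 1) + 2 * ω6) * Real.sqrt (ω0 * ((k : ℝ) + 1) + 2 * ω6)) :
    ∀ k : ℕ, 2 ≤ k →
      G (k + 1) - G k ≤
        (4 * (c - 1) ^ 2 / (((k : ℝ) + 1) * Real.sqrt ((k : ℝ) + 1))) * lam ^ 2 * ‖z (k + 1) - zs‖ ^ 2
        - 4 * (c - 1) * lam * γ * ⟪z (k + 1) - zs, ξ (k + 1) + F (z (k + 1))⟫
        + 2 * γ * (ω1 * (k : ℝ) + ω2) * ⟪z (k + 1) - z k, v (k + 1)⟫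
        - μ k * γ ^ 2 * ‖v (k + 1) - v k‖ ^ 2
        + 2 * (ω3 * (k : ℝ) + Real.sqrt (ω5 * ((k : ℝ) + 1) + ω7)) * ‖z (k + 1) - z k‖ ^ 2
        + γ ^ 2 * (ω4 * (k : ℝ) + c * Real.sqrt (ω0 * (k : ℝ) + 2 * ω6) + s * ω6)
            * ‖v (k + 1)‖ ^ 2 := by
  intro k hk
  have hk1 : 1 ≤ k := by omega
  have hK : (2 : ℝ) ≤ k := by exact_mod_cast hk
  rw [hG (k + 1) (by omega), hG k hk, hE (k + 1) (by omega), hE k hk1, hμ k hk]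
  simp only [Nat.add_sub_cancel]
  push_cast
  subst hω0 hω1 hω2 hω3 hω4 hω5 hω6 hω7
  have hm1 : γ * L < 1 / 2 := by
    rw [lt_div_iff₀ (by positivity)] at hγ
    linarith
  have hwz : ∀ j : ℕ, 1 ≤ j → ‖F (z (j + 1)) - F (w j)‖ ≤ γ * L * ‖v (j + 1) - v j‖ := by
    intro j hj
    refine (hFlip _ _).trans (le_of_eq ?_)
    rw [hz j hj, sub_sub_cancel_left, norm_neg, norm_smul, Real.norm_of_nonneg hγ0.le]
    ring
  have hf' := hwz k hk1
  have hf := hwz (k - 1) (by omega)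
  rw [Nat.sub_add_cancel hk1] at hf
  have hstep : (k : ℝ) • (z k - z (k - 1)) = ((k : ℝ) + α) • (z (k + 1) - z k)
      + (c * γ) • v (k + 1) + (γ * ((k : ℝ) + α - c)) • (v (k + 1) - v k) := by
    have hne : (k : ℝ) + α ≠ 0 := by linarith
    rw [hz k hk1, hw k hk1]
    match_scalars <;> field_simp <;> ring
  have hmono : 0 ≤ ⟪z (k + 1) - z k, v (k + 1) - v k⟫
      + ⟪z (k + 1) - z k, F (z (k + 1)) - F (w k)⟫
      - ⟪z (k + 1) - z k, F (z k) - F (w (k - 1))⟫ := by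
    have h1 := hM _ _ _ _ (hξ k hk1) (hξ (k + 1) (by omega))
    have h2 := hFmono (z k) (z (k + 1))
    rw [real_inner_comm] at h1 h2
    have h3 := add_nonneg h1 h2
    rw [← inner_add_right] at h3
    rw [← inner_add_right, ← inner_sub_right, hv k hk1, hv (k + 1) (by omega), Nat.add_sub_cancel]
    refine h3.trans_eq (congrArg _ ?_)
    abel
  have hxV : ⟪z (k + 1) - zs, v (k + 1)⟫ = ⟪z (k + 1) - zs, ξ (k + 1) + F (z (k + 1))⟫
      - ⟪z (k + 1) - zs, F (z (k + 1)) - F (w k)⟫ := by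
    rw [← inner_sub_right, hv (k + 1) (by omega), Nat.add_sub_cancel]
    congr 1
    module
  have hE' := energy_succ_sub (z (k + 1) - zs) (z (k + 1) - z k) (z k - z (k - 1)) (v (k + 1))
    (v (k + 1) - v k) k α c γ lam s hstep
  rw [sub_sub_sub_cancel_left, sub_sub_cancel] at hE'
  have hd : 0 ≤ (α - 1 - lam) * (1 + α) * ‖z (k + 1) - z k‖ ^ 2 :=
    mul_nonneg (mul_nonneg (by linarith) (by linarith)) (sq_nonneg _)
  have hV : 0 ≤ γ ^ 2 * (c - 1) * (s + 2 * c) * ‖v (k + 1)‖ ^ 2 :=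
    mul_nonneg (mul_nonneg (mul_nonneg (sq_nonneg γ) (by linarith)) (by linarith)) (sq_nonneg _)
  have hcross := cross_terms_le (lam := lam) (s := s)
    (T := ((k : ℝ) + 1) * √((k : ℝ) + 1)) (z (k + 1) - zs)
    _ _ _ _ _ _ _ hK (by linarith) hcu hγ0 hL hm1 hs1 hs2 (by positivity) hstep hf' hf hmono
  rw [hxV] at hE' ⊢
  linarith only [hE', hcross, hd, hV]
end

section
/- For every z* ∈ Zer(M+F), every λ with 0 ≤ λ ≤ α − 1 and every s with 1 < s < 2, there exists an integer k₁ ≥ 2 such that for all k ≥ k₁: G_{λ,s,k} ≥ (1/(4s))(2−s)‖4λ(z_k − z*) + 2k(z_k − z_{k−1}) + 2sγk v_k‖² + (1/(4s))(2−s)²k²‖z_k − z_{k−1}‖² + 2λ(α − 1 − (4(α−1)/(sα))λ)‖z_k − z*‖². -/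
open scoped RealInnerProductSpace Pointwise
open Filter

/-- Expansion of the energy minus its lower bound as a sum of squares and lower-order terms. -/
theorem energy_sub_lower_bound_eq
    {H : Type*} [NormedAddCommGroup H] [InnerProductSpace ℝ H] (x d v : H)
    (α c γ lam s k : ℝ) (hα : α ≠ 0) (hs : s ≠ 0) :
    (1 / 2) * ‖(2 * lam) • x + (2 * k) • d + (s * γ * k) • v‖ ^ 2
      + 2 * lam * (α - 1 - lam) * ‖x‖ ^ 2
      + 2 * lam * γ * ((2 - s) * k + 2 * (α - c)) * ⟪x, v⟫
      + (1 / 2) * γ ^ 2 * ((2 - s) * k + 2 * (α - c)) * (s * k + 2 * c) * ‖v‖ ^ 2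
      - ((1 / (4 * s)) * (2 - s) * ‖(4 * lam) • x + (2 * k) • d + (2 * s * γ * k) • v‖ ^ 2
        + (1 / (4 * s)) * (2 - s) ^ 2 * k ^ 2 * ‖d‖ ^ 2
        + 2 * lam * (α - 1 - (4 * (α - 1) / (s * α)) * lam) * ‖x‖ ^ 2)
    = (s - 1) / s * ‖(2 * lam) • x + (2 * k) • d + (s * γ * k) • v‖ ^ 2
      + 4 * ((1 - 2 / α) / s) * lam ^ 2 * ‖x‖ ^ 2
      + 4 * lam * γ * (α - c) * ⟪x, v⟫
      + k * γ ^ 2 * (c * (2 - s) + s * (α - c)) * ‖v‖ ^ 2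
      + 2 * c * (α - c) * γ ^ 2 * ‖v‖ ^ 2
      + (2 - s) * ((2 + s) / (4 * s)) * k ^ 2 * ‖d‖ ^ 2 := by
  have expand (a b e : ℝ) : ‖a • x + b • d + e • v‖ ^ 2
      = a ^ 2 * ‖x‖ ^ 2 + b ^ 2 * ‖d‖ ^ 2 + e ^ 2 * ‖v‖ ^ 2
        + 2 * a * b * ⟪x, d⟫ + 2 * a * e * ⟪x, v⟫ + 2 * b * e * ⟪d, v⟫ := by
    simp only [norm_add_sq_real, inner_add_left, real_inner_smul_left, real_inner_smul_right,
      norm_smul, mul_pow, Real.norm_eq_abs, sq_abs]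
    ring
  rw [expand, expand]
  field_simp
  ring

/-- A quadratic form in `p ‖x‖` and `q ‖v‖` with cross term `⟪x, v⟫` and nonpositive discriminant
is nonnegative. -/
theorem quadratic_form_inner_nonneg
    {H : Type*} [NormedAddCommGroup H] [InnerProductSpace ℝ H] (x v : H)
    {p q b m n : ℝ} (hm : 0 < m) (hb : b ^ 2 ≤ m * n) :
    0 ≤ m * p ^ 2 * ‖x‖ ^ 2 + 2 * p * q * b * ⟪x, v⟫ + n * q ^ 2 * ‖v‖ ^ 2 := by
  have h : ‖(m * p) • x + (b * q) • v‖ ^ 2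
      = m ^ 2 * p ^ 2 * ‖x‖ ^ 2 + 2 * m * p * b * q * ⟪x, v⟫ + b ^ 2 * q ^ 2 * ‖v‖ ^ 2 := by
    simp only [norm_add_sq_real, real_inner_smul_left, real_inner_smul_right,
      norm_smul, mul_pow, Real.norm_eq_abs, sq_abs]
    ring
  have h' : 0 ≤ (m * n - b ^ 2) * (q ^ 2 * ‖v‖ ^ 2) :=
    mul_nonneg (sub_nonneg.2 hb) (by positivity)
  refine nonneg_of_mul_nonneg_right (a := m) ?_ hm
  nlinarith [sq_nonneg ‖(m * p) • x + (b * q) • v‖]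

/-- Young's inequality for the term coupling `d` to a vector controlled by `γ L ‖δ‖`. -/
theorem neg_le_inner_coupling
    {H : Type*} [NormedAddCommGroup H] [InnerProductSpace ℝ H] (d f δ : H)
    {γ L : ℝ} (hL : 0 ≤ L) (hf : ‖f‖ ≤ L * (γ * ‖δ‖)) :
    -(L * ‖d‖ ^ 2) ≤ -2 * ⟪d, f⟫ + γ ^ 2 * L * ‖δ‖ ^ 2 := by
  have h1 : ⟪d, f⟫ ≤ ‖d‖ * (L * (γ * ‖δ‖)) :=
    (real_inner_le_norm d f).trans (mul_le_mul_of_nonneg_left hf (norm_nonneg d))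
  nlinarith [mul_nonneg hL (sq_nonneg (‖d‖ - γ * ‖δ‖))]

theorem stmt_3
    {H : Type*} [NormedAddCommGroup H] [InnerProductSpace ℝ H] [CompleteSpace H]
    (M : H → Set H) (F : H → H) (L α c γ : ℝ)
    (hM : ∀ z y u' v', u' ∈ M z → v' ∈ M y → 0 ≤ ⟪v' - u', y - z⟫)
    (hFmono : ∀ z y, 0 ≤ ⟪F y - F z, y - z⟫)
    (hL : 0 < L)
    (hFlip : ∀ z y, ‖F y - F z‖ ≤ L * ‖y - z‖)
    (hα : 2 < α) (hcl : α / 2 < c) (hcu : c < α - 1)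
    (hγ0 : 0 < γ) (hγ : γ < 1 / (2 * L))
    (z w ξ v : ℕ → H)
    (hξ : ∀ k : ℕ, 1 ≤ k → ξ k ∈ M (z k))
    (hv : ∀ k : ℕ, 1 ≤ k → v k = ξ k + F (w (k - 1)))
    (hw : ∀ k : ℕ, 1 ≤ k →
      w k = z k + ((k : ℝ) / ((k : ℝ) + α)) • (z k - z (k - 1)) - ((c / ((k : ℝ) + α)) * γ) • v k)
    (hz : ∀ k : ℕ, 1 ≤ k → z (k + 1) = w k - γ • (v (k + 1) - v k))
    (zs : H) (hzs : -F zs ∈ M zs)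
    (lam s : ℝ) (hlam0 : 0 ≤ lam) (hlam1 : lam ≤ α - 1) (hs1 : 1 < s) (hs2 : s < 2)
    (E : ℕ → ℝ)
    (hE : ∀ k : ℕ, 1 ≤ k → E k =
      (1 / 2) * ‖(2 * lam) • (z k - zs) + (2 * (k : ℝ)) • (z k - z (k - 1)) + (s * γ * (k : ℝ)) • v k‖ ^ 2
      + 2 * lam * (α - 1 - lam) * ‖z k - zs‖ ^ 2
      + 2 * lam * γ * ((2 - s) * (k : ℝ) + 2 * (α - c)) * ⟪z k - zs, v k⟫
      + (1 / 2) * γ ^ 2 * ((2 - s) * (k : ℝ) + 2 * (α - c)) * (s * (k : ℝ) + 2 * c) * ‖v k‖ ^ 2)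
    (G : ℕ → ℝ)
    (hG : ∀ k : ℕ, 2 ≤ k → G k =
      E k - 2 * γ * ((2 - s) * (k : ℝ) + 2 * (α - c)) * (k : ℝ)
          * ⟪z k - z (k - 1), F (z k) - F (w (k - 1))⟫
      + γ ^ 3 * L * ((2 - s) * (k : ℝ) + 2 * (α - c))
        * ((k : ℝ) + α - c + c * γ * L * Real.sqrt ((2 - s) * (k : ℝ) + 2 * (α - c)))
        * ‖v k - v (k - 1)‖ ^ 2) :
    ∃ k₁ : ℕ, 2 ≤ k₁ ∧ ∀ k : ℕ, k₁ ≤ k →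
      G k ≥
        (1 / (4 * s)) * (2 - s)
          * ‖(4 * lam) • (z k - zs) + (2 * (k : ℝ)) • (z k - z (k - 1)) + (2 * s * γ * (k : ℝ)) • v k‖ ^ 2
        + (1 / (4 * s)) * (2 - s) ^ 2 * (k : ℝ) ^ 2 * ‖z k - z (k - 1)‖ ^ 2
        + 2 * lam * (α - 1 - (4 * (α - 1) / (s * α)) * lam) * ‖z k - zs‖ ^ 2 := by
  have hs0 : 0 < s := by linarith
  have hα0 : 0 < α := by linarith
  have hc0 : 0 < c := by linarith
  have hαc : 0 < α - c := by linarith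
  have h2s : 0 < 2 - s := by linarith
  have hμ : 0 < (1 - 2 / α) / s :=
    div_pos (sub_pos.2 ((div_lt_one hα0).2 hα)) hs0
  have hκ : 0 < c * (2 - s) + s * (α - c) := by positivity
  have hγL : γ * L < 1 / 2 := by
    rw [lt_div_iff₀ (by positivity)] at hγ
    linarith
  have hρ : 0 < (2 + s) / (4 * s) - γ * L := by
    have : 1 / 2 < (2 + s) / (4 * s) := by
      rw [div_lt_div_iff₀ (by norm_num) (by positivity)]
      linarith
    linarith
  generalize hμdef : (1 - 2 / α) / s = μ at hμ
  generalize hκdef : c * (2 - s) + s * (α - c) = κ at hκ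
  generalize hρdef : (2 + s) / (4 * s) - γ * L = ρ at hρ
  obtain ⟨N, hN⟩ := exists_nat_ge ((α - c) ^ 2 / (μ * κ))
  obtain ⟨N', hN'⟩ := exists_nat_ge (2 * (γ * L) * (α - c) / ((2 - s) * ρ))
  refine ⟨2 + N + N', by omega, fun k hk => ?_⟩
  have hk2 : 2 ≤ k := by omega
  have hNk : (N : ℝ) ≤ k := by exact_mod_cast (by omega : N ≤ k)
  have hNk' : (N' : ℝ) ≤ k := by exact_mod_cast (by omega : N' ≤ k)
  have hdiscr : (α - c) ^ 2 ≤ μ * (k * κ) := by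
    have := (div_le_iff₀ (mul_pos hμ hκ)).1 (hN.trans hNk)
    linarith
  have hlarge : 2 * (γ * L) * (α - c) ≤ k * ((2 - s) * ρ) :=
    (div_le_iff₀ (mul_pos h2s hρ)).1 (hN'.trans hNk')
  have hresid : ‖F (z k) - F (w (k - 1))‖ ≤ L * (γ * ‖v k - v (k - 1)‖) := by
    have hstep : z k = w (k - 1) - γ • (v k - v (k - 1)) := by
      have := hz (k - 1) (by omega)
      rwa [Nat.sub_add_cancel (by omega : 1 ≤ k)] at this
    have hnorm : ‖z k - w (k - 1)‖ = γ * ‖v k - v (k - 1)‖ := by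
      rw [hstep, sub_sub_cancel_left, norm_neg, norm_smul, Real.norm_of_nonneg hγ0.le]
    exact hnorm ▸ hFlip (w (k - 1)) (z k)
  have hid := energy_sub_lower_bound_eq (z k - zs) (z k - z (k - 1)) (v k) α c γ lam s k
    hα0.ne' hs0.ne'
  have hxv := quadratic_form_inner_nonneg (z k - zs) (v k) (p := 2 * lam) (q := γ) hμ hdiscr
  have hcoupling := neg_le_inner_coupling (z k - z (k - 1)) _ _ hL.le hresid
  rw [hG k hk2, hE k (by omega)]
  rw [hμdef, hκdef] at hid
  have hk0 : (0 : ℝ) ≤ k := k.cast_nonneg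
  set A : ℝ := (2 - s) * (k : ℝ) + 2 * (α - c) with hA
  have hA0 : 0 ≤ A := by positivity
  have hd : 0 ≤ (k * ((2 - s) * ρ) - 2 * (γ * L) * (α - c)) * (k * ‖z k - z (k - 1)‖ ^ 2) :=
    mul_nonneg (sub_nonneg.2 hlarge) (by positivity)
  have hscaled := mul_le_mul_of_nonneg_left hcoupling (by positivity : 0 ≤ γ * A * k)
  have hrest : 0 ≤ γ ^ 3 * L * A * (α - c + c * γ * L * Real.sqrt A) * ‖v k - v (k - 1)‖ ^ 2 := by
    positivity
  have hsq : 0 ≤ (s - 1) / s * ‖(2 * lam) • (z k - zs) + (2 * (k : ℝ)) • (z k - z (k - 1))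
      + (s * γ * (k : ℝ)) • v k‖ ^ 2 :=
    mul_nonneg (div_nonneg (by linarith) hs0.le) (sq_nonneg _)
  have hvk : 0 ≤ 2 * c * (α - c) * γ ^ 2 * ‖v k‖ ^ 2 := by positivity
  have hdsplit : (2 - s) * ((2 + s) / (4 * s)) * (k : ℝ) ^ 2 * ‖z k - z (k - 1)‖ ^ 2
      - γ * A * k * (L * ‖z k - z (k - 1)‖ ^ 2)
      = (k * ((2 - s) * ρ) - 2 * (γ * L) * (α - c)) * (k * ‖z k - z (k - 1)‖ ^ 2) := by
    rw [hA, ← hρdef]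
    ring
  clear_value A
  linarith
end

section
/- Suppose s satisfies 1 + α/(4c − α) < s < 2 and δ satisfies max{√((s(α−2) + 2(2c−s))/(4s(c−1))), √((−(2−s)(α−1) − s + 2c)/(s(c−1)))} < δ < 1. Then there exist real numbers λ̲ and λ̄ with 0 ≤ λ̲ < λ̄ ≤ sα/4 such that for every λ with λ̲ < λ < λ̄ there exists an integer k_λ ≥ 1 with the property that for all k ≥ k_λ: R_k := 2γ(ω₁k + ω₂)⟨z_{k+1} − z_k, v_{k+1}⟩ + δγ²(ω₄k + c√(ω₀k + 2ω₆) + sω₆)‖v_{k+1}‖² + 2δ(ω₃k + √(ω₅(k+1) + ω₇))‖z_{k+1} − z_k‖² ≤ 0, where ω₀ := 2 − s, ω₁ := ω₀λ + s(λ + 1 − α) + s − 2c, ω₂ := 2λα + s − 2αc, ω₃ := 2(λ + 1 − α), ω₄ := 2s(1 − c), ω₅ := (α − 2)ω₀, ω₆ := α − c, ω₇ := (α − 1)(2ω₆ − ω₀). -/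
open scoped RealInnerProductSpace Pointwise
open Filter

theorem tendsto_sqrt_affine_div_natCast (a b : ℝ) :
    Tendsto (fun k : ℕ => Real.sqrt (a * (k : ℝ) + b) / (k : ℝ)) atTop (nhds 0) := by
  have hinner : Tendsto (fun k : ℕ => a / (k : ℝ) + b / (k : ℝ) * (1 / (k : ℝ))) atTop
      (nhds 0) := by
    simpa using (tendsto_const_div_atTop_nhds_zero_nat a).add
      ((tendsto_const_div_atTop_nhds_zero_nat b).mul (tendsto_const_div_atTop_nhds_zero_nat 1))
  have hsqrt := hinner.sqrt
  rw [Real.sqrt_zero] at hsqrt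
  refine hsqrt.congr' ?_
  filter_upwards [eventually_gt_atTop 0] with k hk
  have hk' : (0 : ℝ) < k := by exact_mod_cast hk
  rw [show a / (k : ℝ) + b / (k : ℝ) * (1 / (k : ℝ)) = (a * (k : ℝ) + b) / (k : ℝ) ^ 2 by
    field_simp, Real.sqrt_div' _ (sq_nonneg _), Real.sqrt_sq hk'.le]

theorem tendsto_affine_div_natCast (a b : ℝ) :
    Tendsto (fun k : ℕ => (a * (k : ℝ) + b) / (k : ℝ)) atTop (nhds a) := by
  have h : Tendsto (fun k : ℕ => a + b / (k : ℝ)) atTop (nhds a) := by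
    simpa using tendsto_const_nhds.add (tendsto_const_div_atTop_nhds_zero_nat b)
  refine h.congr' ?_
  filter_upwards [eventually_gt_atTop 0] with k hk
  have hk' : (0 : ℝ) < k := by exact_mod_cast hk
  field_simp

/-- A quadratic form in two vectors is nonpositive if one diagonal coefficient is negative and its
discriminant is nonpositive. -/
theorem inner_quadratic_nonpos {H : Type*} [NormedAddCommGroup H] [InnerProductSpace ℝ H]
    {a p q : ℝ} (hp : p < 0) (h : a ^ 2 ≤ p * q) (x y : H) :
    2 * a * ⟪x, y⟫ + p * ‖y‖ ^ 2 + q * ‖x‖ ^ 2 ≤ 0 := by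
  have hsq : ⟪x, y⟫ ^ 2 ≤ ‖x‖ ^ 2 * ‖y‖ ^ 2 := by
    have := sq_le_sq' (neg_le_of_abs_le (abs_real_inner_le_norm x y)) (real_inner_le_norm x y)
    rwa [mul_pow] at this
  have hnorm : ‖a • x + p • y‖ ^ 2 = a ^ 2 * ‖x‖ ^ 2 + 2 * (a * p * ⟪x, y⟫) + p ^ 2 * ‖y‖ ^ 2 := by
    rw [norm_add_sq_real, norm_smul, norm_smul, real_inner_smul_left, real_inner_smul_right,
      mul_pow, mul_pow, Real.norm_eq_abs, Real.norm_eq_abs, sq_abs, sq_abs]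
    ring
  have hnonneg : 0 ≤ p * (2 * a * ⟪x, y⟫ + p * ‖y‖ ^ 2 + q * ‖x‖ ^ 2) := by
    nlinarith [sq_nonneg ‖a • x + p • y‖, mul_le_mul_of_nonneg_right h (sq_nonneg ‖x‖)]
  exact nonpos_of_mul_nonneg_right hnonneg hp

/-- If two sequences have ratios to `k` converging to `p < 0` and `q`, and a third to `a` with
`a ^ 2 < p * q`, then the quadratic forms they define are eventually nonpositive. -/
theorem eventually_inner_quadratic_nonpos {H : Type*} [NormedAddCommGroup H]
    [InnerProductSpace ℝ H] {A P Q : ℕ → ℝ} {a p q : ℝ}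
    (hA : Tendsto (fun k : ℕ => A k / (k : ℝ)) atTop (nhds a))
    (hP : Tendsto (fun k : ℕ => P k / (k : ℝ)) atTop (nhds p))
    (hQ : Tendsto (fun k : ℕ => Q k / (k : ℝ)) atTop (nhds q))
    (hp : p < 0) (h : a ^ 2 < p * q) :
    ∀ᶠ k in atTop, ∀ x y : H,
      2 * A k * ⟪x, y⟫ + P k * ‖y‖ ^ 2 + Q k * ‖x‖ ^ 2 ≤ 0 := by
  filter_upwards [(hA.pow 2).eventually_lt (hP.mul hQ) h, hP.eventually_lt_const hp,
    eventually_gt_atTop 0] with k hdisc hPk hk x y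
  have hk' : (0 : ℝ) < k := by exact_mod_cast hk
  refine inner_quadratic_nonpos (by simpa using (div_lt_iff₀ hk').1 hPk) ?_ x y
  rw [div_pow, div_mul_div_comm, ← sq] at hdisc
  exact ((div_lt_div_iff_of_pos_right (by positivity)).1 hdisc).le

theorem stmt_4
    {H : Type*} [NormedAddCommGroup H] [InnerProductSpace ℝ H] [CompleteSpace H]
    (M : H → Set H) (F : H → H) (L α c γ : ℝ)
    (hM : ∀ z y u' v', u' ∈ M z → v' ∈ M y → 0 ≤ ⟪v' - u', y - z⟫)
    (hFmono : ∀ z y, 0 ≤ ⟪F y - F z, y - z⟫)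
    (hL : 0 < L)
    (hFlip : ∀ z y, ‖F y - F z‖ ≤ L * ‖y - z‖)
    (hα : 2 < α) (hcl : α / 2 < c) (hcu : c < α - 1)
    (hγ0 : 0 < γ) (hγ : γ < 1 / (2 * L))
    (z w ξ v : ℕ → H)
    (hξ : ∀ k : ℕ, 1 ≤ k → ξ k ∈ M (z k))
    (hv : ∀ k : ℕ, 1 ≤ k → v k = ξ k + F (w (k - 1)))
    (hw : ∀ k : ℕ, 1 ≤ k →
      w k = z k + ((k : ℝ) / ((k : ℝ) + α)) • (z k - z (k - 1)) - ((c / ((k : ℝ) + α)) * γ) • v k)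
    (hz : ∀ k : ℕ, 1 ≤ k → z (k + 1) = w k - γ • (v (k + 1) - v k))
    (s δ : ℝ)
    (hs1 : 1 + α / (4 * c - α) < s) (hs2 : s < 2)
    (hδlo : max (Real.sqrt ((s * (α - 2) + 2 * (2 * c - s)) / (4 * s * (c - 1))))
        (Real.sqrt ((-((2 - s) * (α - 1)) - s + 2 * c) / (s * (c - 1)))) < δ)
    (hδhi : δ < 1) :
    ∃ lo hi : ℝ, 0 ≤ lo ∧ lo < hi ∧ hi ≤ s * α / 4 ∧
      ∀ lam : ℝ, lo < lam → lam < hi →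
        ∃ klam : ℕ, 1 ≤ klam ∧ ∀ k : ℕ, klam ≤ k →
          2 * γ * (((2 - s) * lam + s * (lam + 1 - α) + s - 2 * c) * (k : ℝ)
              + (2 * lam * α + s - 2 * α * c)) * ⟪z (k + 1) - z k, v (k + 1)⟫
          + δ * γ ^ 2 * ((2 * s * (1 - c)) * (k : ℝ)
              + c * Real.sqrt ((2 - s) * (k : ℝ) + 2 * (α - c)) + s * (α - c)) * ‖v (k + 1)‖ ^ 2
          + 2 * δ * ((2 * (lam + 1 - α)) * (k : ℝ)
              + Real.sqrt ((α - 2) * (2 - s) * ((k : ℝ) + 1) + (α - 1) * (2 * (α - c) - (2 - s))))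
              * ‖z (k + 1) - z k‖ ^ 2
          ≤ 0 := by
  have hc : 1 < c := by linarith
  have hs : 1 < s := by
    have : 0 < α / (4 * c - α) := div_pos (by linarith) (by linarith)
    linarith
  obtain ⟨hδ₁, hδ₂⟩ := max_lt_iff.1 hδlo
  have hδ : 0 < δ := (Real.sqrt_nonneg _).trans_lt hδ₁
  have hsc : 0 < s * (c - 1) := mul_pos (by linarith) (by linarith)
  rw [Real.sqrt_lt' hδ, div_lt_iff₀ (by linarith)] at hδ₁
  rw [Real.sqrt_lt' hδ, div_lt_iff₀ hsc] at hδ₂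
  obtain ⟨B, hB⟩ : ∃ B, B = δ ^ 2 * (s * (c - 1)) := ⟨_, rfl⟩
  have hBpos : 0 < B := hB ▸ by positivity
  have hBlt : B < s * (c - 1) := by
    have : δ ^ 2 < 1 := pow_lt_one₀ hδ.le hδhi two_ne_zero
    nlinarith
  -- `ω₁ ^ 2 - 8 * B * (α - 1 - lam) = 4 * ((lam - m) ^ 2 - D)`
  obtain ⟨m, hm⟩ : ∃ m, m = (s * (α - 2) + 2 * c - 2 * B) / 2 := ⟨_, rfl⟩
  obtain ⟨D, hD⟩ : ∃ D, D = B * (B - (s * (α - 2) + 2 * c) + 2 * (α - 1)) := ⟨_, rfl⟩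
  have hDpos : 0 < D := hD ▸ mul_pos hBpos (by linarith)
  have hm0 : 0 ≤ m := by
    nlinarith [mul_pos (sub_pos.2 hs) (sub_pos.2 hcu)]
  have hm1 : m < s * α / 4 := by linarith
  refine ⟨m, min (s * α / 4) (m + Real.sqrt D), hm0,
    lt_min hm1 (lt_add_of_pos_right m (Real.sqrt_pos.2 hDpos)), min_le_left _ _, ?_⟩
  intro lam hlo hhi
  have hdist : (lam - m) ^ 2 < D :=
    (Real.lt_sqrt (by linarith)).1 (by linarith [(lt_min_iff.1 hhi).2])
  have hA := (tendsto_affine_div_natCast ((2 - s) * lam + s * (lam + 1 - α) + s - 2 * c)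
    (2 * lam * α + s - 2 * α * c)).const_mul γ
  have hP := ((tendsto_affine_div_natCast (2 * s * (1 - c)) (s * (α - c))).add
    ((tendsto_sqrt_affine_div_natCast (2 - s) (2 * (α - c))).const_mul c)).const_mul (δ * γ ^ 2)
  have hQ := ((tendsto_affine_div_natCast (2 * (lam + 1 - α)) 0).add
    (tendsto_sqrt_affine_div_natCast ((α - 2) * (2 - s))
      ((α - 2) * (2 - s) + (α - 1) * (2 * (α - c) - (2 - s))))).const_mul (2 * δ)
  have hev := eventually_inner_quadratic_nonpos (H := H)
    (A := fun k => γ * (((2 - s) * lam + s * (lam + 1 - α) + s - 2 * c) * (k : ℝ)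
      + (2 * lam * α + s - 2 * α * c)))
    (P := fun k => δ * γ ^ 2 * ((2 * s * (1 - c)) * (k : ℝ)
      + c * Real.sqrt ((2 - s) * (k : ℝ) + 2 * (α - c)) + s * (α - c)))
    (Q := fun k => 2 * δ * ((2 * (lam + 1 - α)) * (k : ℝ)
      + Real.sqrt ((α - 2) * (2 - s) * ((k : ℝ) + 1) + (α - 1) * (2 * (α - c) - (2 - s)))))
    (hA.congr fun k => by ring) (hP.congr fun k => by ring)
    (hQ.congr fun k => by rw [mul_add_one, add_assoc]; ring)
    (by nlinarith [mul_pos (mul_pos hδ (pow_pos hγ0 2)) hsc])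
    (by
      have hdisc : ((2 - s) * lam + s * (lam + 1 - α) + s - 2 * c) ^ 2
          < 8 * (δ ^ 2 * (s * (c - 1))) * (α - 1 - lam) := by
        rw [← hB]
        subst hm hD
        linarith
      linarith [mul_lt_mul_of_pos_left hdisc (pow_pos hγ0 2)])
  obtain ⟨N, hN⟩ := eventually_atTop.1 hev
  refine ⟨max 1 N, le_max_left _ _, fun k hk => ?_⟩
  have := hN k ((le_max_right _ _).trans hk) (z (k + 1) - z k) (v (k + 1))
  rwa [← mul_assoc 2 γ] at this
end

section
/- Suppose Zer(M+F) is nonempty and let z* ∈ Zer(M+F). Then the following series of real numbers converge: ∑_{k≥1} ⟨z_k − z*, F(z_k) + ξ_k⟩ (whose terms are nonnegative), ∑_{k≥1} k²‖v_{k+1} − v_k‖², ∑_{k≥1} k‖F(w_k) + ξ_{k+1}‖², and ∑_{k≥1} k‖z_{k+1} − z_k‖². -/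
open scoped RealInnerProductSpace Pointwise
open Filter

/-- Lyapunov energy of the Fast RFB iteration at time `t`. -/
noncomputable def rfbEnergy {H : Type*} [NormedAddCommGroup H] [InnerProductSpace ℝ H]
    (α c ε t : ℝ) (x y V e D : H) : ℝ :=
  ‖(α - c) • x + y + (t + α - 1) • V‖ ^ 2 / 2 + (α - c) * (c - 1) / 2 * ‖x‖ ^ 2
    - ε / 2 * (‖y + (t + α - 1) • V‖ ^ 2 - ‖y‖ ^ 2)
    - ε * (t + (α - c) - 1) * ⟪e, y⟫ + ε / 4 * (t + (α - c) - 1) ^ 2 * ‖D‖ ^ 2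

/-- Exact variation of the energy along one step of the iteration, in terms of the new state. -/
theorem rfbEnergy_sub_eq {H : Type*} [NormedAddCommGroup H] [InnerProductSpace ℝ H]
    (α c ε t : ℝ) (x Δ V D e e' D₀ : H) :
    rfbEnergy α c ε (t + 1) x ((t + 1) • Δ) V e' D
      - rfbEnergy α c ε t (x - Δ) ((t + α) • Δ + c • V + (t + α - c) • D) (V - D) e D₀ =
    - t * ((c - 1) * ‖Δ‖ ^ 2 + (2 * (c - 1) - ε * (α - 2)) * ⟪Δ, V⟫
        + (c - 1) * (1 - ε) * ‖V‖ ^ 2)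
      - (c - 1) * (α - c) * ⟪x, V⟫ + (c - 1) * (α - c) * ⟪x, D⟫
      - ε * (t + 1) * (t + (α - c)) * (⟪D, Δ⟫ + ⟪e', Δ⟫ - ⟪e, Δ⟫)
      + ε * (t + (α - c) - 1) * (t + (α - c)) * ⟪e, D⟫
      - ε / 4 * (t + (α - c)) ^ 2 * ‖D‖ ^ 2 - ε / 4 * (t + (α - c) - 1) ^ 2 * ‖D₀‖ ^ 2
      + ((-(c - 1) - (α - c) * (c - 1) / 2) * ‖Δ‖ ^ 2
        + ((c - 1) * (-(1 + α)) + ε * (c - 1 + α * (α - 1) - c)) * ⟪Δ, V⟫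
        + (c - 1) * α * (ε - 1) * ‖V‖ ^ 2
        + (((c - 1) * (1 - ε) - ε * (α - 1)) * t
            + ((c - 1) * (1 - ε) - ε * (α - 1) * (α - c))) * ⟪D, Δ⟫
        + (((c - 1) * (1 - ε) - ε * c) * t
            + ((c - 1) * (1 - ε) * α - ε * c * (α - c))) * ⟪D, V⟫
        + (ε * (α - 2) * t + ε * ((α - c - 1) * α - (α - c))) * ⟪e, Δ⟫
        + (ε * c * t + ε * c * (α - c - 1)) * ⟪e, V⟫
        - (c - 1) ^ 2 / 2 * ‖Δ + V - D‖ ^ 2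
        + ε / 2 * ‖(α - 1) • Δ + (c - 1) • V - (c - 1) • D‖ ^ 2
        - ε / 2 * ‖(α - 1) • Δ + c • V‖ ^ 2) := by
  simp only [rfbEnergy, ← real_inner_self_eq_norm_sq, inner_add_left, inner_add_right,
    inner_sub_left, inner_sub_right, real_inner_smul_left, real_inner_smul_right,
    real_inner_comm Δ x, real_inner_comm V x, real_inner_comm D x,
    real_inner_comm V Δ, real_inner_comm Δ D, real_inner_comm V D]
  ring

theorem mul_le_abs_mul_of_abs_le {p i P : ℝ} (h : |i| ≤ P) : p * i ≤ |p| * P :=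
  (le_abs_self _).trans (by rw [abs_mul]; gcongr)

theorem affine_mul_le {p q t i P : ℝ} (ht : 1 ≤ t) (h : |i| ≤ P) :
    (p * t + q) * i ≤ (|p| + |q|) * (t * P) := by
  have hP : 0 ≤ P := (abs_nonneg i).trans h
  have h1 : |p * t + q| ≤ (|p| + |q|) * t := by
    refine (abs_add_le _ _).trans ?_
    rw [abs_mul, abs_of_nonneg (by linarith : (0 : ℝ) ≤ t)]
    nlinarith [abs_nonneg q]
  calc (p * t + q) * i ≤ |p * t + q| * P := mul_le_abs_mul_of_abs_le h
    _ ≤ (|p| + |q|) * t * P := by gcongr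
    _ = _ := by ring

theorem exists_remainder_bound {H : Type*} [NormedAddCommGroup H] [InnerProductSpace ℝ H]
    (p₁ p₂ p₃ p₄ q₄ p₅ q₅ p₆ q₆ p₇ q₇ r s₁ s₂ s₃ : ℝ) :
    ∃ C : ℝ, 0 < C ∧ ∀ t : ℝ, 1 ≤ t → ∀ Δ V D e D₀ : H, ‖e‖ ≤ ‖D₀‖ →
      p₁ * ‖Δ‖ ^ 2 + p₂ * ⟪Δ, V⟫ + p₃ * ‖V‖ ^ 2 + (p₄ * t + q₄) * ⟪D, Δ⟫
        + (p₅ * t + q₅) * ⟪D, V⟫ + (p₆ * t + q₆) * ⟪e, Δ⟫ + (p₇ * t + q₇) * ⟪e, V⟫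
        + r * ‖s₁ • Δ + s₂ • V - s₃ • D‖ ^ 2
      ≤ C * (‖Δ‖ ^ 2 + ‖V‖ ^ 2 + ‖D‖ ^ 2)
        + C * (t * ((‖Δ‖ + ‖V‖) * (‖D‖ + ‖D₀‖))) := by
  set S := |s₁| + |s₂| + |s₃| with hS
  refine ⟨1 + |p₁| + |p₂| + |p₃| + (|p₄| + |q₄|) + (|p₅| + |q₅|) + (|p₆| + |q₆|)
    + (|p₇| + |q₇|) + |r| * (3 * S ^ 2), by positivity, ?_⟩
  intro t ht Δ V D e D₀ he
  have hA := norm_nonneg Δ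
  have hB := norm_nonneg V
  have hD := norm_nonneg D
  have hD₀ := norm_nonneg D₀
  set N := ‖Δ‖ ^ 2 + ‖V‖ ^ 2 + ‖D‖ ^ 2 with hN
  set P := (‖Δ‖ + ‖V‖) * (‖D‖ + ‖D₀‖) with hP
  have hN0 : 0 ≤ N := by positivity
  have hP0 : 0 ≤ t * P := by positivity
  have b1 : p₁ * ‖Δ‖ ^ 2 ≤ |p₁| * N :=
    mul_le_abs_mul_of_abs_le (by rw [abs_of_nonneg (by positivity)]; nlinarith)
  have b3 : p₃ * ‖V‖ ^ 2 ≤ |p₃| * N :=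
    mul_le_abs_mul_of_abs_le (by rw [abs_of_nonneg (by positivity)]; nlinarith)
  have b2 : p₂ * ⟪Δ, V⟫ ≤ |p₂| * N :=
    mul_le_abs_mul_of_abs_le ((abs_real_inner_le_norm _ _).trans
      (by nlinarith [sq_nonneg (‖Δ‖ - ‖V‖)]))
  have hPe : P = ‖D‖ * ‖Δ‖ + ‖D‖ * ‖V‖ + ‖D₀‖ * ‖Δ‖ + ‖D₀‖ * ‖V‖ := by ring
  have hDA := mul_nonneg hD hA
  have hDB := mul_nonneg hD hB
  have hEA := mul_nonneg hD₀ hA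
  have hEB := mul_nonneg hD₀ hB
  have b4 : (p₄ * t + q₄) * ⟪D, Δ⟫ ≤ (|p₄| + |q₄|) * (t * P) :=
    affine_mul_le ht ((abs_real_inner_le_norm _ _).trans (by linarith))
  have b5 : (p₅ * t + q₅) * ⟪D, V⟫ ≤ (|p₅| + |q₅|) * (t * P) :=
    affine_mul_le ht ((abs_real_inner_le_norm _ _).trans (by linarith))
  have b6 : (p₆ * t + q₆) * ⟪e, Δ⟫ ≤ (|p₆| + |q₆|) * (t * P) :=
    affine_mul_le ht ((abs_real_inner_le_norm _ _).trans
      ((mul_le_mul_of_nonneg_right he hA).trans (by linarith)))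
  have b7 : (p₇ * t + q₇) * ⟪e, V⟫ ≤ (|p₇| + |q₇|) * (t * P) :=
    affine_mul_le ht ((abs_real_inner_le_norm _ _).trans
      ((mul_le_mul_of_nonneg_right he hB).trans (by linarith)))
  have hn : ‖s₁ • Δ + s₂ • V - s₃ • D‖ ≤ S * (‖Δ‖ + ‖V‖ + ‖D‖) := by
    calc ‖s₁ • Δ + s₂ • V - s₃ • D‖ ≤ ‖s₁ • Δ‖ + ‖s₂ • V‖ + ‖s₃ • D‖ :=
          (norm_sub_le _ _).trans (by gcongr; exact norm_add_le _ _)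
      _ = |s₁| * ‖Δ‖ + |s₂| * ‖V‖ + |s₃| * ‖D‖ := by simp [norm_smul]
      _ ≤ S * ‖Δ‖ + S * ‖V‖ + S * ‖D‖ := by
          have := abs_nonneg s₁
          have := abs_nonneg s₂
          have := abs_nonneg s₃
          gcongr <;> linarith
      _ = _ := by ring
  have b8 : r * ‖s₁ • Δ + s₂ • V - s₃ • D‖ ^ 2 ≤ |r| * (3 * S ^ 2 * N) := by
    refine mul_le_abs_mul_of_abs_le ?_
    rw [abs_of_nonneg (by positivity)]
    calc ‖s₁ • Δ + s₂ • V - s₃ • D‖ ^ 2 ≤ (S * (‖Δ‖ + ‖V‖ + ‖D‖)) ^ 2 := by gcongr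
      _ = S ^ 2 * (‖Δ‖ + ‖V‖ + ‖D‖) ^ 2 := by ring
      _ ≤ S ^ 2 * (3 * N) := by
          gcongr
          nlinarith [sq_nonneg (‖Δ‖ - ‖V‖), sq_nonneg (‖Δ‖ - ‖D‖), sq_nonneg (‖V‖ - ‖D‖)]
      _ = _ := by ring
  refine (add_le_add (add_le_add (add_le_add (add_le_add (add_le_add (add_le_add
    (add_le_add b1 b2) b3) b4) b5) b6) b7) b8).trans ?_
  have h0 : 0 ≤ (|p₄| + |q₄| + |p₅| + |q₅| + |p₆| + |q₆| + |p₇| + |q₇| + 1) * N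
      + (|p₁| + |p₂| + |p₃| + |r| * (3 * S ^ 2) + 1) * (t * P) := by positivity
  linear_combination h0

theorem exists_forall_ge_absorb {C η : ℝ} (hC : 0 < C) (hη : 0 < η) :
    ∃ K : ℝ, 1 ≤ K ∧ ∀ t : ℝ, K ≤ t → ∀ A B d d₀ : ℝ,
      C * (A ^ 2 + B ^ 2 + d ^ 2) + C * (t * ((A + B) * (d + d₀)))
        ≤ η * t * (A ^ 2 + B ^ 2) + η * t ^ 2 * (d ^ 2 + d₀ ^ 2) := by
  refine ⟨1 + (C + 2 * C ^ 2 / η) / η + 2 * C / η, by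
    have : 0 < (C + 2 * C ^ 2 / η) / η + 2 * C / η := by positivity
    linarith, ?_⟩
  intro t ht A B d d₀
  have p1 : 0 < (C + 2 * C ^ 2 / η) / η := by positivity
  have p2 : 0 < 2 * C / η := by positivity
  have h1 : C + 2 * C ^ 2 / η ≤ η * t := by
    have : (C + 2 * C ^ 2 / η) / η ≤ t := by linarith
    rwa [div_le_iff₀' hη] at this
  have h2 : C ≤ η / 2 * t ^ 2 := by
    have : 2 * C / η ≤ t := by linarith
    rw [div_le_iff₀' hη] at this
    nlinarith
  have h3 : C * (t * ((A + B) * (d + d₀))) ≤ η / 4 * t ^ 2 * (d + d₀) ^ 2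
      + C ^ 2 / η * (A + B) ^ 2 := by
    have : η / 4 * t ^ 2 * (d + d₀) ^ 2 + C ^ 2 / η * (A + B) ^ 2
        - C * (t * ((A + B) * (d + d₀)))
        = (η / 2 * t * (d + d₀) - C * (A + B)) ^ 2 / η := by
      field_simp
      ring
    have : 0 ≤ (η / 2 * t * (d + d₀) - C * (A + B)) ^ 2 / η := by positivity
    linarith
  have h4 : η / 4 * t ^ 2 * (d + d₀) ^ 2 ≤ η / 4 * t ^ 2 * (2 * (d ^ 2 + d₀ ^ 2)) := by
    gcongr
    nlinarith [sq_nonneg (d - d₀)]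
  have h5 : C ^ 2 / η * (A + B) ^ 2 ≤ C ^ 2 / η * (2 * (A ^ 2 + B ^ 2)) := by
    gcongr
    nlinarith [sq_nonneg (A - B)]
  have h6 := mul_le_mul_of_nonneg_right h1 (by positivity : 0 ≤ A ^ 2 + B ^ 2)
  have h7 := mul_le_mul_of_nonneg_right h2 (by positivity : 0 ≤ d ^ 2)
  have h8 : 0 ≤ η * t ^ 2 * d₀ ^ 2 := by positivity
  have h9 : C ^ 2 / η * (2 * (A ^ 2 + B ^ 2)) = 2 * C ^ 2 / η * (A ^ 2 + B ^ 2) := by ring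
  nlinarith

theorem quadratic_form_lower_bound {H : Type*} [NormedAddCommGroup H] [InnerProductSpace ℝ H]
    {b g ε η : ℝ} (hb : 0 < b) (hε : 0 < ε) (hε' : ε * g ^ 2 ≤ b * (g - b))
    (hη0 : 0 ≤ η) (hη₁ : 4 * η ≤ b) (hη₂ : 6 * η ≤ ε * (g - b)) (Δ V : H) :
    η * (‖Δ‖ ^ 2 + ‖V‖ ^ 2) ≤
      b * ‖Δ‖ ^ 2 + (2 * b - ε * g) * ⟪Δ, V⟫ + b * (1 - ε) * ‖V‖ ^ 2 := by
  have hh : ‖Δ + V‖ ^ 2 = ‖Δ‖ ^ 2 + 2 * ⟪Δ, V⟫ + ‖V‖ ^ 2 := norm_add_sq_real _ _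
  have hi : ⟪Δ + V, V⟫ = ⟪Δ, V⟫ + ‖V‖ ^ 2 := by
    rw [inner_add_left, real_inner_self_eq_norm_sq]
  have hsq : ⟪Δ + V, V⟫ ^ 2 ≤ ‖Δ + V‖ ^ 2 * ‖V‖ ^ 2 := by
    rw [← mul_pow, ← sq_abs]; gcongr; exact abs_real_inner_le_norm _ _
  have hA : ‖Δ‖ ^ 2 ≤ 2 * ‖Δ + V‖ ^ 2 + 2 * ‖V‖ ^ 2 := by
    have := norm_add_sq_real (Δ + V) V
    nlinarith [sq_nonneg ‖Δ + V + V‖]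
  have key : ε * g * ⟪Δ + V, V⟫ ≤ b / 2 * ‖Δ + V‖ ^ 2 + ε * (g - b) / 2 * ‖V‖ ^ 2 := by
    have h0 : 0 ≤ ‖b • (Δ + V) - (ε * g) • V‖ ^ 2 := by positivity
    rw [norm_sub_sq_real, norm_smul, norm_smul, real_inner_smul_left, real_inner_smul_right,
      mul_pow, mul_pow, Real.norm_eq_abs, Real.norm_eq_abs, sq_abs, sq_abs] at h0
    have h1 : (ε * g) ^ 2 * ‖V‖ ^ 2 ≤ b * (ε * (g - b)) * ‖V‖ ^ 2 := by
      gcongr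
      nlinarith
    have h2 : 0 ≤ b * (b / 2 * ‖Δ + V‖ ^ 2 + ε * (g - b) / 2 * ‖V‖ ^ 2
        - ε * g * ⟪Δ + V, V⟫) := by nlinarith
    linarith [nonneg_of_mul_nonneg_right h2 hb]
  have hV : 0 ≤ ‖V‖ ^ 2 := by positivity
  have hU : 0 ≤ ‖Δ + V‖ ^ 2 := by positivity
  have h3 := mul_le_mul_of_nonneg_right hη₁ hU
  have h4 := mul_le_mul_of_nonneg_right hη₂ hV
  have h5 := mul_le_mul_of_nonneg_left hA hη0
  rw [hi] at key
  nlinarith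

/-- The energy controls the distance to the solution. -/
theorem rfbEnergy_lower_bound {H : Type*} [NormedAddCommGroup H] [InnerProductSpace ℝ H]
    {α c ε ℓ t : ℝ} (hc : 1 < c) (hcα : c < α - 1) (hε : 0 < ε) (hε₁ : ε ≤ 1)
    (hε₂ : 4 * ε * (α - c) * (1 + α) ^ 2 ≤ c - 1) (hℓ : ℓ ≤ 1 / 2)
    (ht : 1 ≤ t) {x y V e D : H} (he : ‖e‖ ≤ ℓ * ‖D‖) (hx : 0 ≤ ⟪x, V + e⟫) :
    (α - c) * (c - 1) / 4 * ‖x‖ ^ 2 ≤ rfbEnergy α c ε t x y V e D := by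
  set lam := α - c with hlam
  have hl : 1 < lam := by linarith
  set S := ‖lam • x + y + (t + α - 1) • V‖ with hS
  set r := ‖lam • x + y‖ with hr
  set u := (t + lam - 1) * ‖D‖ with hu
  have htl : 0 ≤ t + lam - 1 := by linarith
  have hu0 : 0 ≤ u := by positivity
  have hid : rfbEnergy α c ε t x y V e D = (1 - ε) / 2 * S ^ 2 + ε / 2 * r ^ 2
      + lam * (c - 1) / 2 * ‖x‖ ^ 2 + ε * lam * (t + α - 1) * ⟪x, V⟫
      - ε * (t + lam - 1) * ⟪e, y⟫ + ε / 4 * u ^ 2 := by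
    simp only [rfbEnergy, hS, hr, hu, ← hlam, mul_pow, ← real_inner_self_eq_norm_sq,
      inner_add_left, inner_add_right, real_inner_smul_left, real_inner_smul_right,
      real_inner_comm x V, real_inner_comm y V, real_inner_comm x y]
    ring
  have heD : ‖e‖ ≤ ‖D‖ / 2 := he.trans (by nlinarith [norm_nonneg D])
  have hxV : -(‖x‖ * (α * u)) / 2 ≤ (t + α - 1) * ⟪x, V⟫ := by
    rw [inner_add_right] at hx
    have h1 : ⟪x, e⟫ ≤ ‖x‖ * (‖D‖ / 2) :=
      (real_inner_le_norm _ _).trans (by gcongr)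
    have h2 : (t + α - 1) * ‖D‖ ≤ α * u := by
      have : t + α - 1 ≤ α * (t + lam - 1) := by nlinarith
      nlinarith [mul_le_mul_of_nonneg_right this (norm_nonneg D)]
    have h3 : (t + α - 1) * -(‖x‖ * (‖D‖ / 2)) ≤ (t + α - 1) * ⟪x, V⟫ :=
      mul_le_mul_of_nonneg_left (by linarith) (by linarith)
    nlinarith [mul_le_mul_of_nonneg_left h2 (norm_nonneg x)]
  have hey : (t + lam - 1) * ⟪e, y⟫ ≤ u / 2 * (r + lam * ‖x‖) := by
    have h1 : ‖y‖ ≤ r + lam * ‖x‖ := by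
      have : y = (lam • x + y) - lam • x := by abel
      calc ‖y‖ = ‖(lam • x + y) - lam • x‖ := by rw [← this]
        _ ≤ r + ‖lam • x‖ := norm_sub_le _ _
        _ = _ := by rw [norm_smul, Real.norm_of_nonneg (by linarith)]
    have h2 : ⟪e, y⟫ ≤ ‖D‖ / 2 * (r + lam * ‖x‖) :=
      (real_inner_le_norm _ _).trans (by gcongr)
    calc _ ≤ (t + lam - 1) * (‖D‖ / 2 * (r + lam * ‖x‖)) := by gcongr
      _ = _ := by rw [hu]; ring
  have hsq : -(2 * (lam * (1 + α)) ^ 2 * ‖x‖ ^ 2) ≤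
      r ^ 2 - u * r + u ^ 2 / 2 - lam * (1 + α) * ‖x‖ * u := by
    linear_combination sq_nonneg (u / 2 - r) + sq_nonneg (u / 2 - lam * (1 + α) * ‖x‖)
      + sq_nonneg (lam * (1 + α) * ‖x‖)
  have hfin : ε * (2 * (lam * (1 + α)) ^ 2 * ‖x‖ ^ 2) ≤ lam * (c - 1) / 2 * ‖x‖ ^ 2 := by
    have := mul_le_mul_of_nonneg_right hε₂ (by positivity : 0 ≤ lam / 2 * ‖x‖ ^ 2)
    linear_combination this
  have hS0 : 0 ≤ (1 - ε) / 2 * S ^ 2 := mul_nonneg (by linarith) (sq_nonneg _)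
  have e1 := mul_le_mul_of_nonneg_left hxV (by positivity : 0 ≤ ε * lam)
  have e2 := mul_le_mul_of_nonneg_left hey hε.le
  have e3 := mul_le_mul_of_nonneg_left hsq hε.le
  rw [hid]
  linear_combination hS0 + e1 + e2 + 1 / 2 * e3 + 1 / 2 * hfin

theorem cross_term_le {H : Type*} [NormedAddCommGroup H] [InnerProductSpace ℝ H]
    {ε η ℓ t m : ℝ} {e e' D D₀ : H} (ht : 0 ≤ t) (hm₁ : t ≤ m - 1) (hε : 0 ≤ ε) (hη : 0 ≤ η)
    (hηℓ : η ≤ ε * (1 - 2 * ℓ) / 4) (he : ‖e‖ ≤ ℓ * ‖D₀‖) (he' : ‖e'‖ ≤ ℓ * ‖D‖) :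
    ε * (m - 1) * m * ⟪e, D⟫ - ε / 4 * m ^ 2 * ‖D‖ ^ 2 - ε / 4 * (m - 1) ^ 2 * ‖D₀‖ ^ 2
      ≤ -(η * t ^ 2 * (‖D‖ ^ 2 + ‖D₀‖ ^ 2)) := by
  have hm : t ≤ m := by linarith
  have h1 : (m - 1) * m * ⟪e, D⟫ ≤ (m - 1) * m * (ℓ * ‖D₀‖ * ‖D‖) := by
    have : 0 ≤ (m - 1) * m := mul_nonneg (by linarith) (by linarith)
    gcongr
    exact (real_inner_le_norm _ _).trans (by gcongr)
  have h2 : (m - 1) * m * (ℓ * ‖D₀‖ * ‖D‖)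
      ≤ ℓ / 2 * (m ^ 2 * ‖D‖ ^ 2 + (m - 1) ^ 2 * ‖D₀‖ ^ 2) := by
    rcases le_or_gt 0 ℓ with h | h
    · have := mul_nonneg (half_pos (zero_lt_one' ℝ)).le
        (mul_nonneg h (sq_nonneg (m * ‖D‖ - (m - 1) * ‖D₀‖)))
      linear_combination this
    · have h0 : ‖D₀‖ = 0 :=
        le_antisymm (by nlinarith [norm_nonneg D₀, norm_nonneg e]) (norm_nonneg D₀)
      have h0' : ‖D‖ = 0 :=
        le_antisymm (by nlinarith [norm_nonneg D, norm_nonneg e']) (norm_nonneg D)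
      simp [h0, h0']
  have h3 : t ^ 2 * ‖D‖ ^ 2 ≤ m ^ 2 * ‖D‖ ^ 2 := by gcongr
  have h4 : t ^ 2 * ‖D₀‖ ^ 2 ≤ (m - 1) ^ 2 * ‖D₀‖ ^ 2 := by gcongr
  have h5 := mul_le_mul_of_nonneg_left (add_le_add h3 h4) hη
  have h6 := mul_le_mul_of_nonneg_right hηℓ
    (by positivity : 0 ≤ m ^ 2 * ‖D‖ ^ 2 + (m - 1) ^ 2 * ‖D₀‖ ^ 2)
  linear_combination ε * h1 + ε * h2 + h5 + h6

/-- Quasi-decrease of the energy along one step, for a suitable `ε` and all large times. -/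
theorem exists_rfbEnergy_step {H : Type*} [NormedAddCommGroup H] [InnerProductSpace ℝ H]
    {α c ℓ : ℝ} (hc : 1 < c) (hcα : c < α - 1) (hℓ : ℓ < 1 / 2) :
    ∃ ε σ C K : ℝ, 0 < ε ∧ ε ≤ 1 ∧ 4 * ε * (α - c) * (1 + α) ^ 2 ≤ c - 1 ∧ 0 < σ ∧ 0 ≤ C ∧
      1 ≤ K ∧ ∀ t : ℝ, K ≤ t → ∀ x Δ V D e e' D₀ : H, ‖e‖ ≤ ℓ * ‖D₀‖ → ‖e'‖ ≤ ℓ * ‖D‖ →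
        0 ≤ ⟪D + e' - e, Δ⟫ → 0 ≤ ⟪x - Δ, V - D + e⟫ →
        rfbEnergy α c ε (t + 1) x ((t + 1) • Δ) V e' D
          + (σ * (t * (‖Δ‖ ^ 2 + ‖V‖ ^ 2)) + σ * (t ^ 2 * ‖D‖ ^ 2)
            + (c - 1) * (α - c) * ⟪x, V + e'⟫)
        ≤ (1 + C * (1 / t ^ 2)) * rfbEnergy α c ε t (x - Δ)
            ((t + α) • Δ + c • V + (t + α - c) • D) (V - D) e D₀ := by
  have hb : 0 < c - 1 := by linarith
  have hf : 0 < α - 1 - c := by linarith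
  have hl : 1 < α - c := by linarith
  have hl0 : 0 < α - c := by linarith
  have hα : 0 < 1 + α := by linarith
  obtain ⟨ε, hε, hεle⟩ : ∃ ε : ℝ, 0 < ε ∧ ε ≤ min 1 (min ((c - 1) * (α - 1 - c) / (1 + (α - 2) ^ 2))
      ((c - 1) / (4 * (α - c) * (1 + α) ^ 2))) :=
    ⟨_, by positivity, le_rfl⟩
  rw [le_min_iff, le_min_iff, le_div_iff₀ (by positivity), le_div_iff₀ (by positivity)] at hεle
  obtain ⟨hε₁, hε₂, hε₃⟩ := hεle
  have hσ₀ : 0 < ε * (1 - 2 * ℓ) / 4 := by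
    have : 0 < 1 - 2 * ℓ := by linarith
    positivity
  obtain ⟨η, hη, hηle⟩ : ∃ η : ℝ, 0 < η ∧ η ≤ min (ε * (1 - 2 * ℓ) / 4)
      (min ((c - 1) / 4) (ε * (α - 1 - c) / 6)) :=
    ⟨_, by positivity, le_rfl⟩
  rw [le_min_iff, le_min_iff] at hηle
  obtain ⟨hη₁, hη₂, hη₃⟩ := hηle
  obtain ⟨C₁, hC₁, hrem⟩ := exists_remainder_bound (H := H)
    (-(c - 1) - (α - c) * (c - 1) / 2)
    ((c - 1) * (-(1 + α)) + ε * (c - 1 + α * (α - 1) - c))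
    ((c - 1) * α * (ε - 1))
    ((c - 1) * (1 - ε) - ε * (α - 1)) ((c - 1) * (1 - ε) - ε * (α - 1) * (α - c))
    ((c - 1) * (1 - ε) - ε * c) ((c - 1) * (1 - ε) * α - ε * c * (α - c))
    (ε * (α - 2)) (ε * ((α - c - 1) * α - (α - c)))
    (ε * c) (ε * c * (α - c - 1)) (ε / 2) (α - 1) (c - 1) (c - 1)
  set p := 2 * ((c - 1) * (α - c)) with hp
  have hp0 : 0 < p := by positivity
  obtain ⟨K, hK, habs⟩ := exists_forall_ge_absorb (add_pos hC₁ hp0) (half_pos hη)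
  refine ⟨ε, η / 4, p ^ 2 / η * (4 / ((α - c) * (c - 1))), K, hε, hε₁, by linarith, by positivity,
    by positivity, hK, ?_⟩
  intro t ht x Δ V D e e' D₀ he he' hmono hx
  have ht1 : 1 ≤ t := hK.trans ht
  have heD₀ : ‖e‖ ≤ ‖D₀‖ := he.trans (mul_le_of_le_one_left (norm_nonneg D₀) (by linarith))
  have heD : ‖e'‖ ≤ ‖D‖ := he'.trans (mul_le_of_le_one_left (norm_nonneg D) (by linarith))
  have hid := rfbEnergy_sub_eq α c ε t x Δ V D e e' D₀
  have hlow := rfbEnergy_lower_bound (y := (t + α) • Δ + c • V + (t + α - c) • D)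
    hc hcα hε hε₁ (by linarith) hℓ.le ht1 he hx
  set E' := rfbEnergy α c ε (t + 1) x ((t + 1) • Δ) V e' D
  set E := rfbEnergy α c ε t (x - Δ) ((t + α) • Δ + c • V + (t + α - c) • D) (V - D) e D₀
  have hR := hrem t ht1 Δ V D e D₀ heD₀
  have hA := habs t ht ‖Δ‖ ‖V‖ ‖D‖ ‖D₀‖
  have hQ := mul_le_mul_of_nonneg_left (quadratic_form_lower_bound (b := c - 1) (g := α - 2)
    (ε := ε) (η := η) hb hε (by linear_combination hε₂ + hε.le) hη.le (by linarith) (by linarith) Δ V)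
    (by linarith : 0 ≤ t)
  have hM : 0 ≤ ε * (t + 1) * (t + (α - c)) * (⟪D, Δ⟫ + ⟪e', Δ⟫ - ⟪e, Δ⟫) := by
    rw [inner_sub_left, inner_add_left] at hmono
    positivity
  have hD := cross_term_le (by linarith : 0 ≤ t) (by linarith : t ≤ t + (α - c) - 1) hε.le hη.le
    hη₁ he he'
  have hX : (c - 1) * (α - c) * (⟪x, D⟫ + ⟪x, e'⟫)
      ≤ p * (‖Δ‖ ^ 2 + ‖V‖ ^ 2 + ‖D‖ ^ 2) + p * (‖x - Δ‖ * ‖D‖) := by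
    have h1 : ⟪x, D⟫ + ⟪x, e'⟫ ≤ 2 * (‖x‖ * ‖D‖) := by
      have := real_inner_le_norm x D
      have := real_inner_le_norm x e'
      have := mul_le_mul_of_nonneg_left heD (norm_nonneg x)
      linarith
    have h2 : ‖x‖ ≤ ‖x - Δ‖ + ‖Δ‖ := by
      simpa using norm_add_le (x - Δ) Δ
    have h3 := mul_le_mul_of_nonneg_right h2 (norm_nonneg D)
    have h4 : ‖x‖ * ‖D‖ ≤ (‖Δ‖ ^ 2 + ‖V‖ ^ 2 + ‖D‖ ^ 2) + ‖x - Δ‖ * ‖D‖ := by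
      linear_combination h3 + 1 / 2 * sq_nonneg (‖Δ‖ - ‖D‖) + sq_nonneg ‖V‖
        + 1 / 2 * sq_nonneg ‖Δ‖ + 1 / 2 * sq_nonneg ‖D‖
    have hbl : 0 ≤ (c - 1) * (α - c) := by positivity
    linear_combination mul_le_mul_of_nonneg_left h1 hbl + mul_le_mul_of_nonneg_left h4 hp0.le
  have hY : p * (‖x - Δ‖ * ‖D‖) ≤ η / 4 * (t ^ 2 * ‖D‖ ^ 2)
      + p ^ 2 / η * (1 / t ^ 2) * ‖x - Δ‖ ^ 2 := by
    have h0 : 0 ≤ (η / 2 * t * ‖D‖ - p / t * ‖x - Δ‖) ^ 2 / η := by positivity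
    have h1 : (η / 2 * t * ‖D‖ - p / t * ‖x - Δ‖) ^ 2 / η = η / 4 * (t ^ 2 * ‖D‖ ^ 2)
      + p ^ 2 / η * (1 / t ^ 2) * ‖x - Δ‖ ^ 2 - p * (‖x - Δ‖ * ‖D‖) := by
      have : t ≠ 0 := by positivity
      field_simp
      ring
    linarith
  have hZ : p ^ 2 / η * (1 / t ^ 2) * ‖x - Δ‖ ^ 2
      ≤ p ^ 2 / η * (4 / ((α - c) * (c - 1))) * (1 / t ^ 2) * E := by
    have h0 : ‖x - Δ‖ ^ 2 ≤ 4 / ((α - c) * (c - 1)) * E := by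
      rw [div_mul_eq_mul_div, le_div_iff₀ (by positivity)]
      linarith
    calc _ ≤ p ^ 2 / η * (1 / t ^ 2) * (4 / ((α - c) * (c - 1)) * E) := by gcongr
      _ = _ := by ring
  have hs₁ : 0 ≤ (c - 1) ^ 2 / 2 * ‖Δ + V - D‖ ^ 2 := by positivity
  have hs₂ : 0 ≤ ε / 2 * ‖(α - 1) • Δ + c • V‖ ^ 2 := by positivity
  have hs₃ : 0 ≤ η * (t * (‖Δ‖ ^ 2 + ‖V‖ ^ 2)) := by positivity
  have hs₄ : 0 ≤ η * (t ^ 2 * ‖D₀‖ ^ 2) := by positivity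
  have hs₅ : 0 ≤ p * (t * ((‖Δ‖ + ‖V‖) * (‖D‖ + ‖D₀‖))) := by positivity
  rw [inner_add_right]
  linear_combination hid + hR + hA + hQ + hM + hD + hX + hY + hZ + hs₁ + hs₂ + 1 / 4 * hs₃
    + 1 / 2 * hs₄ + hs₅

/-- Deterministic Robbins-Siegmund lemma. -/
theorem summable_of_add_le_one_add_mul {E A τ : ℕ → ℝ} (hE : ∀ n, 0 ≤ E n) (hA : ∀ n, 0 ≤ A n)
    (hτ₀ : ∀ n, 0 ≤ τ n) (hτ : Summable τ) (h : ∀ n, E (n + 1) + A n ≤ (1 + τ n) * E n) :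
    Summable A := by
  have key : ∀ n, E n + ∑ i ∈ Finset.range n, A i ≤ (∏ i ∈ Finset.range n, (1 + τ i)) * E 0 := by
    intro n
    induction n with
    | zero => simp
    | succ n ih =>
      rw [Finset.sum_range_succ, Finset.prod_range_succ]
      have hS : 0 ≤ ∑ i ∈ Finset.range n, A i := Finset.sum_nonneg fun i _ => hA i
      have h1 := mul_le_mul_of_nonneg_left ih (by linarith [hτ₀ n] : 0 ≤ 1 + τ n)
      linarith [h n, mul_nonneg (hτ₀ n) hS]
  refine summable_of_sum_range_le (c := Real.exp (∑' i, τ i) * E 0) hA fun n => ?_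
  have hprod : ∏ i ∈ Finset.range n, (1 + τ i) ≤ Real.exp (∑' i, τ i) := by
    calc ∏ i ∈ Finset.range n, (1 + τ i) ≤ ∏ i ∈ Finset.range n, Real.exp (τ i) :=
          Finset.prod_le_prod (fun i _ => by linarith [hτ₀ i])
            fun i _ => by linarith [Real.add_one_le_exp (τ i)]
      _ = Real.exp (∑ i ∈ Finset.range n, τ i) := (Real.exp_sum _ _).symm
      _ ≤ _ := Real.exp_le_exp.2 (hτ.sum_le_tsum _ fun i _ => hτ₀ i)
  linarith [key n, hE n, mul_le_mul_of_nonneg_right hprod (hE 0)]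

theorem Summable.exists_tendsto_sum_Icc_one {f : ℕ → ℝ} (hf : Summable f) :
    ∃ S : ℝ, Tendsto (fun K : ℕ => ∑ k ∈ Finset.Icc 1 K, f k) atTop (nhds S) := by
  refine ⟨∑' k, f (k + 1), ?_⟩
  have h := ((summable_nat_add_iff 1).2 hf).hasSum.tendsto_sum_nat
  refine h.congr fun K => ?_
  rw [Finset.range_eq_Ico, Finset.sum_Ico_add' f 0 K 1]
  rfl

theorem stmt_6
    {H : Type*} [NormedAddCommGroup H] [InnerProductSpace ℝ H] [CompleteSpace H]
    (M : H → Set H) (F : H → H) (L α c γ : ℝ)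
    (hM : ∀ z y u' v', u' ∈ M z → v' ∈ M y → 0 ≤ ⟪v' - u', y - z⟫)
    (hFmono : ∀ z y, 0 ≤ ⟪F y - F z, y - z⟫)
    (hL : 0 < L)
    (hFlip : ∀ z y, ‖F y - F z‖ ≤ L * ‖y - z‖)
    (hα : 2 < α) (hcl : α / 2 < c) (hcu : c < α - 1)
    (hγ0 : 0 < γ) (hγ : γ < 1 / (2 * L))
    (z w ξ v : ℕ → H)
    (hξ : ∀ k : ℕ, 1 ≤ k → ξ k ∈ M (z k))
    (hv : ∀ k : ℕ, 1 ≤ k → v k = ξ k + F (w (k - 1)))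
    (hw : ∀ k : ℕ, 1 ≤ k →
      w k = z k + ((k : ℝ) / ((k : ℝ) + α)) • (z k - z (k - 1)) - ((c / ((k : ℝ) + α)) * γ) • v k)
    (hz : ∀ k : ℕ, 1 ≤ k → z (k + 1) = w k - γ • (v (k + 1) - v k))
    (zs : H) (hzs : -F zs ∈ M zs) :
    (∀ k : ℕ, 1 ≤ k → 0 ≤ ⟪z k - zs, F (z k) + ξ k⟫) ∧
    (∃ S : ℝ, Tendsto (fun K : ℕ => ∑ k ∈ Finset.Icc 1 K, ⟪z k - zs, F (z k) + ξ k⟫)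
      atTop (nhds S)) ∧
    (∃ S : ℝ, Tendsto (fun K : ℕ => ∑ k ∈ Finset.Icc 1 K, (k : ℝ) ^ 2 * ‖v (k + 1) - v k‖ ^ 2)
      atTop (nhds S)) ∧
    (∃ S : ℝ, Tendsto (fun K : ℕ => ∑ k ∈ Finset.Icc 1 K, (k : ℝ) * ‖F (w k) + ξ (k + 1)‖ ^ 2)
      atTop (nhds S)) ∧
    (∃ S : ℝ, Tendsto (fun K : ℕ => ∑ k ∈ Finset.Icc 1 K, (k : ℝ) * ‖z (k + 1) - z k‖ ^ 2)
      atTop (nhds S)) := by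
  have hmain : ∀ k : ℕ, 1 ≤ k → 0 ≤ ⟪z k - zs, F (z k) + ξ k⟫ := by
    intro k hk
    have h1 := hM zs (z k) _ _ hzs (hξ k hk)
    have h2 := hFmono zs (z k)
    have : ⟪z k - zs, F (z k) + ξ k⟫ = ⟪ξ k - -F zs, z k - zs⟫ + ⟪F (z k) - F zs, z k - zs⟫ := by
      rw [← inner_add_left, real_inner_comm]
      congr 1
      abel
    linarith
  have hγL : γ * L < 1 / 2 := by
    rw [lt_div_iff₀ (by positivity)] at hγ
    linarith
  obtain ⟨ε, σ, C, K, hε, hε₁, hε₂, hσ, hC, hK, hstep⟩ := exists_rfbEnergy_step (H := H)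
    (by linarith : 1 < c) hcu hγL
  have hcb : 0 < (c - 1) * (α - c) := mul_pos (by linarith) (by linarith)
  obtain ⟨N, hN⟩ := exists_nat_ge K
  have hN1 : 1 ≤ N := by exact_mod_cast hK.trans hN
  have herr : ∀ k : ℕ, 1 ≤ k →
      ‖γ • (F (z (k + 1)) - F (w k))‖ ≤ γ * L * ‖γ • (v (k + 1) - v k)‖ := by
    intro k hk
    have h1 := hFlip (w k) (z (k + 1))
    have h2 : z (k + 1) - w k = -(γ • (v (k + 1) - v k)) := by rw [hz k hk]; abel
    rw [h2, norm_neg] at h1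
    rw [norm_smul, Real.norm_of_nonneg hγ0.le, mul_assoc]
    gcongr
  have hG : ∀ k : ℕ, γ • v (k + 1) + γ • (F (z (k + 1)) - F (w k))
      = γ • (F (z (k + 1)) + ξ (k + 1)) := by
    intro k
    rw [hv (k + 1) (by omega), ← smul_add, Nat.add_sub_cancel]
    congr 1
    abel
  have hGx : ∀ k : ℕ, 0 ≤ ⟪z (k + 1) - zs, γ • v (k + 1) + γ • (F (z (k + 1)) - F (w k))⟫ := by
    intro k
    rw [hG, real_inner_smul_right]
    exact mul_nonneg hγ0.le (hmain _ (by omega))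
  let E : ℕ → ℝ := fun k => rfbEnergy α c ε ((k : ℝ) + 1) (z (k + 1) - zs)
    (((k : ℝ) + 1) • (z (k + 1) - z k)) (γ • v (k + 1)) (γ • (F (z (k + 1)) - F (w k)))
    (γ • (v (k + 1) - v k))
  let A : ℕ → ℝ := fun k => σ * ((k : ℝ) * (‖z (k + 1) - z k‖ ^ 2 + ‖γ • v (k + 1)‖ ^ 2))
    + σ * ((k : ℝ) ^ 2 * ‖γ • (v (k + 1) - v k)‖ ^ 2)
    + (c - 1) * (α - c) * ⟪z (k + 1) - zs, γ • v (k + 1) + γ • (F (z (k + 1)) - F (w k))⟫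
  have hE : ∀ k, 1 ≤ k → 0 ≤ E k := by
    intro k hk
    have h1 := rfbEnergy_lower_bound (y := ((k : ℝ) + 1) • (z (k + 1) - z k)) (t := (k : ℝ) + 1)
      (by linarith : 1 < c) hcu hε hε₁ hε₂ hγL.le (by linarith [(Nat.cast_nonneg k : (0 : ℝ) ≤ k)])
      (herr k hk) (hGx k)
    refine le_trans ?_ h1
    have : 0 ≤ (α - c) * (c - 1) := by linarith
    positivity
  have hA1 : ∀ k : ℕ, 0 ≤ σ * ((k : ℝ) * (‖z (k + 1) - z k‖ ^ 2 + ‖γ • v (k + 1)‖ ^ 2)) :=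
    fun k => by positivity
  have hA2 : ∀ k : ℕ, 0 ≤ σ * ((k : ℝ) ^ 2 * ‖γ • (v (k + 1) - v k)‖ ^ 2) := fun k => by positivity
  have hA3 : ∀ k, 0 ≤ (c - 1) * (α - c) *
      ⟪z (k + 1) - zs, γ • v (k + 1) + γ • (F (z (k + 1)) - F (w k))⟫ :=
    fun k => mul_nonneg hcb.le (hGx k)
  have hdecr : ∀ k, N ≤ k → E (k + 1) + A (k + 1)
      ≤ (1 + C * (1 / ((k + 1 : ℕ) : ℝ) ^ 2)) * E k := by
    intro k hk
    have hk1 : 1 ≤ k := hN1.trans hk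
    have hkK : K ≤ (k : ℝ) + 1 := by
      have : (N : ℝ) ≤ k := by exact_mod_cast hk
      linarith
    have hxe : z (k + 1 + 1) - zs - (z (k + 1 + 1) - z (k + 1)) = z (k + 1) - zs := by abel
    have hVe : γ • v (k + 1 + 1) - γ • (v (k + 1 + 1) - v (k + 1)) = γ • v (k + 1) := by
      rw [← smul_sub, sub_sub_cancel]
    have hrec : ((k : ℝ) + 1 + α) • (z (k + 1 + 1) - z (k + 1)) + c • γ • v (k + 1 + 1)
        + ((k : ℝ) + 1 + α - c) • γ • (v (k + 1 + 1) - v (k + 1))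
        = ((k : ℝ) + 1) • (z (k + 1) - z k) := by
      have hne : (k : ℝ) + 1 + α ≠ 0 := by positivity
      rw [hz (k + 1) (by omega), hw (k + 1) (by omega), Nat.add_sub_cancel]
      push_cast
      match_scalars <;> field_simp <;> ring
    have hmono : 0 ≤ ⟪γ • (v (k + 1 + 1) - v (k + 1))
        + γ • (F (z (k + 1 + 1)) - F (w (k + 1))) - γ • (F (z (k + 1)) - F (w k)),
        z (k + 1 + 1) - z (k + 1)⟫ := by
      have h1 := hM _ _ _ _ (hξ (k + 1) (by omega)) (hξ (k + 1 + 1) (by omega))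
      have h2 := hFmono (z (k + 1)) (z (k + 1 + 1))
      have h3 : γ • (v (k + 1 + 1) - v (k + 1))
          + γ • (F (z (k + 1 + 1)) - F (w (k + 1))) - γ • (F (z (k + 1)) - F (w k))
          = γ • ((ξ (k + 1 + 1) - ξ (k + 1)) + (F (z (k + 1 + 1)) - F (z (k + 1)))) := by
        rw [hv (k + 1) (by omega), hv (k + 1 + 1) (by omega), Nat.add_sub_cancel,
          Nat.add_sub_cancel]
        module
      rw [h3, real_inner_smul_left, inner_add_left]
      positivity
    have h := hstep ((k : ℝ) + 1) hkK (z (k + 1 + 1) - zs) (z (k + 1 + 1) - z (k + 1))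
      (γ • v (k + 1 + 1)) (γ • (v (k + 1 + 1) - v (k + 1))) (γ • (F (z (k + 1)) - F (w k)))
      (γ • (F (z (k + 1 + 1)) - F (w (k + 1)))) (γ • (v (k + 1) - v k))
      (herr k hk1) (herr (k + 1) (by omega)) hmono (by rw [hxe, hVe]; exact hGx k)
    rw [hxe, hVe, hrec] at h
    simpa only [E, A, Nat.cast_add, Nat.cast_one] using h
  have hsumA : Summable A := by
    rw [← summable_nat_add_iff (N + 1)]
    refine summable_of_add_le_one_add_mul (E := fun n => E (n + N))
      (τ := fun n => C * (1 / ((n + N + 1 : ℕ) : ℝ) ^ 2)) (fun n => hE _ (by omega))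
      (fun n => add_nonneg (add_nonneg (hA1 _) (hA2 _)) (hA3 _)) (fun n => by positivity) ?_ ?_
    · refine Summable.mul_left C ?_
      have h := (summable_nat_add_iff (f := fun n : ℕ => 1 / (n : ℝ) ^ 2) (N + 1)).2
        (Real.summable_one_div_nat_pow.2 one_lt_two)
      simpa only [← add_assoc] using h
    · intro n
      have h := hdecr (n + N) (by omega)
      rw [show n + 1 + N = n + N + 1 by ring]
      exact h
  refine ⟨hmain, ?_, ?_, ?_, ?_⟩
  · apply Summable.exists_tendsto_sum_Icc_one
    rw [← summable_nat_add_iff 1]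
    have h := hsumA.of_nonneg_of_le hA3 fun k => by
      simp only [A]
      linarith [hA1 k, hA2 k]
    simp only [hG, real_inner_smul_right] at h
    exact (summable_mul_left_iff hγ0.ne').1 ((summable_mul_left_iff hcb.ne').1 h)
  · apply Summable.exists_tendsto_sum_Icc_one
    refine (hsumA.mul_left (1 / (σ * γ ^ 2))).of_nonneg_of_le (fun k => by positivity) fun k => ?_
    rw [one_div_mul_eq_div, le_div_iff₀ (by positivity)]
    have h2 : σ * ((k : ℝ) ^ 2 * ‖γ • (v (k + 1) - v k)‖ ^ 2)
        = (k : ℝ) ^ 2 * ‖v (k + 1) - v k‖ ^ 2 * (σ * γ ^ 2) := by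
      rw [norm_smul, mul_pow, Real.norm_eq_abs, sq_abs]
      ring
    simp only [A]
    linarith [hA1 k, hA3 k]
  · apply Summable.exists_tendsto_sum_Icc_one
    refine (hsumA.mul_left (1 / (σ * γ ^ 2))).of_nonneg_of_le (fun k => by positivity) fun k => ?_
    rw [one_div_mul_eq_div, le_div_iff₀ (by positivity)]
    have h1 : F (w k) + ξ (k + 1) = v (k + 1) := by
      rw [hv (k + 1) (by omega), Nat.add_sub_cancel, add_comm]
    have h2 : σ * ((k : ℝ) * (‖z (k + 1) - z k‖ ^ 2 + ‖γ • v (k + 1)‖ ^ 2))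
        = (k : ℝ) * ‖v (k + 1)‖ ^ 2 * (σ * γ ^ 2) + σ * (k * ‖z (k + 1) - z k‖ ^ 2) := by
      rw [norm_smul, mul_pow, Real.norm_eq_abs, sq_abs]
      ring
    have h3 : 0 ≤ σ * (k * ‖z (k + 1) - z k‖ ^ 2) := by positivity
    rw [h1]
    simp only [A]
    linarith [hA2 k, hA3 k]
  · apply Summable.exists_tendsto_sum_Icc_one
    refine (hsumA.mul_left (1 / σ)).of_nonneg_of_le (fun k => by positivity) fun k => ?_
    rw [one_div_mul_eq_div, le_div_iff₀ (by positivity)]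
    have h3 : 0 ≤ σ * (k * ‖γ • v (k + 1)‖ ^ 2) := by positivity
    simp only [A]
    linarith [hA2 k, hA3 k]
end

section
/- Suppose Zer(M+F) is nonempty and let z* ∈ Zer(M+F). Then the sequence (z_k)_{k≥0} is bounded, and there exists a constant C > 0 such that for all k ≥ 1: ‖z_k − z_{k−1}‖ ≤ C/k, ‖ξ_k + F(w_{k−1})‖ ≤ C/k, ‖ξ_k + F(z_k)‖ ≤ C/k, and |⟨z_k − z*, ξ_k + F(z_k)⟩| ≤ C/k. -/
open scoped RealInnerProductSpace Pointwise
open Filter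

section Energy

variable {H : Type*} [NormedAddCommGroup H] [InnerProductSpace ℝ H]

/-- The Lyapunov function of the iteration, in terms of the distance `x` to the solution, the scaled
velocity `q`, the scaled operator value `g`, the evaluation error `e`, and the increment `p`
of `g`. -/
noncomputable def fastRFBEnergy (c δ μ m : ℝ) (x q g e p : H) : ℝ :=
  1 / 2 * ‖(c + δ - (μ * (c + δ - 1) - (c - 1))) • x + q + m • g‖ ^ 2
    + 1 / 2 * ((c + δ - (μ * (c + δ - 1) - (c - 1))) * (μ * (c + δ - 1) - (c - 1))) * ‖x‖ ^ 2
    - μ * m * ⟪q, g - e⟫ - 1 / 2 * μ * m ^ 2 * ‖g‖ ^ 2 + 1 / 4 * μ * m ^ 2 * ‖p‖ ^ 2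

/-- The energy as a sum of squares and a monotonicity term. -/
lemma fastRFBEnergy_eq (c δ μ m : ℝ) (x q g e p : H) :
    fastRFBEnergy c δ μ m x q g e p =
      1 / 2 * ‖(c + δ - (μ * (c + δ - 1) - (c - 1))) • x + q + m • g - (μ * m) • (g - e)‖ ^ 2
      + 1 / 2 * ((c + δ - (μ * (c + δ - 1) - (c - 1))) * (μ * (c + δ - 1) - (c - 1))) * ‖x‖ ^ 2
      + (c + δ - (μ * (c + δ - 1) - (c - 1))) * μ * m * ⟪x, g - e⟫
      + 1 / 2 * μ * (1 - μ) * m ^ 2 * ‖g - e‖ ^ 2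
      + μ * m ^ 2 * (1 / 4 * ‖p‖ ^ 2 - 1 / 2 * ‖e‖ ^ 2) := by
  unfold fastRFBEnergy
  simp only [← real_inner_self_eq_norm_sq, inner_add_left, inner_add_right, inner_sub_left,
    inner_sub_right, real_inner_smul_left, real_inner_smul_right]
  rw [real_inner_comm x q, real_inner_comm x g, real_inner_comm x e, real_inner_comm q g,
    real_inner_comm q e, real_inner_comm g e]
  ring

/-- The exact change of the energy along one step; `x`, `d`, `g`, `e`, `p` are the values after the
step and `e₀`, `p₀` those before it. -/
lemma fastRFBEnergy_step (c δ μ m : ℝ) (x d g e p e₀ p₀ : H) :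
    fastRFBEnergy c δ μ (m + 1) x ((m - δ) • d) g e p -
      fastRFBEnergy c δ μ m (x - d) ((m + c) • d + c • g + m • p) (g - p) e₀ p₀ =
    -((c + δ - (μ * (c + δ - 1) - (c - 1))) * (c - 1)) * ⟪x, g⟫
      - (μ * (c + δ - 1) - (c - 1)) * (m - δ) * ‖d‖ ^ 2
      + (μ * δ - (μ * (c + δ - 1) - (c - 1)) + (c - 1) * δ) * ⟪d, g⟫
      - ((c - 1) * ((1 - μ) * m + 1) + 1 / 2 * μ) * ‖g‖ ^ 2
      - μ * (m * (c + δ - 1) + δ) * ⟪d, p + e₀⟫ - μ * c * m * ⟪g, p + e₀⟫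
      - μ * m ^ 2 * (1 / 2 * ‖p‖ ^ 2 + ⟪p, e₀⟫)
      + 1 / 4 * μ * ((m + 1) ^ 2 * ‖p‖ ^ 2 - m ^ 2 * ‖p₀‖ ^ 2)
      - μ * (m + 1) * (m - δ) * ⟪d, (g - e) - (g - p - e₀)⟫
      - 1 / 2 * ‖(μ * (c + δ - 1) - (c - 1)) • d + (c - 1) • g‖ ^ 2
      - 1 / 2 * ((c + δ - (μ * (c + δ - 1) - (c - 1))) * (μ * (c + δ - 1) - (c - 1))) * ‖d‖ ^ 2 := by
  unfold fastRFBEnergy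
  simp only [← real_inner_self_eq_norm_sq, inner_add_left, inner_add_right, inner_sub_left,
    inner_sub_right, real_inner_smul_left, real_inner_smul_right]
  rw [real_inner_comm x d, real_inner_comm x g, real_inner_comm x p, real_inner_comm d g,
    real_inner_comm d p, real_inner_comm g p]
  ring

end Energy

/-- Absorption of the lower order terms by the dissipation once `m` is large. -/
lemma dissipation_absorbs {P K m X a b n₁ n₂ : ℝ} (hP : 0 < P) (hK : 0 < K)
    (hm : 0 < m) (h₁ : 8 * K / P ≤ m) (h₂ : 8 * K ^ 2 / P ^ 2 ≤ m)
    (ha : 0 ≤ a) (hb : 0 ≤ b) (hn₁ : 0 ≤ n₁) (hn₂ : 0 ≤ n₂) :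
    K * (X * a) - P * m * (n₁ ^ 2 + n₂ ^ 2) + K * n₁ ^ 2 + K * (n₁ * n₂)
      + K * m * ((n₁ + n₂) * (a + b)) - P * m ^ 2 * (a ^ 2 + b ^ 2) + K * m * a ^ 2
      ≤ K ^ 2 / P / m ^ 2 * X ^ 2 := by
  rw [div_le_iff₀ hP] at h₁
  rw [div_le_iff₀ (by positivity)] at h₂
  have hX : K * (X * a) ≤ K ^ 2 / P / m ^ 2 * X ^ 2 + P / 4 * m ^ 2 * a ^ 2 := by
    have : K ^ 2 / P / m ^ 2 * X ^ 2 + P / 4 * m ^ 2 * a ^ 2 - K * (X * a)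
        = P * (K * X / (P * m) - m * a / 2) ^ 2 := by
      field_simp
      ring
    nlinarith [mul_nonneg hP.le (sq_nonneg (K * X / (P * m) - m * a / 2))]
  have hS : K * n₁ ^ 2 + K * (n₁ * n₂) ≤ P / 4 * m * (n₁ + n₂) ^ 2 := by
    have h : K ≤ P / 4 * m := by nlinarith
    have : K * (n₁ + n₂) ^ 2 ≤ P / 4 * m * (n₁ + n₂) ^ 2 := by gcongr
    nlinarith [mul_nonneg hK.le (mul_nonneg hn₁ hn₂), mul_nonneg hK.le (sq_nonneg n₂)]
  have hT : K * m * a ^ 2 ≤ P / 8 * m ^ 2 * (a + b) ^ 2 := by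
    have h : K * m ≤ P / 8 * m ^ 2 := by nlinarith
    have h' : K * m * a ^ 2 ≤ K * m * (a + b) ^ 2 := by gcongr; linarith
    exact h'.trans (by gcongr)
  have hST : K * m * ((n₁ + n₂) * (a + b)) ≤
      P / 4 * m * (n₁ + n₂) ^ 2 + P / 8 * m ^ 2 * (a + b) ^ 2 := by
    have h : P / 4 * m * (n₁ + n₂) ^ 2 + P / 8 * m ^ 2 * (a + b) ^ 2
        - K * m * ((n₁ + n₂) * (a + b)) =
        m / P * ((P * (n₁ + n₂) / 2 - K * (a + b)) ^ 2
          + (m * P ^ 2 / 8 - K ^ 2) * (a + b) ^ 2) := by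
      field_simp
      ring
    have : 0 ≤ m * P ^ 2 / 8 - K ^ 2 := by linarith
    have : 0 ≤ m / P * ((P * (n₁ + n₂) / 2 - K * (a + b)) ^ 2
          + (m * P ^ 2 / 8 - K ^ 2) * (a + b) ^ 2) := by positivity
    linarith
  have hS2 : P / 2 * m * (n₁ + n₂) ^ 2 ≤ P * m * (n₁ ^ 2 + n₂ ^ 2) := by
    nlinarith [mul_nonneg (mul_pos hP hm).le (sq_nonneg (n₁ - n₂))]
  have hT2 : P / 4 * m ^ 2 * (a + b) ^ 2 + P / 4 * m ^ 2 * a ^ 2 ≤ P * m ^ 2 * (a ^ 2 + b ^ 2) := by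
    have : 0 < P * m ^ 2 := by positivity
    nlinarith [mul_nonneg this.le (sq_nonneg (a - b)), mul_nonneg this.le (sq_nonneg a),
      mul_nonneg this.le (sq_nonneg b)]
  linarith

lemma inner_add_ge_neg {H : Type*} [NormedAddCommGroup H] [InnerProductSpace ℝ H] {θ : ℝ}
    (hθ : θ ≤ 1) {u p e p₀ : H} (he : ‖e‖ ≤ θ * ‖p₀‖) :
    -(‖u‖ * (‖p‖ + ‖p₀‖)) ≤ ⟪u, p + e⟫ := by
  have h := (abs_le.1 (abs_real_inner_le_norm u (p + e))).1
  have h' : ‖p + e‖ ≤ ‖p‖ + ‖p₀‖ := by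
    nlinarith [norm_add_le p e, norm_nonneg p₀]
  nlinarith [mul_le_mul_of_nonneg_left h' (norm_nonneg u)]

set_option maxHeartbeats 400000 in
/-- Almost-descent of the energy for large indices. -/
lemma fastRFBEnergy_descent {H : Type*} [NormedAddCommGroup H] [InnerProductSpace ℝ H]
    {c δ μ θ : ℝ} (hc : 1 < c) (hδ : 0 < δ) (hμ₀ : 0 < μ) (hμ₁ : μ < 1)
    (hs : 0 < μ * (c + δ - 1) - (c - 1)) (hl : 0 < c + δ - (μ * (c + δ - 1) - (c - 1)))
    (hθ₀ : 0 ≤ θ) (hθ : θ < 1 / 2) :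
    ∃ C m₀ : ℝ, 0 < C ∧ ∀ m : ℝ, m₀ ≤ m → ∀ x d g e p e₀ p₀ : H,
      ‖e‖ ≤ θ * ‖p‖ → ‖e₀‖ ≤ θ * ‖p₀‖ → 0 ≤ ⟪x, g - e⟫ →
      0 ≤ ⟪d, (g - e) - (g - p - e₀)⟫ →
      fastRFBEnergy c δ μ (m + 1) x ((m - δ) • d) g e p -
        fastRFBEnergy c δ μ m (x - d) ((m + c) • d + c • g + m • p) (g - p) e₀ p₀ ≤
      C / m ^ 2 * ‖x‖ ^ 2 := by
  obtain ⟨s, hs_def⟩ : ∃ s, s = μ * (c + δ - 1) - (c - 1) := ⟨_, rfl⟩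
  obtain ⟨l, hl_def⟩ : ∃ l, l = c + δ - s := ⟨_, rfl⟩
  rw [← hs_def] at hs hl
  rw [← hl_def] at hl
  set P := min s (min ((c - 1) * (1 - μ)) (μ * (1 / 4 - θ / 2))) with hP_def
  have hP : 0 < P := by
    refine lt_min hs (lt_min (mul_pos ?_ ?_) (mul_pos hμ₀ ?_)) <;> linarith
  have hP₁ : P ≤ s := min_le_left _ _
  have hP₂ : P ≤ (c - 1) * (1 - μ) := (min_le_right _ _).trans (min_le_left _ _)
  have hP₃ : P ≤ μ * (1 / 4 - θ / 2) := (min_le_right _ _).trans (min_le_right _ _)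
  have k₁ : 0 < l * (c - 1) := mul_pos hl (by linarith)
  have k₂ : 0 < s * δ := mul_pos hs hδ
  have k₃ : 0 ≤ |μ * δ - s + (c - 1) * δ| := abs_nonneg _
  have k₄ : 0 < μ * (c + 2 * δ) := mul_pos hμ₀ (by linarith)
  have k₅ : 0 < μ * c := mul_pos hμ₀ (by linarith)
  set K := l * (c - 1) + s * δ + |μ * δ - s + (c - 1) * δ| + μ * (c + 2 * δ) + μ * c + μ with hK_def
  have hK : 0 < K := by positivity
  have hK₁ : l * (c - 1) ≤ K := by linarith
  have hK₂ : s * δ ≤ K := by linarith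
  have hK₃ : |μ * δ - s + (c - 1) * δ| ≤ K := by linarith
  have hK₄ : μ * (c + 2 * δ) ≤ K := by linarith
  have hK₅ : μ * c ≤ K := by linarith
  have hK₆ : μ ≤ K := by linarith
  clear_value P K
  refine ⟨K ^ 2 / P, max (1 + δ) (max (8 * K / P) (8 * K ^ 2 / P ^ 2)), by positivity, ?_⟩
  intro m hm x d g e p e₀ p₀ he he₀ hx hd
  have hm₁ : 1 + δ ≤ m := (le_max_left _ _).trans hm
  have hm₂ : 8 * K / P ≤ m := ((le_max_left _ _).trans (le_max_right _ _)).trans hm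
  have hm₃ : 8 * K ^ 2 / P ^ 2 ≤ m := ((le_max_right _ _).trans (le_max_right _ _)).trans hm
  have hm₀ : 0 < m := by linarith
  refine le_trans ?_ (dissipation_absorbs (X := ‖x‖) hP hK hm₀ hm₂ hm₃ (norm_nonneg p)
    (norm_nonneg p₀) (norm_nonneg d) (norm_nonneg g))
  rw [fastRFBEnergy_step, ← hs_def, ← hl_def]
  have t₁ : -(l * (c - 1)) * ⟪x, g⟫ ≤ K * (‖x‖ * ‖p‖) := by
    have h : -(‖x‖ * ‖p‖) ≤ ⟪x, g⟫ := by
      have h₁ := (abs_le.1 (abs_real_inner_le_norm x e)).1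
      have h₂ : ‖x‖ * ‖e‖ ≤ ‖x‖ * ‖p‖ := by
        gcongr
        nlinarith [norm_nonneg p]
      rw [inner_sub_right] at hx
      linarith
    have h' : l * (c - 1) * (‖x‖ * ‖p‖) ≤ K * (‖x‖ * ‖p‖) := by
      gcongr
    linarith [mul_le_mul_of_nonneg_left h k₁.le]
  have t₂ : -s * (m - δ) * ‖d‖ ^ 2 ≤ -(P * m) * ‖d‖ ^ 2 + K * ‖d‖ ^ 2 := by
    rw [← add_mul]
    gcongr
    linarith [mul_le_mul_of_nonneg_right hP₁ hm₀.le]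
  have t₃ : (μ * δ - s + (c - 1) * δ) * ⟪d, g⟫ ≤ K * (‖d‖ * ‖g‖) := by
    refine (le_abs_self _).trans ?_
    rw [abs_mul]
    gcongr
    exact abs_real_inner_le_norm d g
  have t₄ : -((c - 1) * ((1 - μ) * m + 1) + 1 / 2 * μ) * ‖g‖ ^ 2 ≤ -(P * m) * ‖g‖ ^ 2 := by
    gcongr
    linarith [mul_le_mul_of_nonneg_right hP₂ hm₀.le]
  have t₅ : -(μ * (m * (c + δ - 1) + δ)) * ⟪d, p + e₀⟫ ≤ K * m * (‖d‖ * (‖p‖ + ‖p₀‖)) := by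
    have h := inner_add_ge_neg (u := d) (p := p) (by linarith) he₀
    have hA : 0 ≤ μ * (m * (c + δ - 1) + δ) := by
      have : 0 < c + δ - 1 := by linarith
      positivity
    have hA' : μ * (m * (c + δ - 1) + δ) ≤ K * m := by
      have h₁ : μ * (m * (c + δ - 1) + δ) ≤ μ * (c + 2 * δ) * m := by
        rw [mul_assoc]
        gcongr
        nlinarith
      exact h₁.trans (by gcongr)
    have := mul_le_mul_of_nonneg_right hA'
      (mul_nonneg (norm_nonneg d) (add_nonneg (norm_nonneg p) (norm_nonneg p₀)))
    linarith [mul_le_mul_of_nonneg_left h hA]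
  have t₆ : -(μ * c * m) * ⟪g, p + e₀⟫ ≤ K * m * (‖g‖ * (‖p‖ + ‖p₀‖)) := by
    have h := inner_add_ge_neg (u := g) (p := p) (by linarith) he₀
    have hA' : μ * c * m ≤ K * m := by gcongr
    have := mul_le_mul_of_nonneg_right hA'
      (mul_nonneg (norm_nonneg g) (add_nonneg (norm_nonneg p) (norm_nonneg p₀)))
    linarith [mul_le_mul_of_nonneg_left h (mul_pos k₅ hm₀).le]
  have t₇ : -μ * m ^ 2 * (1 / 2 * ‖p‖ ^ 2 + ⟪p, e₀⟫)
      + 1 / 4 * μ * ((m + 1) ^ 2 * ‖p‖ ^ 2 - m ^ 2 * ‖p₀‖ ^ 2) ≤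
      -(P * m ^ 2 * (‖p‖ ^ 2 + ‖p₀‖ ^ 2)) + K * m * ‖p‖ ^ 2 := by
    have h : -(θ / 2 * (‖p‖ ^ 2 + ‖p₀‖ ^ 2)) ≤ ⟪p, e₀⟫ := by
      have h₁ := (abs_le.1 (abs_real_inner_le_norm p e₀)).1
      have h₂ : ‖p‖ * ‖e₀‖ ≤ ‖p‖ * (θ * ‖p₀‖) := by gcongr
      linarith [mul_nonneg hθ₀ (sq_nonneg (‖p‖ - ‖p₀‖))]
    have h' := mul_le_mul_of_nonneg_left h (mul_pos hμ₀ (pow_pos hm₀ 2)).le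
    have hPm : P * m ^ 2 * (‖p‖ ^ 2 + ‖p₀‖ ^ 2) ≤
        μ * (1 / 4 - θ / 2) * m ^ 2 * (‖p‖ ^ 2 + ‖p₀‖ ^ 2) := by gcongr
    have hKm : 1 / 4 * μ * (2 * m + 1) * ‖p‖ ^ 2 ≤ K * m * ‖p‖ ^ 2 := by
      refine mul_le_mul_of_nonneg_right ?_ (sq_nonneg _)
      have h1m : 1 ≤ m := by linarith
      linarith [mul_le_mul_of_nonneg_right hK₆ hm₀.le, mul_le_mul_of_nonneg_left h1m hμ₀.le]
    linarith
  have t₈ : 0 ≤ μ * (m + 1) * (m - δ) * ⟪d, (g - e) - (g - p - e₀)⟫ :=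
    mul_nonneg (mul_nonneg (by positivity) (by linarith)) hd
  have t₉ : 0 ≤ 1 / 2 * ‖s • d + (c - 1) • g‖ ^ 2 := by positivity
  have t₁₀ : 0 ≤ 1 / 2 * (l * s) * ‖d‖ ^ 2 := by positivity
  linarith

/-- A nonnegative sequence that grows by relative amounts `C / k ^ 2` is eventually bounded. -/
lemma exists_bound_of_mul_le {E : ℕ → ℝ} {C : ℝ} (hC : 0 < C) (k₀ : ℕ)
    (hE : ∀ k, k₀ ≤ k → 0 ≤ E k)
    (h : ∀ k, k₀ ≤ k → E (k + 1) * (1 - C / (k : ℝ) ^ 2) ≤ E k) :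
    ∃ B : ℝ, ∃ k₁ : ℕ, k₀ ≤ k₁ ∧ ∀ k, k₁ ≤ k → E k ≤ B := by
  obtain ⟨n, hn⟩ := exists_nat_ge (4 * C)
  refine ⟨E (max k₀ (n + 1)) * (1 + 4 * C / (max k₀ (n + 1) : ℕ)), max k₀ (n + 1),
    le_max_left _ _, fun k hk => ?_⟩
  have key : E k * (1 + 4 * C / k) ≤
      E (max k₀ (n + 1)) * (1 + 4 * C / (max k₀ (n + 1) : ℕ)) := by
    induction k, hk using Nat.le_induction with
    | base => exact le_rfl
    | succ k hk ih =>
      refine le_trans ?_ ih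
      have hk₀ : k₀ ≤ k := (le_max_left _ _).trans hk
      have hkn : ((n + 1 : ℕ) : ℝ) ≤ k := by exact_mod_cast (le_max_right _ _).trans hk
      push_cast at hkn ⊢
      have hk1 : (1 : ℝ) ≤ k := by linarith [(Nat.cast_nonneg n : (0 : ℝ) ≤ n)]
      have hkpos : (0 : ℝ) < k := by linarith
      have hfac : 1 + 4 * C / ((k : ℝ) + 1) ≤ (1 - C / (k : ℝ) ^ 2) * (1 + 4 * C / k) := by
        have : (1 - C / (k : ℝ) ^ 2) * (1 + 4 * C / k) - (1 + 4 * C / ((k : ℝ) + 1)) =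
            C * (4 * k ^ 2 - k * (k + 1) - 4 * C * (k + 1)) / (k ^ 3 * (k + 1)) := by
          field_simp
          ring
        have h4 : 0 ≤ 4 * (k : ℝ) ^ 2 - k * (k + 1) - 4 * C * (k + 1) := by nlinarith
        have : 0 ≤ C * (4 * k ^ 2 - k * (k + 1) - 4 * C * (k + 1)) / ((k : ℝ) ^ 3 * (k + 1)) := by
          positivity
        linarith
      calc E (k + 1) * (1 + 4 * C / ((k : ℝ) + 1))
          ≤ E (k + 1) * ((1 - C / (k : ℝ) ^ 2) * (1 + 4 * C / k)) :=
            mul_le_mul_of_nonneg_left hfac (hE _ (by omega))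
        _ = E (k + 1) * (1 - C / (k : ℝ) ^ 2) * (1 + 4 * C / k) := by ring
        _ ≤ E k * (1 + 4 * C / k) :=
            mul_le_mul_of_nonneg_right (h k hk₀) (by positivity)
  have hEk : 0 ≤ E k := hE k ((le_max_left _ _).trans hk)
  have : 0 ≤ E k * (4 * C / k) := by positivity
  linarith

lemma le_sqrt_div_of_mul_sq_le {κ y B : ℝ} (hκ : 0 < κ) (h : κ * y ^ 2 ≤ B) : y ≤ √(B / κ) :=
  Real.le_sqrt_of_sq_le (by rwa [le_div_iff₀ hκ, mul_comm])

lemma fastRFB_eventually_bounded {H : Type*} [NormedAddCommGroup H] [InnerProductSpace ℝ H]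
    {c δ θ : ℝ} (hc : 1 < c) (hδ : 0 < δ) (hθ₀ : 0 ≤ θ) (hθ : θ < 1 / 2)
    {x d g e p : ℕ → H}
    (he : ∀ k, 2 ≤ k → ‖e k‖ ≤ θ * ‖p k‖)
    (hx : ∀ k, 2 ≤ k → 0 ≤ ⟪x k, g k - e k⟫)
    (hd : ∀ k, 2 ≤ k → 0 ≤ ⟪d (k + 1), (g (k + 1) - e (k + 1)) - (g k - e k)⟫)
    (hxd : ∀ k, 2 ≤ k → x (k + 1) - d (k + 1) = x k)
    (hgp : ∀ k, 2 ≤ k → g (k + 1) - p (k + 1) = g k)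
    (hrec : ∀ k : ℕ, 2 ≤ k → ((k : ℝ) + 1 + δ + c) • d (k + 1) + c • g (k + 1)
      + ((k : ℝ) + 1 + δ) • p (k + 1) = (k : ℝ) • d k) :
    ∃ (B : ℝ) (k₁ : ℕ), ∀ k, k₁ ≤ k →
      ‖x k‖ ≤ B ∧ k * ‖d k‖ ≤ B ∧ k * ‖g k‖ ≤ B ∧ k * ‖g k - e k‖ ≤ B := by
  have hcδ : 0 < c + δ - 1 := by linarith
  obtain ⟨μ, hμ⟩ : ∃ μ, μ * (c + δ - 1) = c - 1 + δ / 2 :=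
    ⟨(c - 1 + δ / 2) / (c + δ - 1), div_mul_cancel₀ _ hcδ.ne'⟩
  have hμ₀ : 0 < μ := by
    by_contra! h
    nlinarith
  have hμ₁ : μ < 1 := by
    by_contra! h
    nlinarith
  obtain ⟨C, m₀, hC, hdesc⟩ := fastRFBEnergy_descent (H := H) (μ := μ) hc hδ hμ₀ hμ₁
    (by linarith) (by linarith) hθ₀ hθ
  have hs : μ * (c + δ - 1) - (c - 1) = δ / 2 := by linarith
  have hl : c + δ - δ / 2 = c + δ / 2 := by ring
  set E : ℕ → ℝ := fun k =>
    fastRFBEnergy c δ μ ((k : ℝ) + 1 + δ) (x k) ((k : ℝ) • d k) (g k) (e k) (p k) with hE_def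
  have hlower : ∀ k : ℕ, 2 ≤ k →
      0 ≤ E k ∧ 1 / 2 * ((c + δ / 2) * (δ / 2)) * ‖x k‖ ^ 2 ≤ E k ∧
      1 / 2 * μ * (1 - μ) * (((k : ℝ) + 1 + δ) * ‖g k - e k‖) ^ 2 ≤ E k ∧
      μ / 8 * (((k : ℝ) + 1 + δ) * ‖p k‖) ^ 2 ≤ E k ∧
      1 / 2 * ‖(c + δ / 2) • x k + (k : ℝ) • d k + ((k : ℝ) + 1 + δ) • g k
        - (μ * ((k : ℝ) + 1 + δ)) • (g k - e k)‖ ^ 2 ≤ E k := by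
    intro k hk
    have hm : 0 < (k : ℝ) + 1 + δ := by positivity
    have hEk : E k = _ := fastRFBEnergy_eq c δ μ ((k : ℝ) + 1 + δ) (x k) ((k : ℝ) • d k) (g k)
      (e k) (p k)
    rw [hs, hl] at hEk
    have h₁ : 0 ≤ 1 / 2 * ‖(c + δ / 2) • x k + (k : ℝ) • d k + ((k : ℝ) + 1 + δ) • g k
        - (μ * ((k : ℝ) + 1 + δ)) • (g k - e k)‖ ^ 2 := by positivity
    have h₂ : 0 ≤ 1 / 2 * ((c + δ / 2) * (δ / 2)) * ‖x k‖ ^ 2 := by positivity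
    have h₃ : 0 ≤ (c + δ / 2) * μ * ((k : ℝ) + 1 + δ) * ⟪x k, g k - e k⟫ :=
      mul_nonneg (by positivity) (hx k hk)
    have h₄ : 0 ≤ 1 / 2 * μ * (1 - μ) * (((k : ℝ) + 1 + δ) * ‖g k - e k‖) ^ 2 := by
      have : 0 < 1 - μ := by linarith
      positivity
    have h₅ : 0 ≤ μ / 8 * (((k : ℝ) + 1 + δ) * ‖p k‖) ^ 2 := by positivity
    have h₆ : μ / 8 * (((k : ℝ) + 1 + δ) * ‖p k‖) ^ 2 ≤
        μ * ((k : ℝ) + 1 + δ) ^ 2 * (1 / 4 * ‖p k‖ ^ 2 - 1 / 2 * ‖e k‖ ^ 2) := by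
      have h : ‖e k‖ ^ 2 ≤ 1 / 4 * ‖p k‖ ^ 2 := by
        have : ‖e k‖ ≤ 1 / 2 * ‖p k‖ := (he k hk).trans (by gcongr)
        calc ‖e k‖ ^ 2 ≤ (1 / 2 * ‖p k‖) ^ 2 := by gcongr
          _ = 1 / 4 * ‖p k‖ ^ 2 := by ring
      have h' : 1 / 8 * ‖p k‖ ^ 2 ≤ 1 / 4 * ‖p k‖ ^ 2 - 1 / 2 * ‖e k‖ ^ 2 := by linarith
      calc μ / 8 * (((k : ℝ) + 1 + δ) * ‖p k‖) ^ 2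
          = μ * ((k : ℝ) + 1 + δ) ^ 2 * (1 / 8 * ‖p k‖ ^ 2) := by ring
        _ ≤ _ := by gcongr
    rw [mul_pow] at h₄ ⊢
    refine ⟨?_, ?_, ?_, ?_, ?_⟩ <;> linarith
  have hstep : ∃ k₀ : ℕ, 2 ≤ k₀ ∧ ∀ k, k₀ ≤ k →
      E (k + 1) * (1 - C / (1 / 2 * ((c + δ / 2) * (δ / 2))) / (k : ℝ) ^ 2) ≤ E k := by
    obtain ⟨n, hn⟩ := exists_nat_ge m₀
    refine ⟨n + 2, by omega, fun k hk => ?_⟩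
    have hk2 : 2 ≤ k := by omega
    have hkn : (n : ℝ) + 2 ≤ k := by exact_mod_cast hk
    have hk0 : (0 : ℝ) < k := by linarith [(Nat.cast_nonneg n : (0 : ℝ) ≤ n)]
    have h := hdesc ((k : ℝ) + 1 + δ) (by linarith) (x (k + 1)) (d (k + 1)) (g (k + 1))
      (e (k + 1)) (p (k + 1)) (e k) (p k) (he _ (by omega)) (he _ hk2) (hx _ (by omega))
      (by rw [hgp k hk2]; exact hd k hk2)
    rw [hrec k hk2, hgp k hk2, hxd k hk2, add_sub_cancel_right] at h
    have hE₁ : E (k + 1) = fastRFBEnergy c δ μ ((k : ℝ) + 1 + δ + 1) (x (k + 1))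
        (((k : ℝ) + 1) • d (k + 1)) (g (k + 1)) (e (k + 1)) (p (k + 1)) := by
      simp only [hE_def]
      push_cast
      ring_nf
    rw [← hE₁] at h
    have hxE := (hlower (k + 1) (by omega)).2.1
    have hmk : C / ((k : ℝ) + 1 + δ) ^ 2 * ‖x (k + 1)‖ ^ 2 ≤
        C / (1 / 2 * ((c + δ / 2) * (δ / 2))) / (k : ℝ) ^ 2 * E (k + 1) := by
      calc C / ((k : ℝ) + 1 + δ) ^ 2 * ‖x (k + 1)‖ ^ 2 ≤ C / (k : ℝ) ^ 2 * ‖x (k + 1)‖ ^ 2 := by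
            gcongr
            linarith
        _ = C / (1 / 2 * ((c + δ / 2) * (δ / 2))) / (k : ℝ) ^ 2
            * (1 / 2 * ((c + δ / 2) * (δ / 2)) * ‖x (k + 1)‖ ^ 2) := by
            have : c + δ / 2 ≠ 0 := by positivity
            field_simp
        _ ≤ _ := by gcongr
    change E (k + 1) - E k ≤ _ at h
    linarith
  obtain ⟨k₀, hk₀, hstep⟩ := hstep
  obtain ⟨B, k₁, hk₁, hB⟩ := exists_bound_of_mul_le (by positivity) k₀
    (fun k hk => (hlower k (hk₀.trans hk)).1) hstep
  have hμ' : 0 < 1 - μ := by linarith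
  set b₁ := √(B / (1 / 2 * ((c + δ / 2) * (δ / 2))))
  set b₂ := √(B / (1 / 2 * μ * (1 - μ)))
  set b₃ := √(B / (μ / 8))
  set b₄ := √(B / (1 / 2))
  have hb₁ : 0 ≤ b₁ := Real.sqrt_nonneg _
  have hb₂ : 0 ≤ b₂ := Real.sqrt_nonneg _
  have hb₃ : 0 ≤ b₃ := Real.sqrt_nonneg _
  have hb₄ : 0 ≤ b₄ := Real.sqrt_nonneg _
  have hcb : 0 ≤ (c + δ / 2) * b₁ := by positivity
  refine ⟨b₁ + (b₄ + (c + δ / 2) * b₁ + (b₂ + b₃) + b₂), k₁, fun k hk => ?_⟩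
  have hEB := hB k hk
  obtain ⟨-, i₁, i₂, i₃, i₄⟩ := hlower k (hk₀.trans (hk₁.trans hk))
  have j₁ : ‖x k‖ ≤ b₁ := le_sqrt_div_of_mul_sq_le (by positivity) (i₁.trans hEB)
  have j₂ : ((k : ℝ) + 1 + δ) * ‖g k - e k‖ ≤ b₂ :=
    le_sqrt_div_of_mul_sq_le (by positivity) (i₂.trans hEB)
  have j₃ : ((k : ℝ) + 1 + δ) * ‖p k‖ ≤ b₃ :=
    le_sqrt_div_of_mul_sq_le (by positivity) (i₃.trans hEB)
  have j₄ := le_sqrt_div_of_mul_sq_le (by norm_num) (i₄.trans hEB)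
  have hm : 0 < (k : ℝ) + 1 + δ := by positivity
  have hkm : (k : ℝ) ≤ (k : ℝ) + 1 + δ := by linarith
  have j₅ : ((k : ℝ) + 1 + δ) * ‖g k‖ ≤ b₂ + b₃ := by
    have h₁ : ‖g k‖ ≤ ‖g k - e k‖ + ‖p k‖ := by
      have := norm_add_le (g k - e k) (e k)
      rw [sub_add_cancel] at this
      have := he k (hk₀.trans (hk₁.trans hk))
      nlinarith [norm_nonneg (p k)]
    linarith [mul_le_mul_of_nonneg_left h₁ hm.le]
  have j₆ : k * ‖d k‖ ≤ b₄ + (c + δ / 2) * b₁ + (b₂ + b₃) + b₂ := by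
    set U := (c + δ / 2) • x k + (k : ℝ) • d k + ((k : ℝ) + 1 + δ) • g k
        - (μ * ((k : ℝ) + 1 + δ)) • (g k - e k) with hU
    have hdU : (k : ℝ) • d k = U - (c + δ / 2) • x k - ((k : ℝ) + 1 + δ) • g k
        + (μ * ((k : ℝ) + 1 + δ)) • (g k - e k) := by rw [hU]; abel
    have n₁ : ‖(k : ℝ) • d k‖ = k * ‖d k‖ := by rw [norm_smul, Real.norm_natCast]
    have n₂ : ‖(c + δ / 2) • x k‖ ≤ (c + δ / 2) * b₁ := by
      rw [norm_smul, Real.norm_of_nonneg (by positivity)]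
      gcongr
    have n₃ : ‖((k : ℝ) + 1 + δ) • g k‖ ≤ b₂ + b₃ := by
      rwa [norm_smul, Real.norm_of_nonneg hm.le]
    have n₄ : ‖(μ * ((k : ℝ) + 1 + δ)) • (g k - e k)‖ ≤ b₂ := by
      rw [norm_smul, Real.norm_of_nonneg (by positivity), mul_assoc]
      refine le_trans ?_ j₂
      exact mul_le_of_le_one_left (by positivity) hμ₁.le
    rw [← n₁, hdU]
    refine (norm_add_le _ _).trans (add_le_add ?_ n₄)
    refine (norm_sub_le _ _).trans (add_le_add ?_ n₃)
    exact (norm_sub_le _ _).trans (add_le_add j₄ n₂)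
  have j₇ : k * ‖g k‖ ≤ ((k : ℝ) + 1 + δ) * ‖g k‖ := by gcongr
  have j₈ : k * ‖g k - e k‖ ≤ ((k : ℝ) + 1 + δ) * ‖g k - e k‖ := by gcongr
  refine ⟨?_, ?_, ?_, ?_⟩ <;> linarith

lemma exists_pos_bound_of_eventually_le {f : ℕ → ℝ} {B : ℝ} {n : ℕ} (h : ∀ k, n ≤ k → f k ≤ B) :
    ∃ C : ℝ, 0 < C ∧ ∀ k, f k ≤ C := by
  have hS : 0 ≤ ∑ i ∈ Finset.range n, |f i| := Finset.sum_nonneg fun _ _ => abs_nonneg _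
  refine ⟨|B| + 1 + ∑ i ∈ Finset.range n, |f i|, by positivity, fun k => ?_⟩
  rcases le_or_gt n k with hk | hk
  · linarith [h k hk, le_abs_self B]
  · have := Finset.single_le_sum (f := fun i => |f i|) (fun i _ => abs_nonneg _)
      (Finset.mem_range.2 hk)
    linarith [le_abs_self (f k), abs_nonneg B]

theorem stmt_7
    {H : Type*} [NormedAddCommGroup H] [InnerProductSpace ℝ H] [CompleteSpace H]
    (M : H → Set H) (F : H → H) (L α c γ : ℝ)
    (hM : ∀ z y u' v', u' ∈ M z → v' ∈ M y → 0 ≤ ⟪v' - u', y - z⟫)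
    (hFmono : ∀ z y, 0 ≤ ⟪F y - F z, y - z⟫)
    (hL : 0 < L)
    (hFlip : ∀ z y, ‖F y - F z‖ ≤ L * ‖y - z‖)
    (hα : 2 < α) (hcl : α / 2 < c) (hcu : c < α - 1)
    (hγ0 : 0 < γ) (hγ : γ < 1 / (2 * L))
    (z w ξ v : ℕ → H)
    (hξ : ∀ k : ℕ, 1 ≤ k → ξ k ∈ M (z k))
    (hv : ∀ k : ℕ, 1 ≤ k → v k = ξ k + F (w (k - 1)))
    (hw : ∀ k : ℕ, 1 ≤ k →
      w k = z k + ((k : ℝ) / ((k : ℝ) + α)) • (z k - z (k - 1)) - ((c / ((k : ℝ) + α)) * γ) • v k)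
    (hz : ∀ k : ℕ, 1 ≤ k → z (k + 1) = w k - γ • (v (k + 1) - v k))
    (zs : H) (hzs : -F zs ∈ M zs) :
    (∃ B : ℝ, ∀ k : ℕ, ‖z k‖ ≤ B) ∧
    (∃ C : ℝ, 0 < C ∧ ∀ k : ℕ, 1 ≤ k →
      ‖z k - z (k - 1)‖ ≤ C / (k : ℝ) ∧
      ‖ξ k + F (w (k - 1))‖ ≤ C / (k : ℝ) ∧
      ‖ξ k + F (z k)‖ ≤ C / (k : ℝ) ∧
      |⟪z k - zs, ξ k + F (z k)⟫| ≤ C / (k : ℝ)) := by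
  have hLinv : γ * L < 1 / 2 := by
    rw [lt_div_iff₀ (by positivity)] at hγ
    linarith
  have hp : ∀ k, 2 ≤ k → w (k - 1) - z k = γ • v k - γ • v (k - 1) := by
    intro k hk
    obtain ⟨j, rfl⟩ : ∃ j, k = j + 1 := ⟨k - 1, by omega⟩
    rw [hz j (by omega), add_tsub_cancel_right, smul_sub]
    abel
  have herr : ∀ k, 1 ≤ k → v k - (ξ k + F (z k)) = F (w (k - 1)) - F (z k) := by
    intro k hk
    rw [hv k hk]
    abel
  have hsol : ∀ k, 1 ≤ k → 0 ≤ ⟪z k - zs, ξ k + F (z k)⟫ := by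
    intro k hk
    have h₁ := hM zs (z k) _ _ hzs (hξ k hk)
    have h₂ := hFmono zs (z k)
    have : ξ k + F (z k) = (ξ k - -F zs) + (F (z k) - F zs) := by abel
    rw [real_inner_comm, this, inner_add_left]
    exact add_nonneg h₁ h₂
  have hmon : ∀ k, 1 ≤ k →
      0 ≤ ⟪z (k + 1) - z k, (ξ (k + 1) + F (z (k + 1))) - (ξ k + F (z k))⟫ := by
    intro k hk
    have h₁ := hM (z k) (z (k + 1)) _ _ (hξ k hk) (hξ (k + 1) (by omega))
    have h₂ := hFmono (z k) (z (k + 1))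
    rw [real_inner_comm, add_sub_add_comm, inner_add_left]
    exact add_nonneg h₁ h₂
  obtain ⟨B, k₁, hB⟩ := fastRFB_eventually_bounded (c := c) (δ := α - 1 - c) (θ := γ * L)
    (x := fun k => z k - zs) (d := fun k => z k - z (k - 1)) (g := fun k => γ • v k)
    (e := fun k => γ • (v k - (ξ k + F (z k)))) (p := fun k => γ • v k - γ • v (k - 1))
    (by linarith) (by linarith) (by positivity) hLinv
    (fun k hk => by
      simp only [herr k (by omega), ← hp k hk]
      rw [norm_smul, Real.norm_of_nonneg hγ0.le, mul_assoc]
      exact mul_le_mul_of_nonneg_left (hFlip _ _) hγ0.le)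
    (fun k hk => by
      simp only [← smul_sub, sub_sub_cancel, real_inner_smul_right]
      exact mul_nonneg hγ0.le (hsol k (by omega)))
    (fun k hk => by
      simp only [← smul_sub, sub_sub_cancel, real_inner_smul_right, add_tsub_cancel_right]
      exact mul_nonneg hγ0.le (hmon k (by omega)))
    (fun k _ => by simp)
    (fun k _ => by simp)
    (fun k hk => by
      have hk' : (k : ℝ) + α ≠ 0 := by positivity
      have h := hz k (by omega)
      rw [hw k (by omega)] at h
      simp only [add_tsub_cancel_right]
      rw [h]
      match_scalars <;> field_simp <;> ring)
  simp only [← smul_sub, sub_sub_cancel, norm_smul, Real.norm_of_nonneg hγ0.le] at hB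
  obtain ⟨C, hC, hbound⟩ := exists_pos_bound_of_eventually_le (n := k₁)
    (f := fun k => ‖z k - zs‖ + k * ‖z k - z (k - 1)‖ + k * (γ * ‖v k‖)
      + k * (γ * ‖ξ k + F (z k)‖)) (B := B + B + B + B)
    fun k hk => by
      obtain ⟨h₁, h₂, h₃, h₄⟩ := hB k hk
      linarith
  have hx : ∀ k, ‖z k - zs‖ ≤ C := fun k => le_trans (by
    have : 0 ≤ k * ‖z k - z (k - 1)‖ + k * (γ * ‖v k‖) + k * (γ * ‖ξ k + F (z k)‖) := by positivity
    linarith) (hbound k)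
  refine ⟨⟨C + ‖zs‖, fun k => ?_⟩, C + C / γ + C * (C / γ), by positivity, fun k hk => ?_⟩
  · linarith [norm_sub_norm_le (z k) zs, hx k]
  · have hk0 : (0 : ℝ) < k := by exact_mod_cast hk
    have hCγ : 0 < C / γ := by positivity
    have hCCγ : 0 < C * (C / γ) := by positivity
    have hb := hbound k
    have p₁ := norm_nonneg (z k - zs)
    have p₂ : 0 ≤ k * ‖z k - z (k - 1)‖ := by positivity
    have p₃ : 0 ≤ k * (γ * ‖v k‖) := by positivity
    have p₄ : 0 ≤ k * (γ * ‖ξ k + F (z k)‖) := by positivity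
    have hV : ‖ξ k + F (z k)‖ * k ≤ C / γ := by
      rw [le_div_iff₀ hγ0]
      linarith
    have hvk : ‖v k‖ * k ≤ C / γ := by
      rw [le_div_iff₀ hγ0]
      linarith
    simp only [le_div_iff₀ hk0, ← hv k hk]
    refine ⟨by linarith, by linarith, by linarith, ?_⟩
    have h := abs_real_inner_le_norm (z k - zs) (ξ k + F (z k))
    calc |⟪z k - zs, ξ k + F (z k)⟫| * k
        ≤ ‖z k - zs‖ * (‖ξ k + F (z k)‖ * k) := by
          rw [← mul_assoc]
          gcongr
      _ ≤ C * (C / γ) := by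
          gcongr
          exact hx k
      _ ≤ _ := by linarith
end

section
/- Suppose Zer(M+F) is nonempty and let z* ∈ Zer(M+F). Then for every s with 1 + α/(4c − α) < s < 2 there exist real numbers λ̲ and λ̄ with 0 ≤ λ̲ < λ̄ ≤ sα/4 such that for every λ with λ̲ < λ < λ̄, the real sequences (E_{λ,s,k})_{k≥1} and (G_{λ,s,k})_{k≥2} are convergent. -/
open scoped RealInnerProductSpace Pointwise
open Filter

section Asymptotics

theorem eventually_affine_le_sq (A B : ℝ) {ε : ℝ} (hε : 0 < ε) :
    ∀ᶠ k : ℝ in atTop, A * k + B ≤ ε * k ^ 2 := by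
  filter_upwards [eventually_ge_atTop 1, eventually_ge_atTop ((|A| + |B|) / ε)] with k h1 h2
  rw [div_le_iff₀ hε] at h2
  nlinarith [le_abs_self A, le_abs_self B, abs_nonneg A, abs_nonneg B]

theorem eventually_le_linear (B : ℝ) {ε : ℝ} (hε : 0 < ε) :
    ∀ᶠ k : ℝ in atTop, B ≤ ε * k := by
  filter_upwards [eventually_ge_atTop (B / ε)] with k h
  rw [div_le_iff₀ hε] at h
  linarith

theorem eventually_sqrt_affine_le (A B : ℝ) {ε : ℝ} (hε : 0 < ε) :
    ∀ᶠ k : ℝ in atTop, √(A * k + B) ≤ ε * k := by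
  filter_upwards [eventually_ge_atTop 0, eventually_affine_le_sq A B (pow_pos hε 2)] with k h0 h
  rw [Real.sqrt_le_iff]
  exact ⟨by positivity, by nlinarith⟩

/-- A deterministic Robbins–Siegmund lemma. -/
theorem exists_tendsto_of_le_one_add_mul_sub {g ε r : ℕ → ℝ} (hg : ∀ n, 0 ≤ g n)
    (hε : ∀ n, 0 ≤ ε n) (hr : ∀ n, 0 ≤ r n) (hs : Summable ε)
    (h : ∀ n, g (n + 1) ≤ (1 + ε n) * g n - r n) :
    (∃ l, Tendsto g atTop (nhds l)) ∧ Tendsto r atTop (nhds 0) := by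
  have hexp : ∀ n, g n ≤ Real.exp (∑ i ∈ Finset.range n, ε i) * g 0 := by
    intro n
    induction n with
    | zero => simp
    | succ n ih =>
      rw [Finset.sum_range_succ, Real.exp_add]
      have h1 : 1 + ε n ≤ Real.exp (ε n) := by linarith [Real.add_one_le_exp (ε n)]
      calc g (n + 1) ≤ (1 + ε n) * g n := by linarith [h n, hr n]
        _ ≤ Real.exp (ε n) * g n := mul_le_mul_of_nonneg_right h1 (hg n)
        _ ≤ Real.exp (ε n) * (Real.exp (∑ i ∈ Finset.range n, ε i) * g 0) := by gcongr
        _ = _ := by ring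
  set B := Real.exp (∑' i, ε i) * g 0 with hB
  have hgB : ∀ n, g n ≤ B := fun n => (hexp n).trans
    (mul_le_mul_of_nonneg_right (Real.exp_le_exp.2 (hs.sum_le_tsum _ fun i _ => hε i)) (hg 0))
  have hB0 : 0 ≤ B := (hg 0).trans (hgB 0)
  set f : ℕ → ℝ := fun n => g n - B * ∑ i ∈ Finset.range n, ε i with hf
  have hstep : ∀ n, f (n + 1) ≤ f n - r n := by
    intro n
    simp only [hf, Finset.sum_range_succ]
    nlinarith [h n, mul_le_mul_of_nonneg_left (hgB n) (hε n)]
  have hanti : Antitone f := antitone_nat_of_succ_le fun n => by linarith [hstep n, hr n]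
  have hbdd : BddBelow (Set.range f) := by
    refine ⟨-(B * ∑' i, ε i), ?_⟩
    rintro _ ⟨n, rfl⟩
    have := mul_le_mul_of_nonneg_left (hs.sum_le_tsum (Finset.range n) fun i _ => hε i) hB0
    simp only [hf]
    linarith [hg n]
  have hlim := tendsto_atTop_ciInf hanti hbdd
  refine ⟨⟨(⨅ n, f n) + B * ∑' i, ε i, ?_⟩, ?_⟩
  · have := hlim.add (hs.hasSum.tendsto_sum_nat.const_mul B)
    simpa [hf] using this
  · have h0 : Tendsto (fun n => f n - f (n + 1)) atTop (nhds 0) := by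
      simpa using hlim.sub (hlim.comp (tendsto_add_atTop_nat 1))
    exact squeeze_zero hr (fun n => by linarith [hstep n]) h0

end Asymptotics

section Energy

variable {H : Type*} [NormedAddCommGroup H] [InnerProductSpace ℝ H]

theorem exists_pos_le_quadratic_form {p b q : ℝ} (hp : 0 < p) (hq : 0 < q)
    (h : b ^ 2 < 4 * p * q) :
    ∃ δ > 0, ∀ x y : H, δ * (‖x‖ ^ 2 + ‖y‖ ^ 2) ≤ p * ‖x‖ ^ 2 + b * ⟪x, y⟫ + q * ‖y‖ ^ 2 := by
  set δ := (4 * p * q - b ^ 2) / (4 * (p + q)) with hδ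
  have hδ0 : 0 < δ := div_pos (by linarith) (by linarith)
  have hmul : δ * (p + q) = p * q - b ^ 2 / 4 := by rw [hδ]; field_simp
  have hP : 0 < p - δ := by nlinarith [sq_nonneg b]
  refine ⟨δ, hδ0, fun x y => ?_⟩
  have hsq : ‖(2 * (p - δ)) • x + b • y‖ ^ 2
      = 4 * (p - δ) ^ 2 * ‖x‖ ^ 2 + 4 * (p - δ) * b * ⟪x, y⟫ + b ^ 2 * ‖y‖ ^ 2 := by
    rw [norm_add_sq_real, norm_smul, norm_smul, mul_pow, mul_pow, Real.norm_eq_abs,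
      Real.norm_eq_abs, sq_abs, sq_abs, inner_smul_left, inner_smul_right]
    simp only [conj_trivial]
    ring
  have hdet : 0 ≤ (4 * (p - δ) * (q - δ) - b ^ 2) * ‖y‖ ^ 2 := by
    apply mul_nonneg _ (sq_nonneg _)
    nlinarith
  have : 0 ≤ 4 * (p - δ) * ((p - δ) * ‖x‖ ^ 2 + b * ⟪x, y⟫ + (q - δ) * ‖y‖ ^ 2) := by
    nlinarith [sq_nonneg ‖(2 * (p - δ)) • x + b • y‖]
  have := nonneg_of_mul_nonneg_right this (by linarith)
  linarith

/-- The discrete energy at step `k`, as a function of `a = z k - zs`, `d = z k - z (k - 1)` and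
`v = v k`. -/
noncomputable def energy (lam s α c γ k : ℝ) (a d v : H) : ℝ :=
  (1 / 2) * ‖(2 * lam) • a + (2 * k) • d + (s * γ * k) • v‖ ^ 2
    + 2 * lam * (α - 1 - lam) * ‖a‖ ^ 2
    + 2 * lam * γ * ((2 - s) * k + 2 * (α - c)) * ⟪a, v⟫
    + (1 / 2) * γ ^ 2 * ((2 - s) * k + 2 * (α - c)) * (s * k + 2 * c) * ‖v‖ ^ 2

/-- The correction which turns the energy into a quasi-decreasing quantity, with
`p = F (z k) - F (w (k - 1))` and `Δ = v k - v (k - 1)`. -/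
noncomputable def energyCorrection (s α c γ L k : ℝ) (d p Δ : H) : ℝ :=
  -(2 * γ * ((2 - s) * k + 2 * (α - c)) * k * ⟪d, p⟫)
    + γ ^ 3 * L * ((2 - s) * k + 2 * (α - c))
      * (k + α - c + c * γ * L * √((2 - s) * k + 2 * (α - c))) * ‖Δ‖ ^ 2

theorem energy_eq (lam s α c γ k : ℝ) (a d v : H) :
    energy lam s α c γ k a d v =
      2 * lam * (α - 1) * ‖a‖ ^ 2 + 4 * lam * ⟪a, (γ * k) • v + k • d⟫
        + s * ‖(γ * k) • v + k • d‖ ^ 2 + (2 - s) * k ^ 2 * ‖d‖ ^ 2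
        + 4 * lam * γ * (α - c) * ⟪a, v⟫
        + γ ^ 2 * ((c * (2 - s) + s * (α - c)) * k + 2 * c * (α - c)) * ‖v‖ ^ 2 := by
  simp only [energy, ← real_inner_self_eq_norm_sq, inner_add_left, inner_add_right,
    real_inner_smul_left, real_inner_smul_right, real_inner_comm a d, real_inner_comm a v,
    real_inner_comm d v]
  ring

theorem energy_step (lam s α c γ k : ℝ) (a d e v Δ : H)
    (h : k • e = (k + α) • d + (γ * (k + α)) • Δ + (c * γ) • (v - Δ)) :
    energy lam s α c γ (k + 1) a d v - energy lam s α c γ k (a - d) e (v - Δ) =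
      -(4 * lam * γ * (c - 1) * ⟪a, v⟫)
      - (4 * (k + 1) * (α - 1 - lam) + 2 * (α - 1 - lam) ^ 2 + 2 * lam * (α - 1 - lam)) * ‖d‖ ^ 2
      + (4 * γ * (lam + s - c - s * α / 2) * k
          + (2 * γ * (s - 2 * c) - 2 * s * γ * (α - 1 - lam)
            + 2 * γ * (α - 1 - lam) * (s - 2 * c) + 4 * lam * γ * (α - c))) * ⟪d, v⟫
      + (-(2 * γ ^ 2 * s * (c - 1)) * k
          + (s * γ ^ 2 * (s - 2 * c) - 1 / 2 * γ ^ 2 * (s - 2 * c) ^ 2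
            + 1 / 2 * γ ^ 2 * (2 * s * (α - c) + (2 - s) * (s + 2 * c)))) * ‖v‖ ^ 2
      - 2 * γ * ((2 - s) * k + 2 * (α - c)) * (k + α) * ⟪d, Δ⟫
      - γ ^ 2 * ((2 - s) * k + 2 * (α - c)) * (k + α) * ‖Δ‖ ^ 2 := by
  have h2 : (2 * k) • e = (2 : ℝ) • (k • e) := by rw [smul_smul]
  simp only [energy]
  rw [h2, h]
  simp only [← real_inner_self_eq_norm_sq, inner_add_left, inner_add_right, inner_sub_left,
    inner_sub_right, real_inner_smul_left, real_inner_smul_right]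
  rw [real_inner_comm a d, real_inner_comm a v, real_inner_comm d v, real_inner_comm a Δ,
    real_inner_comm d Δ, real_inner_comm v Δ]
  ring

theorem exists_pos_le_energy_add_correction {lam s α c γ L : ℝ} (hL : 0 < L) (hγ : 0 < γ)
    (hγL : γ * L < 1 / 2) (hs0 : 0 < s) (hs2 : s < 2) (hc : 0 < c) (hcα : c < α)
    (hlam0 : 0 < lam) (hlam : 2 * lam < s * (α - 1)) :
    ∃ δ > 0, ∀ᶠ k : ℝ in atTop, ∀ a d v p Δ : H, ‖p‖ ≤ γ * L * ‖Δ‖ →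
      δ * (‖a‖ ^ 2 + k ^ 2 * ‖d‖ ^ 2) ≤
        energy lam s α c γ k a d v + energyCorrection s α c γ L k d p Δ := by
  obtain ⟨δ, hδ, hquad⟩ := exists_pos_le_quadratic_form (H := H)
    (p := 2 * lam * (α - 1)) (b := 4 * lam) (q := s) (by nlinarith) hs0 (by nlinarith)
  have hκ : 0 < γ ^ 2 * (s * (α - c)) := by
    have := sub_pos.2 hcα
    positivity
  refine ⟨min (δ / 2) ((2 - s) / 4), lt_min (by linarith) (by linarith), ?_⟩
  filter_upwards [eventually_ge_atTop 1,
    eventually_le_linear ((4 * lam * γ * (α - c)) ^ 2) (mul_pos (mul_pos two_pos hδ) hκ),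
    eventually_le_linear (α - c) (show 0 < (2 - s) / 4 by linarith)] with k hk1 hk2 hk3
  intro a d v p Δ hp
  set β := (2 - s) * k + 2 * (α - c) with hβ
  have hβ0 : 0 < β := by nlinarith
  have hq := hquad a ((γ * k) • v + k • d)
  have hav : -(δ / 2 * ‖a‖ ^ 2 + γ ^ 2 * (s * (α - c)) * k * ‖v‖ ^ 2)
      ≤ 4 * lam * γ * (α - c) * ⟪a, v⟫ := by
    have hC : 0 ≤ 4 * lam * γ * (α - c) := by
      have := sub_pos.2 hcα
      positivity
    have h1 := mul_le_mul_of_nonneg_left (neg_le_of_abs_le (abs_real_inner_le_norm a v)) hC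
    have h2 : 4 * lam * γ * (α - c) * (‖a‖ * ‖v‖)
        ≤ δ / 2 * ‖a‖ ^ 2 + γ ^ 2 * (s * (α - c)) * k * ‖v‖ ^ 2 := by
      have h3 := mul_le_mul_of_nonneg_right hk2 (sq_nonneg ‖v‖)
      have h4 := sq_nonneg (δ * ‖a‖ - 4 * lam * γ * (α - c) * ‖v‖)
      refine le_of_mul_le_mul_left ?_ (mul_pos two_pos hδ)
      linarith
    linarith
  have hdp : ⟪d, p⟫ ≤ ‖d‖ * (γ * L * ‖Δ‖) :=
    (real_inner_le_norm d p).trans (mul_le_mul_of_nonneg_left hp (norm_nonneg d))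
  have hcorr : -(γ * L * β * k * ‖d‖ ^ 2) ≤ energyCorrection s α c γ L k d p Δ := by
    have h1 : 2 * γ * β * k * ⟪d, p⟫ ≤ 2 * γ * β * k * (‖d‖ * (γ * L * ‖Δ‖)) :=
      mul_le_mul_of_nonneg_left hdp (by positivity)
    have h2 : 0 ≤ γ * L * β * k * (‖d‖ - γ * ‖Δ‖) ^ 2 := by positivity
    have h3 : γ ^ 3 * L * β * k * ‖Δ‖ ^ 2
        ≤ γ ^ 3 * L * β * (k + α - c + c * γ * L * √β) * ‖Δ‖ ^ 2 := by
      have : 0 ≤ c * γ * L * √β := by positivity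
      gcongr
      linarith
    rw [energyCorrection, ← hβ]
    linarith
  have hd : (2 - s) / 4 * (k ^ 2 * ‖d‖ ^ 2)
      ≤ (2 - s) * k ^ 2 * ‖d‖ ^ 2 - γ * L * β * k * ‖d‖ ^ 2 := by
    have h1 : γ * L * (β * k) ≤ 1 / 2 * (β * k) := by gcongr
    have h2 : (2 - s) / 4 * k ^ 2 ≤ (2 - s) * k ^ 2 - γ * L * (β * k) := by
      have := mul_le_mul_of_nonneg_right hk3 (show (0 : ℝ) ≤ k by linarith)
      rw [hβ] at h1 ⊢
      linarith
    have := mul_le_mul_of_nonneg_right h2 (sq_nonneg ‖d‖)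
    linarith
  have hv : 0 ≤ γ ^ 2 * (c * (2 - s) * k + 2 * c * (α - c)) * ‖v‖ ^ 2 := by
    have := sub_pos.2 hcα
    have := sub_pos.2 hs2
    positivity
  have hX : 0 ≤ δ * ‖(γ * k) • v + k • d‖ ^ 2 := by positivity
  have hm1 : min (δ / 2) ((2 - s) / 4) * ‖a‖ ^ 2 ≤ δ / 2 * ‖a‖ ^ 2 :=
    mul_le_mul_of_nonneg_right (min_le_left _ _) (sq_nonneg _)
  have hm2 : min (δ / 2) ((2 - s) / 4) * (k ^ 2 * ‖d‖ ^ 2) ≤ (2 - s) / 4 * (k ^ 2 * ‖d‖ ^ 2) :=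
    mul_le_mul_of_nonneg_right (min_le_right _ _) (by positivity)
  rw [energy_eq]
  linarith

theorem energy_add_correction_step_le {lam s α c γ L k : ℝ} (hL : 0 < L) (hγ : 0 < γ)
    (hs2 : s < 2) (hc : 0 < c) (hcα : c < α) (hk : 0 ≤ k) {a d e v Δ p p' Δ₀ : H}
    (h : k • e = (k + α) • d + (γ * (k + α)) • Δ + (c * γ) • (v - Δ))
    (hp : ‖p‖ ≤ γ * L * ‖Δ₀‖) (hdΔ : ⟪d, p⟫ - ⟪d, p'⟫ ≤ ⟪d, Δ⟫) :
    (energy lam s α c γ (k + 1) a d v + energyCorrection s α c γ L (k + 1) d p' Δ)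
      - (energy lam s α c γ k (a - d) e (v - Δ) + energyCorrection s α c γ L k e p Δ₀) ≤
      -(4 * lam * γ * (c - 1) * ⟪a, v⟫)
      - (4 * (k + 1) * (α - 1 - lam) + 2 * (α - 1 - lam) ^ 2 + 2 * lam * (α - 1 - lam)) * ‖d‖ ^ 2
      + (4 * γ * (lam + s - c - s * α / 2) * k
          + (2 * γ * (s - 2 * c) - 2 * s * γ * (α - 1 - lam)
            + 2 * γ * (α - 1 - lam) * (s - 2 * c) + 4 * lam * γ * (α - c))) * ⟪d, v⟫
      + (-(2 * γ ^ 2 * s * (c - 1)) * k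
          + (s * γ ^ 2 * (s - 2 * c) - 1 / 2 * γ ^ 2 * (s - 2 * c) ^ 2
            + 1 / 2 * γ ^ 2 * (2 * s * (α - c) + (2 - s) * (s + 2 * c)))) * ‖v‖ ^ 2
      + c * γ ^ 2 * √((2 - s) * k + 2 * (α - c)) * ‖v‖ ^ 2
      + 2 * γ * ((2 - s) * (α - 2) * k + (2 * (α - c) * (α - 1) - (2 - s))) * ⟪d, p'⟫
      + (γ ^ 3 * L * ((2 - s) * (k + 1) + 2 * (α - c))
            * (k + 1 + α - c + c * γ * L * √((2 - s) * (k + 1) + 2 * (α - c)))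
          + γ ^ 3 * L * ((2 - s) * k + 2 * (α - c)) * (k + α - c)
          - γ ^ 2 * ((2 - s) * k + 2 * (α - c)) * (k + α)) * ‖Δ‖ ^ 2 := by
  have hstep := energy_step lam s α c γ k a d e v Δ h
  have hsα := sub_pos.2 hcα
  have hs2' := sub_pos.2 hs2
  have hβ0 : 0 < (2 - s) * k + 2 * (α - c) := by positivity
  set β := (2 - s) * k + 2 * (α - c) with hβ
  set σ := √β with hσ
  have hσ2 : σ ^ 2 = β := Real.sq_sqrt hβ0.le
  have hσ0 : 0 ≤ σ := Real.sqrt_nonneg β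
  have hep : k * ⟪e, p⟫ = (k + α) * ⟪d, p⟫ + γ * (k + α - c) * ⟪Δ, p⟫ + c * γ * ⟪v, p⟫ := by
    rw [← real_inner_smul_left, h]
    simp only [inner_add_left, inner_sub_left, real_inner_smul_left]
    ring
  have hΔp : ⟪Δ, p⟫ ≤ ‖Δ‖ * (γ * L * ‖Δ₀‖) :=
    (real_inner_le_norm Δ p).trans (mul_le_mul_of_nonneg_left hp (norm_nonneg Δ))
  have hvp : ⟪v, p⟫ ≤ ‖v‖ * (γ * L * ‖Δ₀‖) :=
    (real_inner_le_norm v p).trans (mul_le_mul_of_nonneg_left hp (norm_nonneg v))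
  have h1 : 2 * γ * β * (k + α) * (⟪d, p⟫ - ⟪d, p'⟫) ≤ 2 * γ * β * (k + α) * ⟪d, Δ⟫ := by
    have : 0 < α := by linarith
    gcongr
  have h2 : 2 * γ ^ 2 * β * (k + α - c) * ⟪Δ, p⟫
      ≤ γ ^ 3 * L * β * (k + α - c) * (‖Δ‖ ^ 2 + ‖Δ₀‖ ^ 2) := by
    have hka : 0 ≤ k + α - c := by linarith
    have h3 : 2 * γ ^ 2 * β * (k + α - c) * ⟪Δ, p⟫
        ≤ 2 * γ ^ 2 * β * (k + α - c) * (‖Δ‖ * (γ * L * ‖Δ₀‖)) := by gcongr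
    have h4 : 0 ≤ γ ^ 3 * L * β * (k + α - c) * (‖Δ‖ - ‖Δ₀‖) ^ 2 := by positivity
    linarith
  have h3 : 2 * c * γ ^ 2 * β * ⟪v, p⟫
      ≤ c * γ ^ 2 * σ * ‖v‖ ^ 2 + γ ^ 3 * L * β * (c * γ * L * σ) * ‖Δ₀‖ ^ 2 := by
    have h4 : 2 * c * γ ^ 2 * β * ⟪v, p⟫ ≤ 2 * c * γ ^ 2 * β * (‖v‖ * (γ * L * ‖Δ₀‖)) := by gcongr
    have h5 : 0 ≤ c * γ ^ 2 * σ * (‖v‖ - σ * (γ * L * ‖Δ₀‖)) ^ 2 := by positivity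
    have h6 : c * γ ^ 2 * σ * (‖v‖ - σ * (γ * L * ‖Δ₀‖)) ^ 2
        = c * γ ^ 2 * σ * ‖v‖ ^ 2 - 2 * c * γ ^ 2 * σ ^ 2 * (‖v‖ * (γ * L * ‖Δ₀‖))
          + γ ^ 3 * L * σ ^ 2 * (c * γ * L * σ) * ‖Δ₀‖ ^ 2 := by ring
    rw [hσ2] at h6
    linarith
  have hcorr : energyCorrection s α c γ L k e p Δ₀ =
      -(2 * γ * β * ((k + α) * ⟪d, p⟫ + γ * (k + α - c) * ⟪Δ, p⟫ + c * γ * ⟪v, p⟫))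
      + γ ^ 3 * L * β * (k + α - c + c * γ * L * σ) * ‖Δ₀‖ ^ 2 := by
    rw [energyCorrection, ← hβ, ← hσ, ← hep]
    ring
  have hd' : 2 * γ * ((2 - s) * (α - 2) * k + (2 * (α - c) * (α - 1) - (2 - s))) * ⟪d, p'⟫
      = 2 * γ * β * (k + α) * ⟪d, p'⟫
        - 2 * γ * ((2 - s) * (k + 1) + 2 * (α - c)) * (k + 1) * ⟪d, p'⟫ := by
    rw [hβ]; ring
  rw [hd', hcorr, energyCorrection]
  linarith

theorem eventually_diff_coeff_le {s α c γ L : ℝ} (hL : 0 < L) (hγ : 0 < γ) (hc : 0 < c)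
    (hγL : γ * L < 1 / 2) (hs2 : s < 2) :
    ∃ η > 0, ∀ᶠ k : ℝ in atTop,
      γ ^ 3 * L * ((2 - s) * (k + 1) + 2 * (α - c))
            * (k + 1 + α - c + c * γ * L * √((2 - s) * (k + 1) + 2 * (α - c)))
          + γ ^ 3 * L * ((2 - s) * k + 2 * (α - c)) * (k + α - c)
          - γ ^ 2 * ((2 - s) * k + 2 * (α - c)) * (k + α) ≤ -(4 * η * k ^ 2) := by
  set ρ := 2 - s with hρ
  have hρ0 : 0 < ρ := by linarith
  set m := 2 * (α - c) with hm
  set t := α - c with ht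
  set ε := γ ^ 2 * ρ * (1 - 2 * (γ * L)) with hε
  have hε0 : 0 < ε := by
    have : 0 < 1 - 2 * (γ * L) := by linarith
    positivity
  set κ := c * γ ^ 4 * L ^ 2 with hκ
  have hκ0 : 0 < κ := by positivity
  refine ⟨ε / 8, by positivity, ?_⟩
  filter_upwards [eventually_ge_atTop 0, eventually_le_linear (ρ + m) one_pos,
    eventually_affine_le_sq
      (γ ^ 3 * L * (ρ * (1 + t) + ρ + m + ρ * t + m) - γ ^ 2 * (ρ * α + m))
      (γ ^ 3 * L * ((ρ + m) * (1 + t) + m * t) - γ ^ 2 * m * α)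
      (show 0 < ε / 4 by positivity),
    eventually_sqrt_affine_le ρ (ρ + m) (show 0 < ε / 4 / ((ρ + 1) * κ) by positivity)]
    with k hk hk1 hk2 hk3
  rw [show ρ * k + (ρ + m) = ρ * (k + 1) + m by ring] at hk3
  set σ := √(ρ * (k + 1) + m) with hσ
  have hσ0 : 0 ≤ σ := Real.sqrt_nonneg _
  have h1 : κ * ((ρ * (k + 1) + m) * σ)
      ≤ κ * ((ρ + 1) * k * (ε / 4 / ((ρ + 1) * κ) * k)) := by
    gcongr
    linarith
  have h2 : κ * ((ρ + 1) * k * (ε / 4 / ((ρ + 1) * κ) * k)) = ε / 4 * k ^ 2 := by field_simp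
  rw [h2, hκ] at h1
  rw [show k + 1 + α - c = k + 1 + t by rw [ht]; ring, show k + α - c = k + t by rw [ht]; ring]
  clear_value m t σ ρ
  rw [hε] at h1 hk2 ⊢
  linarith

theorem exists_energy_add_correction_step_le {lam s α c γ L : ℝ} (hL : 0 < L) (hγ : 0 < γ)
    (hγL : γ * L < 1 / 2) (hs0 : 0 < s) (hs2 : s < 2) (hc : 1 < c) (hcα : c < α)
    (hlam0 : 0 < lam) (hlam1 : lam < α - 1)
    (hlam : (lam + s - c - s * α / 2) ^ 2 < 2 * s * (c - 1) * (α - 1 - lam)) :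
    ∃ C ≥ 0, ∃ η > 0, ∀ᶠ k : ℝ in atTop, ∀ a d e v Δ p p' Δ₀ : H,
      k • e = (k + α) • d + (γ * (k + α)) • Δ + (c * γ) • (v - Δ) →
      ‖p‖ ≤ γ * L * ‖Δ₀‖ → ‖p'‖ ≤ γ * L * ‖Δ‖ → ⟪d, p⟫ - ⟪d, p'⟫ ≤ ⟪d, Δ⟫ →
      -(γ * L * (‖a‖ * ‖Δ‖)) ≤ ⟪a, v⟫ →
      energy lam s α c γ (k + 1) a d v + energyCorrection s α c γ L (k + 1) d p' Δ ≤
        energy lam s α c γ k (a - d) e (v - Δ) + energyCorrection s α c γ L k e p Δ₀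
          + C / k ^ 2 * ‖a - d‖ ^ 2 - η * k ^ 2 * ‖Δ‖ ^ 2 := by
  obtain ⟨η, hη, hcoef⟩ := eventually_diff_coeff_le (α := α) hL hγ (by linarith : 0 < c) hγL hs2
  obtain ⟨δ, hδ, hquad⟩ := exists_pos_le_quadratic_form (H := H)
    (p := 4 * (α - 1 - lam)) (b := -(4 * γ * (lam + s - c - s * α / 2)))
    (q := 2 * γ ^ 2 * s * (c - 1)) (by linarith)
    (by have := sub_pos.2 hc; positivity)
    (by nlinarith [mul_lt_mul_of_pos_left hlam (show 0 < 16 * γ ^ 2 by positivity)])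
  set μ := α - 1 - lam with hμ
  have hμ0 : 0 < μ := by linarith
  set B := 2 * γ * (s - 2 * c) - 2 * s * γ * μ + 2 * γ * μ * (s - 2 * c)
    + 4 * lam * γ * (α - c) with hB
  set B' := s * γ ^ 2 * (s - 2 * c) - 1 / 2 * γ ^ 2 * (s - 2 * c) ^ 2
            + 1 / 2 * γ ^ 2 * (2 * s * (α - c) + (2 - s) * (s + 2 * c)) with hB'
  set D := (2 - s) * (α - 2) with hD
  set D' := 2 * (α - c) * (α - 1) - (2 - s) with hD'
  set C₁ := 4 * lam * γ * (c - 1) * (γ * L) with hC₁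
  have hC₁0 : 0 ≤ C₁ := by have := sub_pos.2 hc; positivity
  set C₂ := C₁ + 2 * γ * (|D| + |D'|) * (γ * L) with hC₂
  set C₃ := |B| + |B'| with hC₃
  clear_value μ B B' D D' C₁ C₂ C₃
  refine ⟨C₁ ^ 2 / (4 * η), by positivity, η, hη, ?_⟩
  filter_upwards [hcoef, eventually_ge_atTop 1,
    eventually_sqrt_affine_le (2 - s) (2 * (α - c)) (show 0 < δ / 2 / (c * γ ^ 2) by positivity),
    eventually_le_linear (C₂ ^ 2 / (4 * η) + C₃) (show 0 < δ / 2 by positivity)]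
    with k hk hk1 hk2 hk3
  intro a d e v Δ p p' Δ₀ h hp hp' hdΔ hav
  have hmain := energy_add_correction_step_le (lam := lam) hL hγ hs2 (by linarith) hcα
    (by linarith) h hp hdΔ (a := a)
  rw [← hμ, ← hB, ← hB', ← hD, ← hD'] at hmain
  have hk0 : 0 < k := by linarith
  have hnorm : ‖a‖ ≤ ‖a - d‖ + ‖d‖ := by simpa using norm_add_le (a - d) d
  have hQ := mul_le_mul_of_nonneg_left (hquad d v) hk0.le
  have hdv : |⟪d, v⟫| ≤ ‖d‖ ^ 2 + ‖v‖ ^ 2 := by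
    linarith only [abs_real_inner_le_norm d v, sq_nonneg (‖d‖ - ‖v‖), sq_nonneg ‖d‖,
      sq_nonneg ‖v‖]
  have hB1 : B * ⟪d, v⟫ ≤ |B| * (‖d‖ ^ 2 + ‖v‖ ^ 2) := by
    calc B * ⟪d, v⟫ ≤ |B * ⟪d, v⟫| := le_abs_self _
      _ = |B| * |⟪d, v⟫| := abs_mul _ _
      _ ≤ _ := by gcongr
  have hB2 : B' * ‖v‖ ^ 2 ≤ |B'| * (‖d‖ ^ 2 + ‖v‖ ^ 2) :=
    mul_le_mul (le_abs_self B') (le_add_of_nonneg_left (sq_nonneg _)) (sq_nonneg _)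
      (abs_nonneg _)
  have hav' : -(4 * lam * γ * (c - 1) * ⟪a, v⟫)
      ≤ C₁ * (‖a - d‖ * ‖Δ‖) + C₁ * k * (‖d‖ * ‖Δ‖) := by
    have h1 : 4 * lam * γ * (c - 1) * -(γ * L * (‖a‖ * ‖Δ‖)) ≤ 4 * lam * γ * (c - 1) * ⟪a, v⟫ := by
      have := sub_pos.2 hc
      gcongr
    have h2 : C₁ * (‖a‖ * ‖Δ‖) ≤ C₁ * ((‖a - d‖ + ‖d‖) * ‖Δ‖) := by gcongr
    have h3 : C₁ * 1 * (‖d‖ * ‖Δ‖) ≤ C₁ * k * (‖d‖ * ‖Δ‖) := by gcongr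
    rw [hC₁] at h2 h3 ⊢
    linarith only [h1, h2, h3]
  have hdp : 2 * γ * (D * k + D') * ⟪d, p'⟫
      ≤ 2 * γ * (|D| + |D'|) * (γ * L) * k * (‖d‖ * ‖Δ‖) := by
    have h1 : |D * k + D'| ≤ (|D| + |D'|) * k := by
      calc |D * k + D'| ≤ |D * k| + |D'| := abs_add_le _ _
        _ = |D| * k + |D'| := by rw [abs_mul, abs_of_pos hk0]
        _ ≤ _ := by linarith only [mul_le_mul_of_nonneg_left hk1 (abs_nonneg D')]
    have h2 : |⟪d, p'⟫| ≤ ‖d‖ * (γ * L * ‖Δ‖) :=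
      (abs_real_inner_le_norm d p').trans (mul_le_mul_of_nonneg_left hp' (norm_nonneg d))
    calc 2 * γ * (D * k + D') * ⟪d, p'⟫ = 2 * γ * ((D * k + D') * ⟪d, p'⟫) := by ring
      _ ≤ 2 * γ * (|D * k + D'| * |⟪d, p'⟫|) := by
        rw [← abs_mul]
        exact mul_le_mul_of_nonneg_left (le_abs_self _) (by positivity)
      _ ≤ 2 * γ * ((|D| + |D'|) * k * (‖d‖ * (γ * L * ‖Δ‖))) := by gcongr
      _ = _ := by ring
  have hsq : c * γ ^ 2 * √((2 - s) * k + 2 * (α - c)) * ‖v‖ ^ 2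
      ≤ δ / 2 * k * (‖d‖ ^ 2 + ‖v‖ ^ 2) := by
    have h1 : c * γ ^ 2 * √((2 - s) * k + 2 * (α - c)) ≤ c * γ ^ 2 * (δ / 2 / (c * γ ^ 2) * k) := by
      gcongr
    have h2 : c * γ ^ 2 * (δ / 2 / (c * γ ^ 2) * k) = δ / 2 * k := by field_simp
    rw [h2] at h1
    exact mul_le_mul h1 (le_add_of_nonneg_left (sq_nonneg _)) (sq_nonneg _) (by positivity)
  have hΔ := mul_le_mul_of_nonneg_right hk (sq_nonneg ‖Δ‖)
  have hy1 : C₁ * (‖a - d‖ * ‖Δ‖)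
      ≤ C₁ ^ 2 / (4 * η) / k ^ 2 * ‖a - d‖ ^ 2 + η * k ^ 2 * ‖Δ‖ ^ 2 := by
    have h1 : 0 ≤ (C₁ * ‖a - d‖ / k - 2 * η * k * ‖Δ‖) ^ 2 / (4 * η) := by positivity
    have h2 : (C₁ * ‖a - d‖ / k - 2 * η * k * ‖Δ‖) ^ 2 / (4 * η)
        = C₁ ^ 2 / (4 * η) / k ^ 2 * ‖a - d‖ ^ 2 + η * k ^ 2 * ‖Δ‖ ^ 2
          - C₁ * (‖a - d‖ * ‖Δ‖) := by field_simp; ring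
    linarith only [h1, h2]
  have hy2 : C₂ * k * (‖d‖ * ‖Δ‖) ≤ C₂ ^ 2 / (4 * η) * ‖d‖ ^ 2 + η * k ^ 2 * ‖Δ‖ ^ 2 := by
    have h1 : 0 ≤ (C₂ * ‖d‖ - 2 * η * k * ‖Δ‖) ^ 2 / (4 * η) := by positivity
    have h2 : (C₂ * ‖d‖ - 2 * η * k * ‖Δ‖) ^ 2 / (4 * η)
        = C₂ ^ 2 / (4 * η) * ‖d‖ ^ 2 + η * k ^ 2 * ‖Δ‖ ^ 2 - C₂ * k * (‖d‖ * ‖Δ‖) := by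
      field_simp; ring
    linarith only [h1, h2]
  have hk3' := mul_le_mul_of_nonneg_right hk3
    (add_nonneg (sq_nonneg ‖d‖) (sq_nonneg ‖v‖))
  have hv0 : 0 ≤ C₂ ^ 2 / (4 * η) * ‖v‖ ^ 2 := by positivity
  have hd0 : 0 ≤ (4 * μ + 2 * μ ^ 2 + 2 * lam * μ) * ‖d‖ ^ 2 := by positivity
  have hη0 : 0 ≤ η * k ^ 2 * ‖Δ‖ ^ 2 := by positivity
  have hC₂' : C₂ * k * (‖d‖ * ‖Δ‖) = C₁ * k * (‖d‖ * ‖Δ‖)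
      + 2 * γ * (|D| + |D'|) * (γ * L) * k * (‖d‖ * ‖Δ‖) := by
    rw [hC₂]; ring
  rw [hC₃] at hk3'
  linarith only [hmain, hQ, hB1, hB2, hav', hdp, hsq, hΔ, hy1, hy2, hk3', hv0, hd0, hη0,
    hC₂']

theorem exists_abs_energyCorrection_le {s α c γ L : ℝ} (hL : 0 < L) (hγ : 0 < γ) (hs2 : s < 2)
    (hc : 0 < c) (hcα : c < α) :
    ∃ C ≥ 0, ∀ k : ℝ, 1 ≤ k → ∀ d p Δ : H, ‖p‖ ≤ γ * L * ‖Δ‖ →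
      |energyCorrection s α c γ L k d p Δ|
        ≤ C * ((k * ‖d‖) * (k * ‖Δ‖) + (k * ‖Δ‖) ^ 2) := by
  have hα := sub_pos.2 hcα
  have hs := sub_pos.2 hs2
  set b := (2 - s) + 2 * (α - c) with hb
  have hb0 : 0 < b := by positivity
  refine ⟨2 * γ * b * (γ * L) + γ ^ 3 * L * b * (1 + (α - c) + c * γ * L * √b), by positivity, ?_⟩
  intro k hk d p Δ hp
  have hk0 : 0 < k := by linarith
  set β := (2 - s) * k + 2 * (α - c) with hβ
  have hβ0 : 0 < β := by positivity
  have hβb : β ≤ b * k := by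
    rw [hβ, hb]
    nlinarith
  have hσ : √β ≤ √b * k := by
    rw [Real.sqrt_le_iff]
    refine ⟨by positivity, hβb.trans ?_⟩
    rw [mul_pow, Real.sq_sqrt hb0.le]
    gcongr
    nlinarith
  have hdp : |⟪d, p⟫| ≤ ‖d‖ * (γ * L * ‖Δ‖) :=
    (abs_real_inner_le_norm d p).trans (mul_le_mul_of_nonneg_left hp (norm_nonneg d))
  have hlin : k + α - c + c * γ * L * √β ≤ (1 + (α - c) + c * γ * L * √b) * k := by
    have h1 : c * γ * L * √β ≤ c * γ * L * (√b * k) := by gcongr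
    nlinarith
  have hlin0 : 0 ≤ k + α - c + c * γ * L * √β := by
    have : 0 ≤ c * γ * L * √β := by positivity
    linarith
  have h1 : |2 * γ * β * k * ⟪d, p⟫|
      ≤ 2 * γ * b * (γ * L) * ((k * ‖d‖) * (k * ‖Δ‖)) := by
    rw [abs_mul, abs_of_nonneg (show 0 ≤ 2 * γ * β * k by positivity)]
    calc 2 * γ * β * k * |⟪d, p⟫| ≤ 2 * γ * (b * k) * k * (‖d‖ * (γ * L * ‖Δ‖)) := by gcongr
      _ = _ := by ring
  have h2 : |γ ^ 3 * L * β * (k + α - c + c * γ * L * √β) * ‖Δ‖ ^ 2|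
      ≤ γ ^ 3 * L * b * (1 + (α - c) + c * γ * L * √b) * (k * ‖Δ‖) ^ 2 := by
    rw [abs_of_nonneg (by positivity)]
    calc γ ^ 3 * L * β * (k + α - c + c * γ * L * √β) * ‖Δ‖ ^ 2
        ≤ γ ^ 3 * L * (b * k) * ((1 + (α - c) + c * γ * L * √b) * k) * ‖Δ‖ ^ 2 := by gcongr
      _ = _ := by ring
  have h3 : 0 ≤ γ ^ 3 * L * b * (1 + (α - c) + c * γ * L * √b) * ((k * ‖d‖) * (k * ‖Δ‖)) := by
    positivity
  have h4 : 0 ≤ 2 * γ * b * (γ * L) * (k * ‖Δ‖) ^ 2 := by positivity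
  rw [energyCorrection, ← hβ]
  refine (abs_add_le _ _).trans ?_
  rw [abs_neg]
  linarith only [h1, h2, h3, h4]

end Energy

theorem exists_interval_of_step_params {α c s : ℝ} (hcl : α / 2 < c) (hcu : c < α - 1)
    (hs1 : 1 + α / (4 * c - α) < s) (hs2 : s < 2) :
    ∃ lo hi : ℝ, 0 ≤ lo ∧ lo < hi ∧ hi ≤ s * α / 4 ∧ ∀ lam, lo < lam → lam < hi →
      (lam + s - c - s * α / 2) ^ 2 < 2 * s * (c - 1) * (α - 1 - lam) := by
  have h4 : 0 < 4 * c - α := by linarith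
  have hs : 4 * c < s * (4 * c - α) := by
    have h := mul_lt_mul_of_pos_right hs1 h4
    rw [add_mul, div_mul_cancel₀ _ h4.ne'] at h
    linarith
  have hs0 : 0 < s := by
    have : 0 < α / (4 * c - α) := div_pos (by linarith) h4
    linarith
  set m := c - s * (c - α / 2) with hm
  have hm0 : 0 < m := by nlinarith
  have hm1 : m < s * α / 4 := by rw [hm]; linarith
  have hmid : (m + s - c - s * α / 2) ^ 2 < 2 * s * (c - 1) * (α - 1 - m) := by
    have h1 : 0 < s * (c - 1) * ((2 - s) * (α - 1 - c)) :=
      mul_pos (mul_pos hs0 (by linarith)) (mul_pos (by linarith) (by linarith))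
    have h2 : 2 * s * (c - 1) * (α - 1 - m) - (m + s - c - s * α / 2) ^ 2
        = s * (c - 1) * ((2 - s) * (α - 1 - c)) := by rw [hm]; ring
    linarith
  have hopen : IsOpen {x : ℝ | (x + s - c - s * α / 2) ^ 2 < 2 * s * (c - 1) * (α - 1 - x)} :=
    isOpen_lt (by fun_prop) (by fun_prop)
  obtain ⟨l, u, ⟨hl, hu⟩, hsub⟩ := mem_nhds_iff_exists_Ioo_subset.1 (hopen.mem_nhds hmid)
  refine ⟨max l 0, min u (s * α / 4), le_max_right _ _,
    (max_lt hl hm0).trans (lt_min hu hm1), min_le_right _ _, fun x hx1 hx2 => ?_⟩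
  exact hsub ⟨(le_max_left _ _).trans_lt hx1, hx2.trans_le (min_le_left _ _)⟩

theorem stmt_8
    {H : Type*} [NormedAddCommGroup H] [InnerProductSpace ℝ H] [CompleteSpace H]
    (M : H → Set H) (F : H → H) (L α c γ : ℝ)
    (hM : ∀ z y u' v', u' ∈ M z → v' ∈ M y → 0 ≤ ⟪v' - u', y - z⟫)
    (hFmono : ∀ z y, 0 ≤ ⟪F y - F z, y - z⟫)
    (hL : 0 < L)
    (hFlip : ∀ z y, ‖F y - F z‖ ≤ L * ‖y - z‖)
    (hα : 2 < α) (hcl : α / 2 < c) (hcu : c < α - 1)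
    (hγ0 : 0 < γ) (hγ : γ < 1 / (2 * L))
    (z w ξ v : ℕ → H)
    (hξ : ∀ k : ℕ, 1 ≤ k → ξ k ∈ M (z k))
    (hv : ∀ k : ℕ, 1 ≤ k → v k = ξ k + F (w (k - 1)))
    (hw : ∀ k : ℕ, 1 ≤ k →
      w k = z k + ((k : ℝ) / ((k : ℝ) + α)) • (z k - z (k - 1)) - ((c / ((k : ℝ) + α)) * γ) • v k)
    (hz : ∀ k : ℕ, 1 ≤ k → z (k + 1) = w k - γ • (v (k + 1) - v k))
    (zs : H) (hzs : -F zs ∈ M zs)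
    (E : ℝ → ℝ → ℕ → ℝ)
    (hE : ∀ lam s : ℝ, ∀ k : ℕ, 1 ≤ k → E lam s k =
      (1 / 2) * ‖(2 * lam) • (z k - zs) + (2 * (k : ℝ)) • (z k - z (k - 1)) + (s * γ * (k : ℝ)) • v k‖ ^ 2
      + 2 * lam * (α - 1 - lam) * ‖z k - zs‖ ^ 2
      + 2 * lam * γ * ((2 - s) * (k : ℝ) + 2 * (α - c)) * ⟪z k - zs, v k⟫
      + (1 / 2) * γ ^ 2 * ((2 - s) * (k : ℝ) + 2 * (α - c)) * (s * (k : ℝ) + 2 * c) * ‖v k‖ ^ 2)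
    (G : ℝ → ℝ → ℕ → ℝ)
    (hG : ∀ lam s : ℝ, ∀ k : ℕ, 2 ≤ k → G lam s k =
      E lam s k - 2 * γ * ((2 - s) * (k : ℝ) + 2 * (α - c)) * (k : ℝ)
          * ⟪z k - z (k - 1), F (z k) - F (w (k - 1))⟫
      + γ ^ 3 * L * ((2 - s) * (k : ℝ) + 2 * (α - c))
        * ((k : ℝ) + α - c + c * γ * L * Real.sqrt ((2 - s) * (k : ℝ) + 2 * (α - c)))
        * ‖v k - v (k - 1)‖ ^ 2) :
    ∀ s : ℝ, 1 + α / (4 * c - α) < s → s < 2 →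
      ∃ lo hi : ℝ, 0 ≤ lo ∧ lo < hi ∧ hi ≤ s * α / 4 ∧
        ∀ lam : ℝ, lo < lam → lam < hi →
          (∃ e : ℝ, Tendsto (fun k : ℕ => E lam s k) atTop (nhds e)) ∧
          (∃ g : ℝ, Tendsto (fun k : ℕ => G lam s k) atTop (nhds g)) := by
  intro s hs1 hs2
  obtain ⟨lo, hi, hlo, hlohi, hhi, hint⟩ := exists_interval_of_step_params hcl hcu hs1 hs2
  refine ⟨lo, hi, hlo, hlohi, hhi, fun lam hlam1 hlam2 => ?_⟩
  have hγL : γ * L < 1 / 2 := by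
    rw [lt_div_iff₀ (by positivity)] at hγ
    linarith
  have hs0 : 0 < s := by
    have : 0 < α / (4 * c - α) := div_pos (by linarith) (by linarith)
    linarith
  have hc : 1 < c := by linarith
  have hcα : c < α := by linarith
  have hlam0 : 0 < lam := by linarith
  obtain ⟨δ, hδ, hlower⟩ := exists_pos_le_energy_add_correction (H := H) (lam := lam) hL hγ0 hγL
    hs0 hs2 (by linarith) hcα hlam0 (by nlinarith)
  obtain ⟨C, hC, η, hη, hdesc⟩ := exists_energy_add_correction_step_le (H := H) (lam := lam)
    hL hγ0 hγL hs0 hs2 hc hcα hlam0 (by nlinarith) (hint lam hlam1 hlam2)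
  obtain ⟨B, hB, hcorr⟩ := exists_abs_energyCorrection_le (H := H) hL hγ0 hs2
    (by linarith : 0 < c) hcα
  obtain ⟨K, hK⟩ := eventually_atTop.1 ((eventually_ge_atTop 2).and
    ((tendsto_natCast_atTop_atTop (R := ℝ)).eventually (hlower.and hdesc)))
  have hK2 : 2 ≤ K := (hK K le_rfl).1
  have hEk : ∀ k : ℕ, 1 ≤ k →
      E lam s k = energy lam s α c γ k (z k - zs) (z k - z (k - 1)) (v k) := fun k hk => by
    rw [hE lam s k hk, energy]
  have hGk : ∀ k : ℕ, 2 ≤ k → G lam s k =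
      energy lam s α c γ k (z k - zs) (z k - z (k - 1)) (v k)
      + energyCorrection s α c γ L k (z k - z (k - 1)) (F (z k) - F (w (k - 1)))
          (v k - v (k - 1)) := fun k hk => by
    rw [hG lam s k hk, hEk k (by omega), energyCorrection]
    ring
  have hp : ∀ k : ℕ, 1 ≤ k → ‖F (z (k + 1)) - F (w k)‖ ≤ γ * L * ‖v (k + 1) - v k‖ := by
    intro k hk
    refine (hFlip _ _).trans ?_
    rw [hz k hk, sub_sub_cancel_left, norm_neg, norm_smul, Real.norm_of_nonneg hγ0.le]
    linarith
  have hp' : ∀ k : ℕ, 2 ≤ k → ‖F (z k) - F (w (k - 1))‖ ≤ γ * L * ‖v k - v (k - 1)‖ := by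
    intro k hk
    have := hp (k - 1) (by omega)
    rwa [Nat.sub_add_cancel (by omega : 1 ≤ k)] at this
  have hlow : ∀ k : ℕ, K ≤ k → δ * (‖z k - zs‖ ^ 2 + (k : ℝ) ^ 2 * ‖z k - z (k - 1)‖ ^ 2)
      ≤ G lam s k := fun k hk => by
    rw [hGk k (hK2.trans hk)]
    exact (hK k hk).2.1 _ _ _ _ _ (hp' k (hK2.trans hk))
  have hstep : ∀ k : ℕ, K ≤ k → G lam s (k + 1) ≤
      G lam s k + C / (k : ℝ) ^ 2 * ‖z k - zs‖ ^ 2 - η * (k : ℝ) ^ 2 * ‖v (k + 1) - v k‖ ^ 2 := by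
    intro k hk
    have hk2 : 2 ≤ k := hK2.trans hk
    have hk1 : 1 ≤ k := by omega
    have hkα : (k : ℝ) + α ≠ 0 := by positivity
    have hrel : (k : ℝ) • (z k - z (k - 1)) = ((k : ℝ) + α) • (z (k + 1) - z k)
        + (γ * ((k : ℝ) + α)) • (v (k + 1) - v k)
        + (c * γ) • (v (k + 1) - (v (k + 1) - v k)) := by
      rw [hz k hk1, hw k hk1]
      match_scalars <;> field_simp <;> ring
    have hmono : ⟪z (k + 1) - z k, F (z k) - F (w (k - 1))⟫
        - ⟪z (k + 1) - z k, F (z (k + 1)) - F (w k)⟫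
        ≤ ⟪z (k + 1) - z k, v (k + 1) - v k⟫ := by
      have h1 := hM _ _ _ _ (hξ k hk1) (hξ (k + 1) (by omega))
      have h2 := hFmono (z k) (z (k + 1))
      rw [real_inner_comm] at h1 h2
      rw [hv k hk1, hv (k + 1) (by omega), Nat.add_sub_cancel]
      simp only [inner_sub_right, inner_add_right] at h1 h2 ⊢
      linarith
    have hav : -(γ * L * (‖z (k + 1) - zs‖ * ‖v (k + 1) - v k‖))
        ≤ ⟪z (k + 1) - zs, v (k + 1)⟫ := by
      have h1 := hM _ _ _ _ hzs (hξ (k + 1) (by omega))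
      have h2 := hFmono zs (z (k + 1))
      have h3 := (real_inner_le_norm (z (k + 1) - zs) (F (z (k + 1)) - F (w k))).trans
        (mul_le_mul_of_nonneg_left (hp k hk1) (norm_nonneg _))
      rw [real_inner_comm] at h1 h2
      rw [show v (k + 1) = ξ (k + 1) + F (w k) by rw [hv (k + 1) (by omega), Nat.add_sub_cancel]]
        at h3 ⊢
      simp only [inner_sub_right, inner_add_right, inner_neg_right] at h1 h2 h3 ⊢
      linarith
    have h := (hK k hk).2.2 _ _ _ _ _ _ _ _ hrel (hp' k hk2) (hp k hk1) hmono hav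
    rw [hGk k hk2, hGk (k + 1) (by omega)]
    rw [sub_sub_sub_cancel_left, sub_sub_cancel] at h
    simpa only [Nat.cast_add, Nat.cast_one, Nat.add_sub_cancel] using h
  obtain ⟨⟨l, hl⟩, hr⟩ := exists_tendsto_of_le_one_add_mul_sub
    (g := fun n => G lam s (n + K)) (ε := fun n => C / δ * (1 / ((n + K : ℕ) : ℝ) ^ 2))
    (r := fun n => η * ((n + K : ℕ) : ℝ) ^ 2 * ‖v (n + K + 1) - v (n + K)‖ ^ 2)
    (fun n => le_trans (by positivity) (hlow (n + K) (by omega)))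
    (fun n => by positivity) (fun n => by positivity)
    (((summable_nat_add_iff K).2 (Real.summable_one_div_nat_pow.2 one_lt_two)).mul_left _)
    (fun n => by
      have h1 := hstep (n + K) (by omega)
      have h2 := hlow (n + K) (by omega)
      have h3 : δ * ‖z (n + K) - zs‖ ^ 2 ≤ G lam s (n + K) := by
        refine le_trans ?_ h2
        gcongr
        exact le_add_of_nonneg_right (by positivity)
      have h4 : C / ((n + K : ℕ) : ℝ) ^ 2 * ‖z (n + K) - zs‖ ^ 2
          ≤ C / δ * (1 / ((n + K : ℕ) : ℝ) ^ 2) * G lam s (n + K) := by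
        calc C / ((n + K : ℕ) : ℝ) ^ 2 * ‖z (n + K) - zs‖ ^ 2
            = C / δ * (1 / ((n + K : ℕ) : ℝ) ^ 2) * (δ * ‖z (n + K) - zs‖ ^ 2) := by
              field_simp
          _ ≤ _ := by gcongr
      rw [show n + 1 + K = n + K + 1 by ring]
      linarith)
  have hGlim : Tendsto (fun k => G lam s k) atTop (nhds l) := (tendsto_add_atTop_iff_nat K).1 hl
  have hΔ : Tendsto (fun k : ℕ => (k : ℝ) * ‖v k - v (k - 1)‖) atTop (nhds 0) := by
    rw [← tendsto_add_atTop_iff_nat (K + 1)]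
    have h0 := (hr.const_mul (4 / η)).sqrt
    rw [mul_zero, Real.sqrt_zero] at h0
    refine squeeze_zero (fun n => by positivity) (fun n => ?_) h0
    apply Real.le_sqrt_of_sq_le
    rw [show n + (K + 1) = n + K + 1 by ring, Nat.add_sub_cancel]
    have h1 : (1 : ℝ) ≤ ((n + K : ℕ) : ℝ) := by exact_mod_cast (by omega : 1 ≤ n + K)
    calc (((n + K + 1 : ℕ) : ℝ) * ‖v (n + K + 1) - v (n + K)‖) ^ 2
        ≤ ((2 * ((n + K : ℕ) : ℝ)) * ‖v (n + K + 1) - v (n + K)‖) ^ 2 := by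
          gcongr
          push_cast at h1 ⊢
          linarith
      _ = _ := by field_simp; ring
  have hcorr0 : Tendsto (fun k : ℕ => energyCorrection s α c γ L k (z k - z (k - 1))
      (F (z k) - F (w (k - 1))) (v k - v (k - 1))) atTop (nhds 0) := by
    have hbd : Tendsto (fun k : ℕ => B * (√((l + 1) / δ) * ((k : ℝ) * ‖v k - v (k - 1)‖)
        + ((k : ℝ) * ‖v k - v (k - 1)‖) ^ 2)) atTop (nhds 0) := by
      simpa using ((hΔ.const_mul (√((l + 1) / δ))).add (hΔ.pow 2)).const_mul B
    refine squeeze_zero_norm' ?_ hbd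
    filter_upwards [eventually_ge_atTop K, hGlim.eventually_le_const (lt_add_one l)] with k hk hGl
    have hk1 : (1 : ℝ) ≤ k := by exact_mod_cast (by omega : 1 ≤ k)
    have hd : (k : ℝ) * ‖z k - z (k - 1)‖ ≤ √((l + 1) / δ) := by
      apply Real.le_sqrt_of_sq_le
      rw [le_div_iff₀ hδ, mul_pow]
      have h1 := hlow k hk
      have h2 : 0 ≤ δ * ‖z k - zs‖ ^ 2 := by positivity
      linarith
    refine (hcorr k hk1 _ _ _ (hp' k (hK2.trans hk))).trans ?_
    gcongr
  refine ⟨⟨l, ?_⟩, ⟨l, hGlim⟩⟩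
  have h := hGlim.sub hcorr0
  rw [sub_zero] at h
  refine h.congr' ?_
  filter_upwards [eventually_ge_atTop 2] with k hk
  rw [hGk k hk, hEk k (by omega)]
  ring
end
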